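/- Let K: ℝ^{2n+1} → ℝ be continuous and cylindrically symmetric with finite limit K(∞) = lim_{|(z,t)|→∞} K(z,t), and positive at some point. Let S = inf{ ∫_{ℝ^{2n+1}} |∇_{ℍⁿ}v|² dz dt : v ∈ C_c^∞(ℝ^{2n+1}), (∫ |v|^{Q*})^{2/Q*} = 1 } and assume S > 0. Set δ = sup{ max(K(0,t), 0) : t ∈ ℝ }, let M = { u ∈ L^{Q*}(ℝ^{2n+1}) : u cylindrically symmetric, u has weak horizontal gradient G ∈ L², ∫ |G|² = 1, ∫ K |u|^{Q*} > 0 }, and for u ∈ M let F_K(u) = (∫ K |u|^{Q*})^{−(Q−2)/2}. Assume M is nonempty, and assume in addition: if δ > 0, there exists V ∈ M with F_K(V) ≤ δ^{−(Q−2)/2} S^{Q/2}. Then the infimum of F_K over M is attained, i.e. there exists u ∈ M with F_K(u) = inf_{v∈M} F_K(v). -/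

import Mathlib

open MeasureTheory Filter Topology

noncomputable section

/-- Points of the Heisenberg group `ℍⁿ ≅ ℝⁿ × ℝⁿ × ℝ`, written `(x, y, t)`. -/
abbrev Pt (n : ℕ) : Type := (Fin n → ℝ) × (Fin n → ℝ) × ℝ

namespace Heis

/-- Unit vector in the `x_j` direction. -/
def ex (n : ℕ) (j : Fin n) : Pt n := (Pi.single j 1, 0, 0)

/-- Unit vector in the `y_j` direction. -/
def ey (n : ℕ) (j : Fin n) : Pt n := (0, Pi.single j 1, 0)

/-- Unit vector in the `t` direction. -/
def et (n : ℕ) : Pt n := (0, 0, 1)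

/-- The left-invariant vector field `X_j u = ∂u/∂x_j + 2 y_j ∂u/∂t`. -/
def Xd (n : ℕ) (j : Fin n) (u : Pt n → ℝ) (p : Pt n) : ℝ :=
  fderiv ℝ u p (ex n j) + 2 * p.2.1 j * fderiv ℝ u p (et n)

/-- The left-invariant vector field `Y_j u = ∂u/∂y_j - 2 x_j ∂u/∂t`. -/
def Yd (n : ℕ) (j : Fin n) (u : Pt n → ℝ) (p : Pt n) : ℝ :=
  fderiv ℝ u p (ey n j) - 2 * p.1 j * fderiv ℝ u p (et n)

/-- The Kohn Laplacian `Δ_{ℍⁿ} u = Σ_j (X_j² u + Y_j² u)`. -/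
def kohn (n : ℕ) (u : Pt n → ℝ) (p : Pt n) : ℝ :=
  ∑ j, (Xd n j (Xd n j u) p + Yd n j (Yd n j u) p)

/-- `|z|` for `p = (x, y, t)`, i.e. the Euclidean norm of `(x, y)`. -/
def znorm (n : ℕ) (p : Pt n) : ℝ :=
  Real.sqrt (∑ j, (p.1 j) ^ 2 + ∑ j, (p.2.1 j) ^ 2)

/-- Cylindrical symmetry: `u (z, t)` depends only on `(|z|, t)`. -/
def IsCyl (n : ℕ) (u : Pt n → ℝ) : Prop :=
  ∃ v : ℝ → ℝ → ℝ, ∀ p : Pt n, u p = v (znorm n p) p.2.2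

/-- Homogeneous dimension `Q = 2n + 2`. -/
def Qh (n : ℕ) : ℝ := 2 * n + 2

/-- Critical exponent `Q* = 2Q/(Q-2)`. -/
def Qs (n : ℕ) : ℝ := 2 * Qh n / (Qh n - 2)

/-- Smooth compactly supported test functions. -/
def TestFun (n : ℕ) (φ : Pt n → ℝ) : Prop :=
  ContDiff ℝ (⊤ : ℕ∞) φ ∧ HasCompactSupport φ

/-- Pointwise inner product of horizontal gradients `∇_{ℍⁿ}u · ∇_{ℍⁿ}v`. -/
def hDot (n : ℕ) (u v : Pt n → ℝ) (p : Pt n) : ℝ :=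
  ∑ j, (Xd n j u p * Xd n j v p + Yd n j u p * Yd n j v p)

/-- `|∇_{ℍⁿ}u|²`. -/
def hGradSq (n : ℕ) (u : Pt n → ℝ) (p : Pt n) : ℝ := hDot n u u p

/-- `G = (Gx, Gy)` is the weak horizontal gradient of `u`, and is in `L²`. -/
def HasWeakHGrad (n : ℕ) (u : Pt n → ℝ)
    (G : Pt n → (Fin n → ℝ) × (Fin n → ℝ)) : Prop :=
  (∀ j : Fin n, MemLp (fun p => (G p).1 j) 2 volume ∧
      MemLp (fun p => (G p).2 j) 2 volume) ∧
  ∀ φ : Pt n → ℝ, TestFun n φ → ∀ j : Fin n,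
    (∫ p : Pt n, u p * Xd n j φ p = -∫ p : Pt n, (G p).1 j * φ p) ∧
    (∫ p : Pt n, u p * Yd n j φ p = -∫ p : Pt n, (G p).2 j * φ p)

/-- `G · ∇_{ℍⁿ}φ` pointwise. -/
def gDot (n : ℕ) (G : Pt n → (Fin n → ℝ) × (Fin n → ℝ)) (φ : Pt n → ℝ)
    (p : Pt n) : ℝ :=
  ∑ j, ((G p).1 j * Xd n j φ p + (G p).2 j * Yd n j φ p)

/-- `u` is a positive cylindrically symmetric finite-energy weak solution of
`-Δ_{ℍⁿ} u = K u^{Q*-1}`. -/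
def IsWeakSol (n : ℕ) (K u : Pt n → ℝ) : Prop :=
  IsCyl n u ∧ MemLp u (ENNReal.ofReal (Qs n)) volume ∧
  (∀ᵐ p : Pt n, 0 < u p) ∧
  ∃ G : Pt n → (Fin n → ℝ) × (Fin n → ℝ), HasWeakHGrad n u G ∧
    ∀ φ : Pt n → ℝ, TestFun n φ →
      ∫ p : Pt n, gDot n G φ p = ∫ p : Pt n, K p * u p ^ (Qs n - 1) * φ p

/-- The standard bubble `U_{μ,s}`. -/
def bubble (n : ℕ) (μ s : ℝ) (p : Pt n) : ℝ :=
  μ ^ (-(Qh n - 2) / 2) *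
    (((p.2.2 - s) / μ ^ 2) ^ 2 + (1 + (znorm n p) ^ 2 / μ ^ 2) ^ 2)
      ^ (-(Qh n - 2) / 4)

/-- Local Hölder continuity of an uncurried function of two real variables on a set. -/
def LocHolderOn (f : ℝ → ℝ → ℝ) (s : Set (ℝ × ℝ)) : Prop :=
  ∀ x ∈ s, ∃ t ∈ nhdsWithin x s, ∃ C α : NNReal, 0 < α ∧
    HolderOnWith C α (fun q : ℝ × ℝ => f q.1 q.2) t

/-- `K` is cylindrically symmetric, `K(z,t) = K̃(|z|,t)`, with `K̃` locally Hölder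
continuous on `(0,∞) × ℝ`. -/
def CylHolder (n : ℕ) (K : Pt n → ℝ) : Prop :=
  ∃ Kt : ℝ → ℝ → ℝ, (∀ p : Pt n, K p = Kt (znorm n p) p.2.2) ∧
    LocHolderOn Kt (Set.Ioi 0 ×ˢ Set.univ)

/-- The standard solution `ω(z,t) = (Q-2)^{(Q-2)/2} (t² + (1+|z|²)²)^{-(Q-2)/4}`. -/
def omegaFun (n : ℕ) (p : Pt n) : ℝ :=
  (Qh n - 2) ^ ((Qh n - 2) / 2) *
    (p.2.2 ^ 2 + (1 + (znorm n p) ^ 2) ^ 2) ^ (-(Qh n - 2) / 4)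

end Heis
namespace Heis

/-- The Cayley transform `F : S^{2n+1} ∖ {(0,…,0,-1)} → ℍⁿ`. -/
def cayley (n : ℕ) (ζ : Fin (n + 1) → ℂ) : Pt n :=
  (fun j => (ζ j.castSucc / (1 + ζ (Fin.last n))).re,
   fun j => (ζ j.castSucc / (1 + ζ (Fin.last n))).im,
   (Complex.I * (1 - ζ (Fin.last n)) / (1 + ζ (Fin.last n))).re)

/-- The partial Laplacian `Δ_{x,y} k = Σ_i (∂²k/∂x_i² + ∂²k/∂y_i²)`. -/
def lapXY (n : ℕ) (k : Pt n → ℝ) (p : Pt n) : ℝ :=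
  ∑ j, (fderiv ℝ (fun q => fderiv ℝ k q (ex n j)) p (ex n j)
      + fderiv ℝ (fun q => fderiv ℝ k q (ey n j)) p (ey n j))

/-- The rescaling operator `(𝒰_{μ,s} u)(z,t) = μ^{-(Q-2)/2} u(z/μ, (t-s)/μ²)`. -/
def rescale (n : ℕ) (μ s : ℝ) (u : Pt n → ℝ) (p : Pt n) : ℝ :=
  μ ^ (-(Qh n - 2) / 2) *
    u (fun j => p.1 j / μ, fun j => p.2.1 j / μ, (p.2.2 - s) / μ ^ 2)

/-- The point `(μ z, μ² t + s)`. -/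
def scalePt (n : ℕ) (μ s : ℝ) (p : Pt n) : Pt n :=
  (fun j => μ * p.1 j, fun j => μ * p.2.1 j, μ ^ 2 * p.2.2 + s)

/-- The reduced functional `Γ(μ,s) = (1/Q*) ∫ k(μz, μ²t+s) ω^{Q*}`. -/
def Gam (n : ℕ) (k : Pt n → ℝ) (μ s : ℝ) : ℝ :=
  (1 / Qs n) * ∫ p : Pt n, k (scalePt n μ s p) * omegaFun n p ^ Qs n

/-- The Heisenberg group law
`(x,y,t) ∘ (x',y',t') = (x+x', y+y', t+t'+2x'·y-2x·y')`. -/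
def heisMul (n : ℕ) (a b : Pt n) : Pt n :=
  (fun j => a.1 j + b.1 j, fun j => a.2.1 j + b.2.1 j,
   a.2.2 + b.2.2 + 2 * (∑ j, b.1 j * a.2.1 j) - 2 * (∑ j, a.1 j * b.2.1 j))

end Heis

open Heis

namespace HeisAux
open ENNReal

section gen
set_option linter.unusedSectionVars false
set_option linter.style.haveILetI false
variable {E : Type*} [NormedAddCommGroup E] [NormedSpace ℝ E] [FiniteDimensional ℝ E]
  [MeasurableSpace E] [BorelSpace E] {μ : Measure E} [μ.IsAddHaarMeasure]

/-- Minkowski-type inequality. -/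
lemma jensen_aux {k F : E → ℝ≥0∞} (hk : Measurable k) (hF : Measurable F) {r : ℝ} (hr : 1 ≤ r) :
    (∫⁻ h, k h * F h ∂μ) ^ r ≤ (∫⁻ h, k h ∂μ) ^ (r - 1) * ∫⁻ h, k h * F h ^ r ∂μ := by
  rcases eq_or_lt_of_le hr with rfl | hr1
  · simp
  have hpq : r.HolderConjugate (r / (r - 1)) := Real.HolderConjugate.conjExponent hr1
  have h0 : (0:ℝ) < r := by linarith
  have := ENNReal.lintegral_mul_le_Lp_mul_Lq μ hpq (f := fun h => k h ^ (1 / r) * F h)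
    (g := fun h => k h ^ (1 - 1 / r)) ((hk.pow_const _).mul hF).aemeasurable
    (hk.pow_const _).aemeasurable
  have e1 : ∀ h, ((fun h => k h ^ (1 / r) * F h) * (fun h => k h ^ (1 - 1 / r))) h = k h * F h := by
    intro h
    simp only [Pi.mul_apply]
    rw [mul_right_comm, ← ENNReal.rpow_add_of_nonneg _ _ (by positivity)
      (by rw [sub_nonneg, div_le_one h0]; exact hr)]
    simp
  have e2 : ∀ h, (k h ^ (1 / r) * F h) ^ r = k h * F h ^ r := by
    intro h
    rw [ENNReal.mul_rpow_of_nonneg _ _ h0.le, ← ENNReal.rpow_mul]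
    simp [h0.ne']
  have hc : (1 - 1 / r) * (r / (r - 1)) = 1 := by
    have : r - 1 ≠ 0 := by linarith
    field_simp
  have e3 : ∀ h, (k h ^ (1 - 1 / r)) ^ (r / (r - 1)) = k h := by
    intro h
    rw [← ENNReal.rpow_mul, hc]; simp
  simp only [e1, e2, e3] at this
  calc (∫⁻ h, k h * F h ∂μ) ^ r ≤ ((∫⁻ h, k h * F h ^ r ∂μ) ^ (1 / r) *
        (∫⁻ h, k h ∂μ) ^ (1 / (r / (r - 1)))) ^ r := ENNReal.rpow_le_rpow this h0.le
    _ = _ := by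
      rw [ENNReal.mul_rpow_of_nonneg _ _ h0.le, ← ENNReal.rpow_mul, ← ENNReal.rpow_mul, mul_comm]
      congr 2
      · have : r - 1 ≠ 0 := by linarith
        field_simp
      · rw [one_div, inv_mul_cancel₀ h0.ne', ENNReal.rpow_one]

lemma mink_aux {κ : E → ℝ} (hκ : Measurable κ) {f : E → E → ℝ}
    (hf : Measurable (Function.uncurry f)) {r : ℝ} (hr : 1 ≤ r) {ε : ℝ≥0∞}
    (h : ∀ x, κ x ≠ 0 → eLpNorm (f x) (ENNReal.ofReal r) μ ≤ ε) :
    eLpNorm (fun p => ∫ x, κ x * f x p ∂μ) (ENNReal.ofReal r) μ ≤ (∫⁻ x, ‖κ x‖ₑ ∂μ) * ε := by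
  have h0 : (0:ℝ) < r := by linarith
  have hr0 : ENNReal.ofReal r ≠ 0 := by simpa using h0
  have hrt : ENNReal.ofReal r ≠ ⊤ := ENNReal.ofReal_ne_top
  have hrr : (ENNReal.ofReal r).toReal = r := ENNReal.toReal_ofReal h0.le
  rw [eLpNorm_eq_lintegral_rpow_enorm_toReal hr0 hrt, hrr]
  rw [one_div, ENNReal.rpow_inv_le_iff h0]
  have hfe : Measurable fun z : E × E => ‖f z.1 z.2‖ₑ := hf.enorm
  calc ∫⁻ p, ‖∫ x, κ x * f x p ∂μ‖ₑ ^ r ∂μ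
      ≤ ∫⁻ p, (∫⁻ x, ‖κ x‖ₑ ∂μ) ^ (r - 1) * ∫⁻ x, ‖κ x‖ₑ * ‖f x p‖ₑ ^ r ∂μ ∂μ := by
        refine lintegral_mono fun p => ?_
        refine le_trans (ENNReal.rpow_le_rpow (enorm_integral_le_lintegral_enorm _) h0.le) ?_
        simp only [enorm_mul]
        exact jensen_aux hκ.enorm (hfe.comp (measurable_id.prodMk measurable_const)) hr
    _ = (∫⁻ x, ‖κ x‖ₑ ∂μ) ^ (r - 1) * ∫⁻ p, ∫⁻ x, ‖κ x‖ₑ * ‖f x p‖ₑ ^ r ∂μ ∂μ := by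
        rw [lintegral_const_mul]
        refine Measurable.lintegral_prod_right' (f := fun z : E × E => ‖κ z.2‖ₑ * ‖f z.2 z.1‖ₑ ^ r) ?_
        exact (hκ.enorm.comp measurable_snd).mul ((hfe.comp measurable_swap).pow_const _)
    _ = (∫⁻ x, ‖κ x‖ₑ ∂μ) ^ (r - 1) * ∫⁻ x, ∫⁻ p, ‖κ x‖ₑ * ‖f x p‖ₑ ^ r ∂μ ∂μ := by
        rw [lintegral_lintegral_swap]
        exact ((hκ.enorm.comp measurable_snd).mul
          ((hfe.comp measurable_swap).pow_const _)).aemeasurable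
    _ ≤ (∫⁻ x, ‖κ x‖ₑ ∂μ) ^ (r - 1) * ∫⁻ x, ‖κ x‖ₑ * ε ^ r ∂μ := by
        gcongr with x
        rw [lintegral_const_mul]
        · by_cases hx : κ x = 0
          · simp [hx]
          · gcongr
            have := h x hx
            rw [eLpNorm_eq_lintegral_rpow_enorm_toReal hr0 hrt, hrr, one_div,
              ENNReal.rpow_inv_le_iff h0] at this
            exact this
        · exact ((hfe.comp (measurable_const.prodMk measurable_id)).pow_const _)
    _ = ((∫⁻ x, ‖κ x‖ₑ ∂μ) * ε) ^ r := by
        rw [lintegral_mul_const _ hκ.enorm, ← mul_assoc, ENNReal.mul_rpow_of_nonneg _ _ h0.le]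
        congr 1
        conv_lhs => rw [← ENNReal.rpow_one (∫⁻ x, ‖κ x‖ₑ ∂μ)]
        rw [ENNReal.rpow_one, ← ENNReal.rpow_one (∫⁻ x, ‖κ x‖ₑ ∂μ), ← ENNReal.rpow_mul, ← ENNReal.rpow_add_of_nonneg _ _ (by linarith) zero_le_one]
        simp

lemma translation_cont {v : E → ℝ} {r : ℝ≥0∞} (hr : 1 ≤ r) (hrt : r ≠ ⊤) (hv : MemLp v r μ)
    {ε : ℝ≥0∞} (hε : 0 < ε) :
    ∃ δ > 0, ∀ a : E, ‖a‖ < δ → eLpNorm (fun p => v (p - a) - v p) r μ ≤ ε := by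
  haveI : Fact (1 ≤ r) := ⟨hr⟩
  let g : E → C(E, E) := fun a => ⟨fun p => p - a, by fun_prop⟩
  have hg : Continuous g := by
    refine ContinuousMap.continuous_of_continuous_uncurry _ ?_
    simp only [Function.uncurry_def]
    show Continuous fun z : E × E => z.2 - z.1
    fun_prop
  have hgm : ∀ a, MeasurePreserving (g a) μ μ := fun a => measurePreserving_sub_right μ a
  have hc : Continuous fun a => Lp.compMeasurePreserving (g a) (hgm a) (hv.toLp v) :=
    Continuous.compMeasurePreservingLp continuous_const hg hgm hrt
  have h0 := hc.tendsto 0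
  have := (EMetric.tendsto_nhds.1 h0) ε hε
  obtain ⟨δ, hδ, h⟩ := Metric.eventually_nhds_iff.1 this
  refine ⟨δ, hδ, fun a ha => ?_⟩
  have h1 := h (y := a) (by simpa using ha)
  rw [Lp.edist_def] at h1
  refine le_trans (le_of_eq ?_) h1.le
  refine eLpNorm_congr_ae ?_
  have e1 := Lp.coeFn_compMeasurePreserving (hv.toLp v) (hgm a)
  have e2 := Lp.coeFn_compMeasurePreserving (hv.toLp v) (hgm 0)
  have e3 := (hgm a).quasiMeasurePreserving.ae_eq_comp hv.coeFn_toLp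
  have e4 := (hgm 0).quasiMeasurePreserving.ae_eq_comp hv.coeFn_toLp
  filter_upwards [e1, e2, e3, e4] with p h1 h2 h3 h4
  simp only [Pi.sub_apply, h1, h2, h3, h4]
  simp [g]

/-- mollification operator -/
def moll (μ : Measure E) (κ : E → ℝ) (σ : ℝ) (v : E → ℝ) (p : E) : ℝ :=
  ∫ h, κ h * v (p - σ • h) ∂μ

lemma moll_congr {κ : E → ℝ} {σ : ℝ} (hσ : 0 < σ) {v w : E → ℝ} (h : v =ᵐ[μ] w) (p : E) :
    moll μ κ σ v p = moll μ κ σ w p := by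
  refine integral_congr_ae ?_
  have q1 : Measure.QuasiMeasurePreserving (fun h : E => p - σ • h) μ μ := by
    refine (Measure.measurePreserving_sub_left μ p).quasiMeasurePreserving.comp ?_
    refine ⟨measurable_const_smul σ, ?_⟩
    rw [Measure.map_addHaar_smul _ hσ.ne']
    exact Measure.smul_absolutelyContinuous
  filter_upwards [q1.ae_eq_comp h] with x hx
  simp only [Function.comp] at hx
  simp [hx]

lemma resc_supp {κ : E → ℝ} (hκs : HasCompactSupport κ) {σ : ℝ} (hσ : 0 < σ) :
    HasCompactSupport fun q : E => κ (σ⁻¹ • q) :=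
  hκs.comp_homeomorph (Homeomorph.smulOfNeZero σ⁻¹ (inv_pos.2 hσ).ne')

lemma kern_integrable {κ : E → ℝ} (hκ : Continuous κ) (hκs : HasCompactSupport κ) {v : E → ℝ}
    (hv : LocallyIntegrable v μ) (p : E) : Integrable (fun q => κ (p - q) * v q) μ := by
  have h1 : HasCompactSupport fun q : E => κ (p - q) :=
    hκs.comp_homeomorph (Homeomorph.subLeft p)
  have h2 : Continuous fun q : E => κ (p - q) := by fun_prop
  simpa using hv.integrable_smul_left_of_hasCompactSupport h2 h1

lemma moll_integrable {κ : E → ℝ} (hκ : Continuous κ) (hκs : HasCompactSupport κ) {σ : ℝ}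
    (hσ : 0 < σ) {v : E → ℝ} (hv : LocallyIntegrable v μ) (p : E) :
    Integrable (fun h => κ h * v (p - σ • h)) μ := by
  have h1 : Integrable (fun q => κ (σ⁻¹ • (p - q)) * v q) μ :=
    kern_integrable (κ := fun q => κ (σ⁻¹ • q)) (by fun_prop) (resc_supp hκs hσ) hv p
  have h2 := (h1.comp_sub_left p).comp_smul hσ.ne'
  simpa [smul_smul, hσ.ne'] using h2

/-- rescaled kernel -/
def resc (κ : E → ℝ) (σ : ℝ) (q : E) : ℝ := (σ ^ Module.finrank ℝ E)⁻¹ * κ (σ⁻¹ • q)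

lemma moll_eq {κ : E → ℝ} {σ : ℝ} (hσ : 0 < σ) (v : E → ℝ) (p : E) :
    moll μ κ σ v p = ∫ q, resc κ σ (p - q) * v q ∂μ := by
  have h1 := Measure.integral_comp_smul_of_nonneg μ (fun x => κ (σ⁻¹ • x) * v (p - x)) σ
    (hR := hσ.le)
  simp only [smul_smul, inv_mul_cancel₀ hσ.ne', one_smul, smul_eq_mul] at h1
  unfold moll resc
  rw [h1, ← integral_sub_left_eq_self _ μ p, ← integral_const_mul]
  congr 1; ext q; simp; ring

lemma moll_tendsto {κ : E → ℝ} (hκ : Continuous κ) (hκs : HasCompactSupport κ) {v : E → ℝ}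
    {r : ℝ} (hr : 1 ≤ r) (hv : MemLp v (ENNReal.ofReal r) μ) :
    Tendsto (fun σ => eLpNorm (fun p => moll μ κ σ v p - (∫ h, κ h ∂μ) * v p) (ENNReal.ofReal r) μ)
      (𝓝[>] 0) (𝓝 0) := by
  have hr1 : (1:ℝ≥0∞) ≤ ENNReal.ofReal r := by simpa using hr
  have hrt : ENNReal.ofReal r ≠ ⊤ := ENNReal.ofReal_ne_top
  have hκi : Integrable κ μ := hκ.integrable_of_hasCompactSupport hκs
  -- wlog strongly measurable
  obtain ⟨w, hw, hvw⟩ := hv.1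
  have hwm : MemLp w (ENNReal.ofReal r) μ := hv.ae_eq hvw
  have hwL : LocallyIntegrable w μ := hwm.locallyIntegrable hr1
  set I : ℝ≥0∞ := ∫⁻ x, ‖κ x‖ₑ ∂μ with hI
  have hIt : I ≠ ⊤ := hκi.2.ne
  obtain ⟨R, hR⟩ : ∃ R, ∀ x ∈ tsupport κ, ‖x‖ ≤ R := hκs.isCompact.isBounded.exists_norm_le
  rw [ENNReal.tendsto_nhds_zero]
  intro ε hε
  by_cases hεt : ε = ⊤
  · simp [hεt]
  set ε' : ℝ≥0∞ := ε / (I + 1) with hε'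
  have hε'0 : 0 < ε' := ENNReal.div_pos hε.ne' (by simp [hIt])
  obtain ⟨δ, hδ, H⟩ := translation_cont hr1 hrt hwm hε'0
  have hmem : Set.Ioo (0:ℝ) (δ / (|R| + 1)) ∈ 𝓝[>] (0:ℝ) := Ioo_mem_nhdsGT (by positivity)
  filter_upwards [hmem] with σ hσ
  have e : ∀ᵐ p ∂μ, moll μ κ σ v p - (∫ h, κ h ∂μ) * v p =
      ∫ h, κ h * (w (p - σ • h) - w p) ∂μ := by
    filter_upwards [hvw] with p hp
    rw [moll_congr hσ.1 hvw, hp, ← integral_mul_const]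
    unfold moll
    rw [← integral_sub]
    · congr 1; ext h; ring
    · exact moll_integrable hκ hκs hσ.1 hwL p
    · exact hκi.mul_const _
  rw [eLpNorm_congr_ae e]
  have hwm' : Measurable w := hw.measurable
  refine (mink_aux hκ.measurable (f := fun h p => w (p - σ • h) - w p) ?_ hr (ε := ε') ?_).trans ?_
  · refine Measurable.sub (hwm'.comp ?_) (hwm'.comp measurable_snd)
    exact measurable_snd.sub (measurable_fst.const_smul σ)
  · intro x hx
    refine H _ ?_
    rw [norm_smul, Real.norm_of_nonneg hσ.1.le]
    have h1 : ‖x‖ ≤ |R| := (hR x (subset_tsupport _ hx)).trans (le_abs_self R)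
    calc σ * ‖x‖ ≤ σ * (|R|) := by gcongr; exact hσ.1.le
      _ < σ * (|R| + 1) := by have := hσ.1; nlinarith
      _ < δ := by have := hσ.2; rwa [lt_div_iff₀ (by positivity)] at this
  · calc I * ε' ≤ (I + 1) * ε' := by gcongr; exact le_self_add
      _ = ε := by rw [hε', ENNReal.mul_div_cancel (by simp) (by simp [hIt])]

end gen
end HeisAux

namespace HeisAux
open ENNReal

/-- index of horizontal fields -/
abbrev Ix (n : ℕ) := Fin n ⊕ Fin n

def ev (n : ℕ) : Ix n → Pt n
  | .inl j => ex n j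
  | .inr j => ey n j

def Lf (n : ℕ) : Ix n → (Pt n →L[ℝ] ℝ)
  | .inl j => (2:ℝ) • ((ContinuousLinearMap.proj j).comp
      ((ContinuousLinearMap.fst ℝ (Fin n → ℝ) ℝ).comp (ContinuousLinearMap.snd ℝ (Fin n → ℝ) _)))
  | .inr j => (-2:ℝ) • ((ContinuousLinearMap.proj j).comp
      (ContinuousLinearMap.fst ℝ (Fin n → ℝ) ((Fin n → ℝ) × ℝ)))

lemma Lf_inl (n : ℕ) (j : Fin n) (p : Pt n) : Lf n (.inl j) p = 2 * p.2.1 j := by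
  simp [Lf]
lemma Lf_inr (n : ℕ) (j : Fin n) (p : Pt n) : Lf n (.inr j) p = -2 * p.1 j := by
  simp [Lf]
lemma Lf_et (n : ℕ) (i : Ix n) : Lf n i (et n) = 0 := by
  rcases i with j | j <;> simp [Lf, et]

/-- unified horizontal derivative -/
def Zd (n : ℕ) (i : Ix n) (u : Pt n → ℝ) (p : Pt n) : ℝ :=
  fderiv ℝ u p (ev n i) + Lf n i p * fderiv ℝ u p (et n)

lemma Zd_inl (n : ℕ) (j : Fin n) (u : Pt n → ℝ) : Zd n (.inl j) u = Xd n j u := by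
  ext p; simp [Zd, Xd, Lf_inl, ev]
lemma Zd_inr (n : ℕ) (j : Fin n) (u : Pt n → ℝ) : Zd n (.inr j) u = Yd n j u := by
  ext p; simp only [Zd, Yd, Lf_inr, ev]; ring

/-- `u ∈ L^{Q*}` with weak horizontal gradient `g`. -/
def HD (n : ℕ) (u : Pt n → ℝ) (g : Ix n → Pt n → ℝ) : Prop :=
  MemLp u (ENNReal.ofReal (Qs n)) volume ∧ (∀ i, MemLp (g i) 2 volume) ∧
    ∀ φ : Pt n → ℝ, TestFun n φ → ∀ i, ∫ p, u p * Zd n i φ p = -∫ p, g i p * φ p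

section basics
variable {n : ℕ}

lemma Qs_eq (hn : 1 ≤ n) : Qs n = 2 + 2 / (n:ℝ) := by
  have : (0:ℝ) < n := by exact_mod_cast hn
  unfold Qs Qh
  rw [add_sub_cancel_right]; field_simp

lemma Qs_gt (hn : 1 ≤ n) : 2 < Qs n := by
  have : (0:ℝ) < n := by exact_mod_cast hn
  rw [Qs_eq hn]
  have : 0 < 2 / (n:ℝ) := by positivity
  linarith

lemma one_le_Qs (hn : 1 ≤ n) : (1:ℝ≥0∞) ≤ ENNReal.ofReal (Qs n) := by
  rw [ENNReal.one_le_ofReal]; linarith [Qs_gt hn]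

instance instHaarPt1 : (volume : Measure ((Fin n → ℝ) × ℝ)).IsAddHaarMeasure :=
  Measure.prod.instIsAddHaarMeasure _ _

instance instHaarPt : (volume : Measure (Pt n)).IsAddHaarMeasure :=
  Measure.prod.instIsAddHaarMeasure _ _

lemma _root_.Heis.TestFun.mul {φ ψ : Pt n → ℝ} (h : TestFun n φ) (h' : ContDiff ℝ (⊤ : ℕ∞) ψ) :
    TestFun n (fun p => ψ p * φ p) := ⟨h'.mul h.1, h.2.mul_left⟩

lemma _root_.Heis.TestFun.differentiable {φ : Pt n → ℝ} (h : TestFun n φ) : Differentiable ℝ φ :=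
  h.1.differentiable (by simp)

lemma contDiff_dir {φ : Pt n → ℝ} (h : ContDiff ℝ (⊤ : ℕ∞) φ) (e : Pt n) :
    ContDiff ℝ (⊤ : ℕ∞) fun p => fderiv ℝ φ p e :=
  (h.fderiv_right (m := (⊤ : ℕ∞)) (by simp)).clm_apply contDiff_const

lemma _root_.Heis.TestFun.dir {φ : Pt n → ℝ} (h : TestFun n φ) (e : Pt n) :
    TestFun n fun p => fderiv ℝ φ p e :=
  ⟨contDiff_dir h.1 e, h.2.fderiv_apply ℝ e⟩

lemma _root_.Heis.TestFun.tZd {φ : Pt n → ℝ} (h : TestFun n φ) (i : Ix n) : TestFun n (Zd n i φ) := by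
  refine ⟨?_, ?_⟩
  · unfold HeisAux.Zd
    exact (contDiff_dir h.1 _).add ((Lf n i).contDiff.mul (contDiff_dir h.1 _))
  · exact (h.2.fderiv_apply ℝ _).add ((h.2.fderiv_apply ℝ _).mul_left)

lemma _root_.Heis.TestFun.memLp {φ : Pt n → ℝ} (h : TestFun n φ) (r : ℝ≥0∞) : MemLp φ r volume :=
  h.1.continuous.memLp_of_hasCompactSupport h.2

lemma Zd_mul {φ ψ : Pt n → ℝ} {p : Pt n} (hφ : DifferentiableAt ℝ φ p) (hψ : DifferentiableAt ℝ ψ p)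
    (i : Ix n) : Zd n i (fun p => φ p * ψ p) p = φ p * Zd n i ψ p + ψ p * Zd n i φ p := by
  unfold Zd
  rw [fderiv_fun_mul hφ hψ]
  simp; ring

lemma LInt {u : Pt n → ℝ} {r : ℝ≥0∞} (hr : 1 ≤ r) (hu : MemLp u r volume) :
    LocallyIntegrable u volume := hu.locallyIntegrable hr

lemma int_test {u φ : Pt n → ℝ} (hu : LocallyIntegrable u volume) (hφ : TestFun n φ) :
    Integrable (fun p => u p * φ p) volume := by
  simpa using hu.integrable_smul_right_of_hasCompactSupport hφ.1.continuous hφ.2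

lemma HD.loc (hn : 1 ≤ n) {u : Pt n → ℝ} {g : Ix n → Pt n → ℝ} (h : HD n u g) :
    LocallyIntegrable u volume := LInt (one_le_Qs hn) h.1

lemma HD.locg {u : Pt n → ℝ} {g : Ix n → Pt n → ℝ} (h : HD n u g) (i : Ix n) :
    LocallyIntegrable (g i) volume := LInt (by norm_num) (h.2.1 i)

lemma HD.sub (hn : 1 ≤ n) {u u' : Pt n → ℝ} {g g' : Ix n → Pt n → ℝ} (h : HD n u g) (h' : HD n u' g') :
    HD n (fun p => u p - u' p) (fun i p => g i p - g' i p) := by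
  refine ⟨h.1.sub h'.1, fun i => (h.2.1 i).sub (h'.2.1 i), fun φ hφ i => ?_⟩
  simp only [sub_mul]
  rw [integral_sub (int_test (h.loc hn) (hφ.tZd i)) (int_test (h'.loc hn) (hφ.tZd i)),
    integral_sub (int_test (h.locg i) hφ) (int_test (h'.locg i) hφ), h.2.2 φ hφ i, h'.2.2 φ hφ i]
  ring

lemma HD.smul {u : Pt n → ℝ} {g : Ix n → Pt n → ℝ} (h : HD n u g) (c : ℝ) :
    HD n (fun p => c * u p) (fun i p => c * g i p) := by
  refine ⟨h.1.const_mul c, fun i => (h.2.1 i).const_mul c, fun φ hφ i => ?_⟩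
  simp only [mul_assoc]
  rw [integral_const_mul, integral_const_mul, h.2.2 φ hφ i]; ring

/-- product rule with a test function -/
lemma HD.cut_aux (hn : 1 ≤ n) {u : Pt n → ℝ} {g : Ix n → Pt n → ℝ} (h : HD n u g) {χ : Pt n → ℝ}
    (hχ : TestFun n χ) {φ : Pt n → ℝ} (hφ : TestFun n φ) (i : Ix n) :
    ∫ p, χ p * u p * Zd n i φ p = -∫ p, (χ p * g i p + u p * Zd n i χ p) * φ p := by
  have h1 := h.2.2 _ (hφ.mul hχ.1) i
  have e1 : ∀ p, u p * Zd n i (fun p => χ p * φ p) p =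
      χ p * u p * Zd n i φ p + u p * Zd n i χ p * φ p := by
    intro p
    rw [Zd_mul (hχ.differentiable p) (hφ.differentiable p)]; ring
  simp only [e1] at h1
  have i1 : Integrable (fun p => χ p * u p * Zd n i φ p) volume := by
    refine (int_test (h.loc hn) ((hφ.tZd i).mul hχ.1)).congr (.of_forall fun p => ?_)
    simp only; ring
  have i2 : Integrable (fun p => u p * Zd n i χ p * φ p) volume := by
    refine (int_test (h.loc hn) (hφ.mul (hχ.tZd i).1)).congr (.of_forall fun p => ?_)
    simp only; ring
  have i3 : Integrable (fun p => χ p * g i p * φ p) volume := by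
    refine (int_test (h.locg i) (hφ.mul hχ.1)).congr (.of_forall fun p => ?_)
    simp only; ring
  rw [integral_add i1 i2] at h1
  simp only [add_mul]
  rw [integral_add i3 i2]
  have e2 : ∫ p, g i p * (χ p * φ p) = ∫ p, χ p * g i p * φ p := by
    congr 1; ext p; ring
  rw [e2] at h1
  linarith

/-- squared Euclidean norm -/
def N2 (n : ℕ) (p : Pt n) : ℝ := ∑ j, (p.1 j) ^ 2 + ∑ j, (p.2.1 j) ^ 2 + p.2.2 ^ 2

lemma N2_contDiff : ContDiff ℝ (⊤ : ℕ∞) (N2 n) := by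
  unfold N2
  fun_prop

lemma norm_le_of_N2 {p : Pt n} {c : ℝ} (hc : 0 ≤ c) (h : N2 n p ≤ c ^ 2) : ‖p‖ ≤ c := by
  unfold N2 at h
  have hx : ∀ j, (p.1 j) ^ 2 ≤ ∑ j, (p.1 j) ^ 2 := fun j =>
    Finset.single_le_sum (f := fun j => (p.1 j) ^ 2) (fun i _ => sq_nonneg _) (Finset.mem_univ j)
  have hy : ∀ j, (p.2.1 j) ^ 2 ≤ ∑ j, (p.2.1 j) ^ 2 := fun j =>
    Finset.single_le_sum (f := fun j => (p.2.1 j) ^ 2) (fun i _ => sq_nonneg _) (Finset.mem_univ j)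
  have hx0 : 0 ≤ ∑ j, (p.1 j) ^ 2 := Finset.sum_nonneg fun i _ => sq_nonneg _
  have hy0 : 0 ≤ ∑ j, (p.2.1 j) ^ 2 := Finset.sum_nonneg fun i _ => sq_nonneg _
  have ht0 := sq_nonneg p.2.2
  rw [Prod.norm_def, Prod.norm_def, max_le_iff, max_le_iff, pi_norm_le_iff_of_nonneg hc,
    pi_norm_le_iff_of_nonneg hc]
  refine ⟨fun j => abs_le_of_sq_le_sq ?_ hc, fun j => abs_le_of_sq_le_sq ?_ hc,
    abs_le_of_sq_le_sq ?_ hc⟩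
  · linarith [hx j]
  · linarith [hy j]
  · linarith

lemma N2_le_norm (p : Pt n) : N2 n p ≤ (2 * n + 1) * ‖p‖ ^ 2 := by
  have h1 : ‖p.1‖ ≤ ‖p‖ := norm_fst_le p
  have h2 : ‖p.2‖ ≤ ‖p‖ := norm_snd_le p
  have h3 : ‖p.2.1‖ ≤ ‖p‖ := (norm_fst_le p.2).trans h2
  have h4 : ‖p.2.2‖ ≤ ‖p‖ := (norm_snd_le p.2).trans h2
  have hx : ∑ j, (p.1 j) ^ 2 ≤ ∑ _j : Fin n, ‖p‖ ^ 2 := Finset.sum_le_sum fun j _ => by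
    rw [← sq_abs]; gcongr; exact (norm_le_pi_norm p.1 j).trans h1
  have hy : ∑ j, (p.2.1 j) ^ 2 ≤ ∑ _j : Fin n, ‖p‖ ^ 2 := Finset.sum_le_sum fun j _ => by
    rw [← sq_abs]; gcongr; exact (norm_le_pi_norm p.2.1 j).trans h3
  have ht : p.2.2 ^ 2 ≤ ‖p‖ ^ 2 := by
    rw [← sq_abs]; gcongr; exact h4
  simp only [Finset.sum_const, Finset.card_univ, Fintype.card_fin, nsmul_eq_mul] at hx hy
  unfold N2; nlinarith

/-- rotation `z ↦ e^{-iθ} z` -/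
def rotL (n : ℕ) (θ : ℝ) : Pt n →ₗ[ℝ] Pt n where
  toFun p := (Real.cos θ • p.1 + Real.sin θ • p.2.1, - Real.sin θ • p.1 + Real.cos θ • p.2.1, p.2.2)
  map_add' p q := by
    ext <;> simp <;> ring
  map_smul' c p := by
    ext <;> simp <;> ring

lemma rotL_apply (θ : ℝ) (p : Pt n) : rotL n θ p =
  (Real.cos θ • p.1 + Real.sin θ • p.2.1, - Real.sin θ • p.1 + Real.cos θ • p.2.1, p.2.2) := rfl

lemma rot_inv (θ : ℝ) (p : Pt n) : rotL n (-θ) (rotL n θ p) = p := by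
  have := Real.sin_sq_add_cos_sq θ
  simp only [rotL_apply, Real.cos_neg, Real.sin_neg]
  refine Prod.ext ?_ (Prod.ext ?_ rfl)
  · ext j
    simp
    linear_combination (p.1 j) * this
  · ext j
    simp
    linear_combination (p.2.1 j) * this

lemma rot_zsq (θ : ℝ) (p : Pt n) : ∑ j, ((rotL n θ p).1 j) ^ 2 + ∑ j, ((rotL n θ p).2.1 j) ^ 2
    = ∑ j, (p.1 j) ^ 2 + ∑ j, (p.2.1 j) ^ 2 := by
  rw [← Finset.sum_add_distrib, ← Finset.sum_add_distrib]
  refine Finset.sum_congr rfl fun j _ => ?_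
  have := Real.sin_sq_add_cos_sq θ
  simp [rotL_apply]
  linear_combination ((p.1 j) ^ 2 + (p.2.1 j) ^ 2) * this

lemma rot_N2 (θ : ℝ) (p : Pt n) : N2 n (rotL n θ p) = N2 n p := by
  unfold N2; rw [rot_zsq]; rfl

lemma N2_closed (c : ℝ) : IsCompact {p : Pt n | N2 n p ≤ c ^ 2} := by
  refine Metric.isCompact_of_isClosed_isBounded (isClosed_le N2_contDiff.continuous continuous_const) ?_
  refine (Metric.isBounded_closedBall (x := (0 : Pt n)) (r := |c|)).subset fun p hp => ?_
  simp only [Metric.mem_closedBall, dist_zero_right]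
  exact norm_le_of_N2 (abs_nonneg c) (by simpa using hp)

lemma rot_mp (θ : ℝ) : MeasurePreserving (rotL n θ) (volume : Measure (Pt n)) volume := by
  have hcont : Continuous (rotL n θ) := (rotL n θ).continuous_of_finiteDimensional
  have hdet : LinearMap.det (rotL n θ) ≠ 0 := by
    have h : rotL n (-θ) ∘ₗ rotL n θ = LinearMap.id := LinearMap.ext (rot_inv θ)
    have h2 := congrArg LinearMap.det h
    rw [LinearMap.det_comp, LinearMap.det_id] at h2
    exact right_ne_zero_of_mul_eq_one h2
  have hmap := Measure.map_linearMap_addHaar_eq_smul_addHaar (volume : Measure (Pt n)) hdet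
  refine ⟨hcont.measurable, ?_⟩
  set c := ENNReal.ofReal |(LinearMap.det (rotL n θ))⁻¹| with hc
  let B : Set (Pt n) := {p : Pt n | N2 n p ≤ 1 ^ 2}
  have hB : (rotL n θ) ⁻¹' B = B := by ext p; simp [B, rot_N2]
  have hBc : IsCompact B := N2_closed 1
  have h1 : volume B = c * volume B := by
    have := congrArg (fun m => m B) hmap
    simp only [Measure.smul_apply, smul_eq_mul] at this
    rwa [Measure.map_apply hcont.measurable hBc.measurableSet, hB] at this
  have hBt : volume B ≠ ⊤ := hBc.measure_lt_top.ne
  have hB0 : volume B ≠ 0 := by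
    have : {p : Pt n | N2 n p < 1} ⊆ B := fun p hp => by
      simp only [Set.mem_ofPred_eq] at hp; simp [B, hp.le]
    refine ne_of_gt (lt_of_lt_of_le ?_ (measure_mono this))
    refine (isOpen_lt N2_contDiff.continuous continuous_const).measure_pos _ ⟨0, ?_⟩
    simp [N2]
  have hc1 : c = 1 := by
    have h2 : 1 * volume B = c * volume B := by rw [one_mul]; exact h1
    exact ((ENNReal.mul_left_inj hB0 hBt).1 h2).symm
  rw [hmap, hc1, one_smul]

def RotInv (n : ℕ) (u : Pt n → ℝ) : Prop := ∀ θ p, u (rotL n θ p) = u p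

lemma _root_.Heis.IsCyl.rotInv {u : Pt n → ℝ} (h : IsCyl n u) : RotInv n u := by
  obtain ⟨v, hv⟩ := h
  intro θ p
  rw [hv, hv, znorm, znorm, rot_zsq]; rfl

lemma rot_integral (θ : ℝ) (f : Pt n → ℝ) : ∫ p, f (rotL n θ p) = ∫ p, f p := by
  have hcont : ∀ θ, Continuous (rotL n θ) := fun θ => (rotL n θ).continuous_of_finiteDimensional
  let e : Pt n ≃ₜ Pt n :=
    { toFun := rotL n θ
      invFun := rotL n (-θ)
      left_inv := rot_inv θ
      right_inv := fun p => by simpa using rot_inv (-θ) p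
      continuous_toFun := hcont θ
      continuous_invFun := hcont (-θ) }
  exact (rot_mp θ).integral_comp e.measurableEmbedding f

lemma RotInv.moll {u κ : Pt n → ℝ} (hu : RotInv n u) (hκ : RotInv n κ) (σ : ℝ) :
    RotInv n (moll volume κ σ u) := by
  intro θ p
  unfold HeisAux.moll
  rw [← rot_integral θ]
  congr 1; ext h
  rw [hκ, ← map_smul, ← map_sub, hu]

/-- smooth bump, equal to one for `N2 ≤ 1`, vanishing for `N2 ≥ 4` -/
def bmp (n : ℕ) (p : Pt n) : ℝ := (⟨1, 4, by norm_num, by norm_num⟩ : ContDiffBump (0:ℝ)) (N2 n p)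

lemma N2_nonneg (p : Pt n) : 0 ≤ N2 n p := by unfold N2; positivity

lemma bmp_test : TestFun n (bmp n) := by
  refine ⟨(ContDiffBump.contDiff _).comp N2_contDiff, ?_⟩
  refine HasCompactSupport.of_support_subset_isCompact (N2_closed 2) ?_
  intro p hp
  by_contra h
  apply hp
  unfold bmp
  apply ContDiffBump.zero_of_le_dist
  simp only [dist_zero_right, Real.norm_eq_abs, abs_of_nonneg (N2_nonneg p)]
  simp only [Set.mem_ofPred_eq] at h
  linarith

lemma bmp_nonneg (p : Pt n) : 0 ≤ bmp n p := ContDiffBump.nonneg _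
lemma bmp_le_one (p : Pt n) : bmp n p ≤ 1 := ContDiffBump.le_one _
lemma bmp_one {p : Pt n} (h : N2 n p ≤ 1) : bmp n p = 1 := by
  apply ContDiffBump.one_of_mem_closedBall
  simpa [abs_of_nonneg (N2_nonneg p)] using h
lemma bmp_rot : RotInv n (bmp n) := fun θ p => by unfold bmp; rw [rot_N2]

lemma bmp_int_pos : 0 < ∫ p, bmp n p := by
  refine bmp_test.1.continuous.integral_pos_of_hasCompactSupport_nonneg_nonzero bmp_test.2
    bmp_nonneg (x := 0) ?_
  rw [bmp_one (by simp [N2])]; norm_num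

/-- mollifier -/
def rho (n : ℕ) (p : Pt n) : ℝ := (∫ p, bmp n p)⁻¹ * bmp n p

lemma rho_test : TestFun n (rho n) := bmp_test.mul contDiff_const
lemma rho_nonneg (p : Pt n) : 0 ≤ rho n p := mul_nonneg (inv_nonneg.2 bmp_int_pos.le) (bmp_nonneg p)
lemma rho_rot : RotInv n (rho n) := fun θ p => by unfold rho; rw [bmp_rot]
lemma rho_int : ∫ p, rho n p = 1 := by
  unfold rho; rw [integral_const_mul, inv_mul_cancel₀ bmp_int_pos.ne']
lemma rho_supp {p : Pt n} (h : rho n p ≠ 0) : ‖p‖ ≤ 2 := by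
  refine norm_le_of_N2 (by norm_num) ?_
  by_contra h'
  apply h
  have : bmp n p = 0 := by
    unfold bmp
    apply ContDiffBump.zero_of_le_dist
    simp only [dist_zero_right, Real.norm_eq_abs, abs_of_nonneg (N2_nonneg p)]
    linarith
  simp [rho, this]

end basics
end HeisAux

namespace HeisAux
open ENNReal
section P3
variable {n : ℕ}

instance instNegPt : (volume : Measure (Pt n)).IsNegInvariant :=
  haveI : (volume : Measure (Pt n)).Regular :=
    Measure.Regular.of_sigmaCompactSpace_of_isLocallyFiniteMeasure _
  Measure.IsAddHaarMeasure.isNegInvariant_of_regular _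

lemma resc_test {κ : Pt n → ℝ} (h : TestFun n κ) {σ : ℝ} (hσ : 0 < σ) : TestFun n (resc κ σ) := by
  refine ⟨?_, (resc_supp h.2 hσ).mul_left⟩
  unfold resc
  exact contDiff_const.mul (h.1.comp (contDiff_const_smul _))

lemma resc_fderiv {κ : Pt n → ℝ} (h : TestFun n κ) (σ : ℝ) (q e : Pt n) :
    fderiv ℝ (resc κ σ) q e = σ⁻¹ * resc (fun p => fderiv ℝ κ p e) σ q := by
  have h1 : HasFDerivAt (fun q : Pt n => κ (σ⁻¹ • q))
      ((fderiv ℝ κ (σ⁻¹ • q)).comp (σ⁻¹ • ContinuousLinearMap.id ℝ (Pt n))) q := by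
    have hk := (h.differentiable (σ⁻¹ • q)).hasFDerivAt
    exact hk.comp q ((hasFDerivAt_id q).const_smul σ⁻¹)
  have h2 := (h1.const_mul ((σ ^ Module.finrank ℝ (Pt n))⁻¹)).fderiv
  unfold resc
  rw [h2]
  simp; ring

lemma moll_fderiv {κ : Pt n → ℝ} (h : TestFun n κ) {σ : ℝ} (hσ : 0 < σ) {v : Pt n → ℝ}
    (hv : LocallyIntegrable v volume) (p e : Pt n) :
    fderiv ℝ (moll volume κ σ v) p e = ∫ q, fderiv ℝ (resc κ σ) (p - q) e * v q := by
  have hk := resc_test h hσ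
  have e1 : moll volume κ σ v = convolution (resc κ σ) v (ContinuousLinearMap.mul ℝ ℝ) volume := by
    ext p
    rw [moll_eq hσ, convolution_mul_swap]
  have hd := hk.2.hasFDerivAt_convolution_left (ContinuousLinearMap.mul ℝ ℝ)
    (hk.1.of_le (by exact_mod_cast le_top)) hv p
  rw [e1, hd.fderiv, convolution_eq_swap, ContinuousLinearMap.integral_apply]
  · rfl
  · have h1 := (hk.2.fderiv ℝ).convolutionExists_left (L := (ContinuousLinearMap.mul ℝ ℝ).precompL (Pt n))
      (μ := volume) (g := v) (hk.1.continuous_fderiv (by simp)) hv p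
    exact h1.integrable_swap

lemma moll_test {κ : Pt n → ℝ} (h : TestFun n κ) {σ : ℝ} (hσ : 0 < σ) {v : Pt n → ℝ}
    (hv : LocallyIntegrable v volume) (hvs : HasCompactSupport v) :
    TestFun n (moll volume κ σ v) := by
  have hk := resc_test h hσ
  have e1 : moll volume κ σ v = convolution (resc κ σ) v (ContinuousLinearMap.mul ℝ ℝ) volume := by
    ext p
    rw [moll_eq hσ, convolution_mul_swap]
  rw [e1]
  exact ⟨hk.2.contDiff_convolution_left _ hk.1 hv, hk.2.convolution _ hvs⟩

/-- commutator kernel -/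
def kap (n : ℕ) (i : Ix n) (h : Pt n) : ℝ := Lf n i h * fderiv ℝ (rho n) h (et n)

lemma kap_test (i : Ix n) : TestFun n (kap n i) := (rho_test.dir (et n)).mul (Lf n i).contDiff

lemma kap_int (i : Ix n) : ∫ h, kap n i h = 0 := by
  have hL : Differentiable ℝ (Lf n i) := (Lf n i).differentiable
  have := integral_mul_fderiv_eq_neg_fderiv_mul_of_integrable (μ := (volume : Measure (Pt n)))
    (f := fun p => Lf n i p) (g := rho n) (v := et n) ?_ ?_ ?_ (fun p _ => hL p) (fun p _ => rho_test.differentiable p)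
  · unfold kap
    rw [this]
    simp only [ContinuousLinearMap.fderiv, Lf_et]
    simp
  · simp only [ContinuousLinearMap.fderiv, Lf_et]
    simp
  · exact (kap_test i).1.continuous.integrable_of_hasCompactSupport (kap_test i).2
  · have := rho_test.mul (n := n) (Lf n i).contDiff
    exact this.1.continuous.integrable_of_hasCompactSupport this.2

lemma Zd_moll {v g : Pt n → ℝ} {i : Ix n} (hv : LocallyIntegrable v volume)
    (hw : ∀ φ, TestFun n φ → ∫ p, v p * Zd n i φ p = -∫ p, g p * φ p) {σ : ℝ} (hσ : 0 < σ) (p : Pt n) :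
    Zd n i (moll volume (rho n) σ v) p = moll volume (rho n) σ g p + moll volume (kap n i) σ v p := by
  have hk := resc_test (rho_test (n := n)) hσ
  have hφ : TestFun n fun q => resc (rho n) σ (p - q) :=
    ⟨hk.1.comp (contDiff_const.sub contDiff_id), hk.2.comp_homeomorph (Homeomorph.subLeft p)⟩
  have hd : ∀ q e, fderiv ℝ (fun q => resc (rho n) σ (p - q)) q e = - fderiv ℝ (resc (rho n) σ) (p - q) e := by
    intro q e
    have h1 : HasFDerivAt (fun q : Pt n => p - q) (-(ContinuousLinearMap.id ℝ (Pt n))) q :=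
      (hasFDerivAt_id q).const_sub p
    have h2 : HasFDerivAt (fun q => resc (rho n) σ (p - q)) _ q :=
      (hk.differentiable (p - q)).hasFDerivAt.comp q h1
    rw [h2.fderiv]
    simp
  have h1 := hw _ hφ
  unfold Zd at h1 ⊢
  simp only [hd] at h1
  rw [moll_fderiv rho_test hσ hv, moll_fderiv rho_test hσ hv, moll_eq hσ, moll_eq hσ]
  have e2 : ∀ q, resc (kap n i) σ (p - q) = Lf n i (p - q) * fderiv ℝ (resc (rho n) σ) (p - q) (et n) := by
    intro q
    rw [resc_fderiv rho_test]
    simp only [resc, kap, map_smul, smul_eq_mul]; ring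
  have e3 : ∫ q, resc (rho n) σ (p - q) * g q =
      ∫ q, (fderiv ℝ (resc (rho n) σ) (p - q) (ev n i) +
        Lf n i q * fderiv ℝ (resc (rho n) σ) (p - q) (et n)) * v q := by
    have : ∫ q, resc (rho n) σ (p - q) * g q = ∫ q, g q * resc (rho n) σ (p - q) := by
      congr 1; ext q; ring
    rw [this, ← neg_eq_iff_eq_neg.2 h1, ← integral_neg]
    congr 1; ext q; ring
  have j1 : ∀ e, Integrable (fun q => fderiv ℝ (resc (rho n) σ) (p - q) e * v q) volume := fun e =>
    kern_integrable (hk.dir e).1.continuous (hk.dir e).2 hv p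
  have j2 : Integrable (fun q => resc (kap n i) σ (p - q) * v q) volume :=
    kern_integrable (resc_test (kap_test i) hσ).1.continuous (resc_test (kap_test i) hσ).2 hv p
  have j3 : Integrable (fun q => (fderiv ℝ (resc (rho n) σ) (p - q) (ev n i) +
        Lf n i q * fderiv ℝ (resc (rho n) σ) (p - q) (et n)) * v q) volume := by
    refine (((j1 (ev n i)).add ((j1 (et n)).const_mul (Lf n i p))).sub j2).congr (.of_forall fun q => ?_)
    simp only [Pi.add_apply, Pi.sub_apply, e2, map_sub]; ring
  rw [e3, ← integral_add j3 j2, ← integral_const_mul, ← integral_add (j1 _) ((j1 _).const_mul _)]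
  congr 1; ext q
  rw [e2, map_sub]; ring

lemma eLpNorm_small_of_tendsto {α : Type*} {l : Filter α} {f : α → ℝ≥0∞} (h : Tendsto f l (𝓝 0))
    {ε : ℝ≥0∞} (hε : 0 < ε) : ∀ᶠ a in l, f a ≤ ε :=
  (ENNReal.tendsto_nhds_zero.1 h) ε hε

lemma dens_compact (hn : 1 ≤ n) {v : Pt n → ℝ} {g : Ix n → Pt n → ℝ} (h : HD n v g)
    (hs : HasCompactSupport v) (hr : RotInv n v) {ε : ℝ≥0∞} (hε : 0 < ε) :
    ∃ φ, TestFun n φ ∧ RotInv n φ ∧ eLpNorm (fun p => φ p - v p) (ENNReal.ofReal (Qs n)) volume ≤ ε ∧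
      ∀ i, eLpNorm (fun p => Zd n i φ p - g i p) 2 volume ≤ ε := by
  have hv2 : MemLp v 2 volume := by
    refine h.1.mono_exponent_of_measure_support_ne_top (s := tsupport v)
      (fun x hx => image_eq_zero_of_notMem_tsupport hx) hs.isCompact.measure_lt_top.ne ?_
    rw [show (2:ℝ≥0∞) = ENNReal.ofReal 2 by simp]
    exact ENNReal.ofReal_le_ofReal (Qs_gt hn).le
  have two : (2:ℝ≥0∞) = ENNReal.ofReal 2 := by simp
  have hε2 : 0 < ε / 2 := ENNReal.half_pos hε.ne'
  have t1 := eLpNorm_small_of_tendsto (moll_tendsto rho_test.1.continuous rho_test.2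
    (by linarith [Qs_gt hn] : (1:ℝ) ≤ Qs n) h.1) hε
  have t2 : ∀ᶠ σ in 𝓝[>] (0:ℝ), ∀ i, eLpNorm (fun p => moll volume (rho n) σ (g i) p -
      (∫ p, rho n p) * g i p) 2 volume ≤ ε / 2 := by
    rw [eventually_all]; intro i
    generalize ε / 2 = ε' at hε2
    rw [two]
    exact eLpNorm_small_of_tendsto (moll_tendsto rho_test.1.continuous rho_test.2
      (by norm_num) (two ▸ h.2.1 i)) hε2
  have t3 : ∀ᶠ σ in 𝓝[>] (0:ℝ), ∀ i, eLpNorm (fun p => moll volume (kap n i) σ v p -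
      (∫ p, kap n i p) * v p) 2 volume ≤ ε / 2 := by
    rw [eventually_all]; intro i
    generalize ε / 2 = ε' at hε2
    rw [two]
    exact eLpNorm_small_of_tendsto (moll_tendsto (kap_test i).1.continuous (kap_test i).2
      (by norm_num) (two ▸ hv2)) hε2
  obtain ⟨σ, ⟨⟨h1, h2⟩, h3⟩, hσ⟩ := ((t1.and t2).and t3 |>.and self_mem_nhdsWithin).exists
  have hσ : 0 < σ := hσ
  refine ⟨moll volume (rho n) σ v, moll_test rho_test hσ (h.loc hn) hs, hr.moll rho_rot σ, ?_, fun i => ?_⟩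
  · simpa [rho_int] using h1
  · have e : (fun p => Zd n i (moll volume (rho n) σ v) p - g i p) =
      (fun p => moll volume (rho n) σ (g i) p - (∫ p, rho n p) * g i p) +
      (fun p => moll volume (kap n i) σ v p - (∫ p, kap n i p) * v p) := by
      ext p
      rw [Zd_moll (h.loc hn) (fun φ hφ => h.2.2 φ hφ i) hσ, rho_int, kap_int]
      simp; ring
    have m2 : AEStronglyMeasurable (fun p => moll volume (kap n i) σ v p - (∫ p, kap n i p) * v p) volume :=
      ((moll_test (kap_test i) hσ (h.loc hn) hs).1.continuous.aestronglyMeasurable).sub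
        (h.1.1.const_mul _)
    have m1 : AEStronglyMeasurable (fun p => moll volume (rho n) σ (g i) p - (∫ p, rho n p) * g i p) volume := by
      have := ((((moll_test rho_test hσ (h.loc hn) hs).tZd i).1.continuous.aestronglyMeasurable
        (μ := volume)).sub (h.2.1 i).1).sub m2
      refine this.congr (.of_forall fun p => ?_)
      have := congrFun e p
      simp only [Pi.add_apply, Pi.sub_apply] at this ⊢
      rw [this]; ring
    rw [e]
    refine (eLpNorm_add_le m1 m2 (by norm_num)).trans ?_
    calc _ ≤ ε / 2 + ε / 2 := add_le_add (h2 i) (h3 i)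
      _ = ε := ENNReal.add_halves ε

end P3
end HeisAux

namespace HeisAux
open ENNReal
section P4
variable {n : ℕ}

lemma elp_dom {ι : Type*} {l : Filter ι} [l.IsCountablyGenerated] {r : ℝ} (hr : 0 < r)
    {u : Pt n → ℝ} (hu : MemLp u (ENNReal.ofReal r) volume)
    (a : ι → Pt n → ℝ) (ha : ∀ k, AEStronglyMeasurable (a k) volume) (hb : ∀ k p, |a k p| ≤ 1)
    (ht : ∀ p, Tendsto (fun k => a k p) l (𝓝 0)) :
    Tendsto (fun k => eLpNorm (fun p => a k p * u p) (ENNReal.ofReal r) volume) l (𝓝 0) := by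
  have h0 : ENNReal.ofReal r ≠ 0 := by simpa using hr
  have h1 : (ENNReal.ofReal r).toReal = r := ENNReal.toReal_ofReal hr.le
  simp only [eLpNorm_eq_lintegral_rpow_enorm_toReal h0 ENNReal.ofReal_ne_top, h1]
  have hfin : ∫⁻ p, ‖u p‖ₑ ^ r ≠ ∞ := by
    have := (lintegral_rpow_enorm_lt_top_of_eLpNorm_lt_top h0 ENNReal.ofReal_ne_top hu.2).ne
    rwa [h1] at this
  have key : Tendsto (fun k => ∫⁻ p, ‖a k p * u p‖ₑ ^ r) l (𝓝 (∫⁻ _p : Pt n, 0)) := by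
    refine tendsto_of_seq_tendsto fun x hx => ?_
    refine tendsto_lintegral_of_dominated_convergence' (fun p => ‖u p‖ₑ ^ r)
      (fun k => (((ha (x k)).mul hu.1).enorm.pow_const r)) ?_ hfin ?_
    · refine fun k => .of_forall fun p => ?_
      beta_reduce
      rw [enorm_mul]
      gcongr
      calc ‖a (x k) p‖ₑ * ‖u p‖ₑ ≤ 1 * ‖u p‖ₑ := by
            gcongr
            rw [Real.enorm_eq_ofReal_abs]
            simpa using ENNReal.ofReal_le_ofReal (hb (x k) p)
        _ = _ := one_mul _
    · refine .of_forall fun p => ?_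
      have h2 : Tendsto (fun k => a k p * u p) l (𝓝 0) := by simpa using (ht p).mul_const (u p)
      have h3 := (ENNReal.continuous_rpow_const (y := r)).tendsto _ |>.comp
        ((continuous_enorm.tendsto _).comp (h2.comp hx))
      simpa [hr, Function.comp_def] using h3
  have h4 := (ENNReal.continuous_rpow_const (y := 1 / r)).tendsto _ |>.comp key
  simpa [hr, Function.comp_def] using h4

/-- anisotropic dilation -/
def dil (n : ℕ) (s : ℝ) : Pt n →ₗ[ℝ] Pt n :=
  LinearMap.prodMap (s • LinearMap.id) (LinearMap.prodMap (s • LinearMap.id) (s ^ 2 • LinearMap.id))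

lemma dil_apply (s : ℝ) (p : Pt n) : dil n s p = (s • p.1, s • p.2.1, s ^ 2 * p.2.2) := rfl

lemma dil_det (s : ℝ) : LinearMap.det (dil n s) = s ^ (2 * n + 2) := by
  unfold dil
  rw [LinearMap.det_prodMap, LinearMap.det_prodMap]
  simp only [LinearMap.det_smul, LinearMap.det_id]
  simp; ring

lemma dil_cont (s : ℝ) : Continuous (dil n s) := (dil n s).continuous_of_finiteDimensional

lemma dil_rot (s θ : ℝ) (p : Pt n) : dil n s (rotL n θ p) = rotL n θ (dil n s p) := by
  simp only [dil_apply, rotL_apply]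
  refine Prod.ext ?_ (Prod.ext ?_ rfl)
  · ext j; simp; ring
  · ext j; simp; ring

lemma N2_dil {s : ℝ} (hs : 0 < s) (hs1 : s ≤ 1) (p : Pt n) : s ^ 4 * N2 n p ≤ N2 n (dil n s p) := by
  have h : s ^ 4 ≤ s ^ 2 := pow_le_pow_of_le_one hs.le hs1 (by norm_num)
  have hx : 0 ≤ ∑ j, (p.1 j) ^ 2 := Finset.sum_nonneg fun i _ => sq_nonneg _
  have hy : 0 ≤ ∑ j, (p.2.1 j) ^ 2 := Finset.sum_nonneg fun i _ => sq_nonneg _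
  have e : N2 n (dil n s p) = s ^ 2 * ∑ j, (p.1 j) ^ 2 + s ^ 2 * ∑ j, (p.2.1 j) ^ 2 + s ^ 4 * p.2.2 ^ 2 := by
    simp only [N2, dil_apply, Pi.smul_apply, smul_eq_mul, mul_pow, Finset.mul_sum]
    ring
  rw [e, N2]
  nlinarith

lemma bmp_zero {p : Pt n} (h : 4 ≤ N2 n p) : bmp n p = 0 := by
  unfold bmp
  apply ContDiffBump.zero_of_le_dist
  simpa only [dist_zero_right, Real.norm_eq_abs, abs_of_nonneg (N2_nonneg p)] using h

lemma chi_contDiff (s : ℝ) : ContDiff ℝ (⊤ : ℕ∞) fun p => bmp n (dil n s p) :=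
  bmp_test.1.comp (LinearMap.toContinuousLinearMap (dil n s)).contDiff

lemma chi_test {s : ℝ} (hs : 0 < s) (hs1 : s ≤ 1) : TestFun n fun p => bmp n (dil n s p) := by
  refine ⟨chi_contDiff s, ?_⟩
  refine HasCompactSupport.of_support_subset_isCompact (N2_closed (2 / s ^ 2)) fun p hp => ?_
  by_contra h
  apply hp
  apply bmp_zero
  have h : (2 / s ^ 2) ^ 2 < N2 n p := not_le.1 h
  refine le_trans ?_ (N2_dil hs hs1 p)
  calc (4:ℝ) = s ^ 4 * (2 / s ^ 2) ^ 2 := by field_simp; norm_num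
    _ ≤ _ := by gcongr

lemma chi_Zd (s : ℝ) (i : Ix n) (p : Pt n) :
    Zd n i (fun p => bmp n (dil n s p)) p = s * Zd n i (bmp n) (dil n s p) := by
  have h1 : HasFDerivAt (fun p => bmp n (dil n s p))
      ((fderiv ℝ (bmp n) (dil n s p)).comp (LinearMap.toContinuousLinearMap (dil n s))) p :=
    (bmp_test.differentiable (dil n s p)).hasFDerivAt.comp p
      (LinearMap.toContinuousLinearMap (dil n s)).hasFDerivAt
  have e1 : dil n s (ev n i) = s • ev n i := by
    rcases i with j | j <;> simp [ev, ex, ey, dil_apply]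
  have e2 : dil n s (et n) = s ^ 2 • et n := by simp [et, dil_apply]
  have e3 : Lf n i (dil n s p) = s * Lf n i p := by
    rcases i with j | j
    · simp [Lf_inl, dil_apply]; ring
    · simp [Lf_inr, dil_apply]; ring
  unfold Zd
  rw [h1.fderiv]
  simp only [ContinuousLinearMap.comp_apply, LinearMap.coe_toContinuousLinearMap', e1, e2, e3, map_smul,
    smul_eq_mul]
  ring

lemma Zd_bmp_zero {p : Pt n} (h : N2 n p < 1) (i : Ix n) : Zd n i (bmp n) p = 0 := by
  have : bmp n =ᶠ[𝓝 p] fun _ => (1:ℝ) := by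
    filter_upwards [(N2_contDiff (n := n)).continuous.continuousAt.eventually_lt continuousAt_const h] with q hq
    exact bmp_one (le_of_lt hq)
  unfold Zd
  rw [this.fderiv_eq]
  simp

lemma elp_dil {f : Pt n → ℝ} (hf : Continuous f) {s : ℝ} (hs : 0 < s) :
    eLpNorm (fun p => s * f (dil n s p)) (ENNReal.ofReal (Qh n)) volume =
      eLpNorm f (ENNReal.ofReal (Qh n)) volume := by
  have hQ : 0 < Qh n := by unfold Qh; positivity
  have hdet : LinearMap.det (dil n s) ≠ 0 := by rw [dil_det]; positivity
  have hmap := Measure.map_linearMap_addHaar_eq_smul_addHaar (volume : Measure (Pt n)) hdet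
  have e1 : eLpNorm (fun p => f (dil n s p)) (ENNReal.ofReal (Qh n)) volume =
      ENNReal.ofReal s⁻¹ * eLpNorm f (ENNReal.ofReal (Qh n)) volume := by
    have h2 := eLpNorm_map_measure (p := ENNReal.ofReal (Qh n)) (μ := (volume : Measure (Pt n)))
      (f := dil n s) (g := f) hf.aestronglyMeasurable (dil_cont s).aemeasurable
    rw [Function.comp_def] at h2
    rw [← h2, hmap, eLpNorm_smul_measure_of_ne_top ENNReal.ofReal_ne_top]
    rw [one_div, ENNReal.toReal_inv, ENNReal.toReal_ofReal hQ.le, smul_eq_mul, dil_det, abs_of_pos (by positivity),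
      ENNReal.ofReal_rpow_of_pos (by positivity)]
    congr 2
    have : s ^ (2 * n + 2) = s ^ Qh n := by
      unfold Qh; rw [← Real.rpow_natCast]; push_cast; rfl
    rw [this, ← Real.rpow_neg hs.le, ← Real.rpow_mul hs.le, neg_mul, mul_inv_cancel₀ hQ.ne', Real.rpow_neg_one]
  have e2 : (fun p => s * f (dil n s p)) = s • fun p => f (dil n s p) := rfl
  rw [e2, eLpNorm_const_smul, e1, ← mul_assoc, Real.enorm_eq_ofReal hs.le,
    ← ENNReal.ofReal_mul hs.le, mul_inv_cancel₀ hs.ne']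
  simp

lemma holder_trip (hn : 1 ≤ n) : ENNReal.HolderTriple (ENNReal.ofReal (Qs n)) (ENNReal.ofReal (Qh n)) 2 := by
  have hq := Qs_gt hn
  have hn0 : (0:ℝ) < n := by exact_mod_cast hn
  have hQ : 0 < Qh n := by unfold Qh; positivity
  constructor
  rw [← ENNReal.ofReal_inv_of_pos (by linarith), ← ENNReal.ofReal_inv_of_pos hQ,
    ← ENNReal.ofReal_add (by positivity) (by positivity)]
  rw [show (2:ℝ≥0∞)⁻¹ = ENNReal.ofReal (2⁻¹) by rw [ENNReal.ofReal_inv_of_pos (by norm_num)]; simp]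
  congr 1
  rw [Qs_eq hn]; unfold Qh
  field_simp

lemma cutoff (hn : 1 ≤ n) {u : Pt n → ℝ} {g : Ix n → Pt n → ℝ} (h : HD n u g)
    (hr : RotInv n u) {ε : ℝ≥0∞} (hε : 0 < ε) :
    ∃ v g', HD n v g' ∧ HasCompactSupport v ∧ RotInv n v ∧
      eLpNorm (fun p => v p - u p) (ENNReal.ofReal (Qs n)) volume ≤ ε ∧
      ∀ i, eLpNorm (fun p => g' i p - g i p) 2 volume ≤ ε := by
  have hq := Qs_gt hn
  have two : (2:ℝ≥0∞) = ENNReal.ofReal 2 := by simp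
  have hε2 : 0 < ε / 2 := ENNReal.half_pos hε.ne'
  have ht : ∀ p : Pt n, Tendsto (fun s => N2 n (dil n s p)) (𝓝[>] 0) (𝓝 0) := by
    intro p
    have h1 : Continuous fun s : ℝ => N2 n (dil n s p) := by
      simp only [N2, dil_apply, Pi.smul_apply, smul_eq_mul]; fun_prop
    have := h1.tendsto 0
    simp only [N2, dil_apply] at this ⊢
    exact (by simpa using this : Tendsto _ (𝓝 (0:ℝ)) (𝓝 (0:ℝ))).mono_left nhdsWithin_le_nhds
  have ht1 : ∀ p : Pt n, Tendsto (fun s => bmp n (dil n s p) - 1) (𝓝[>] 0) (𝓝 0) := by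
    intro p
    refine tendsto_const_nhds.congr' ?_
    filter_upwards [(ht p).eventually (gt_mem_nhds (show (0:ℝ) < 1 by norm_num))] with s hs
    rw [bmp_one (le_of_lt hs)]; simp
  have hb1 : ∀ s (p : Pt n), |bmp n (dil n s p) - 1| ≤ 1 := by
    intro s p
    rw [abs_le]
    constructor <;> linarith [bmp_nonneg (dil n s p), bmp_le_one (dil n s p)]
  have hm1 : ∀ s, AEStronglyMeasurable (fun p : Pt n => bmp n (dil n s p) - 1) volume := fun s =>
    ((chi_contDiff s).continuous.sub continuous_const).aestronglyMeasurable
  have t1 := eLpNorm_small_of_tendsto (elp_dom (by linarith : 0 < Qs n) h.1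
    (fun s p => bmp n (dil n s p) - 1) hm1 hb1 ht1) hε
  have t2 : ∀ᶠ s in 𝓝[>] (0:ℝ), ∀ i, eLpNorm (fun p => (bmp n (dil n s p) - 1) * g i p) 2 volume ≤ ε / 2 := by
    rw [eventually_all]; intro i
    generalize ε / 2 = ε' at hε2
    rw [two]
    exact eLpNorm_small_of_tendsto (elp_dom (by norm_num) (two ▸ h.2.1 i)
      (fun s p => bmp n (dil n s p) - 1) hm1 hb1 ht1) hε2
  -- the commutator term
  let a : ℝ → Pt n → ℝ := fun s p => Set.indicator {p | 1 ≤ N2 n (dil n s p)} (fun _ => 1) p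
  have hS : ∀ s, MeasurableSet {p : Pt n | 1 ≤ N2 n (dil n s p)} := fun s =>
    (isClosed_le continuous_const (N2_contDiff.continuous.comp (dil_cont s))).measurableSet
  have ha : ∀ s, AEStronglyMeasurable (a s) volume := fun s =>
    (measurable_const.indicator (hS s)).aestronglyMeasurable
  have hab : ∀ s p, |a s p| ≤ 1 := by
    intro s p
    simp only [a, Set.indicator_apply]; split_ifs <;> simp
  have hat : ∀ p, Tendsto (fun s => a s p) (𝓝[>] 0) (𝓝 0) := by
    intro p
    refine tendsto_const_nhds.congr' ?_
    filter_upwards [(ht p).eventually (gt_mem_nhds (show (0:ℝ) < 1 by norm_num))] with s hs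
    simp only [a, Set.indicator_apply]
    rw [if_neg]
    simpa using hs
  have t0 := elp_dom (by linarith : 0 < Qs n) h.1 a ha hab hat
  have hbound : ∀ s, 0 < s → ∀ i, eLpNorm (fun p => u p * Zd n i (fun p => bmp n (dil n s p)) p) 2 volume
      ≤ eLpNorm (fun p => a s p * u p) (ENNReal.ofReal (Qs n)) volume *
        eLpNorm (Zd n i (bmp n)) (ENNReal.ofReal (Qh n)) volume := by
    intro s hs i
    have := holder_trip hn
    rw [← elp_dil (bmp_test.tZd i).1.continuous hs]
    have e : (fun p => u p * Zd n i (fun p => bmp n (dil n s p)) p) =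
        (fun p => a s p * u p) • (fun p => s * Zd n i (bmp n) (dil n s p)) := by
      ext p
      simp only [Pi.smul_apply', smul_eq_mul, chi_Zd, a, Set.indicator_apply]
      split_ifs with hp
      · ring
      · rw [Zd_bmp_zero (by simpa using hp)]; simp
    rw [e]
    exact eLpNorm_smul_le_mul_eLpNorm
      ((((bmp_test.tZd i).1.continuous.comp (dil_cont s)).const_smul s).aestronglyMeasurable) ((ha s).mul h.1.1)
  have t3 : ∀ᶠ s in 𝓝[>] (0:ℝ), ∀ i,
      eLpNorm (fun p => u p * Zd n i (fun p => bmp n (dil n s p)) p) 2 volume ≤ ε / 2 := by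
    rw [eventually_all]; intro i
    have hfin := ((bmp_test (n := n)).tZd i).memLp (ENNReal.ofReal (Qh n)) |>.2.ne
    have t4 := ENNReal.Tendsto.mul_const t0 (Or.inr hfin)
    rw [zero_mul] at t4
    filter_upwards [eLpNorm_small_of_tendsto t4 hε2, self_mem_nhdsWithin] with s hs hs0
    exact (hbound s hs0 i).trans hs
  have hlt1 : ∀ᶠ s in 𝓝[>] (0:ℝ), s ≤ 1 :=
    nhdsWithin_le_nhds (Iic_mem_nhds (by norm_num))
  obtain ⟨s, ⟨⟨⟨h1, h2⟩, h3⟩, hs1⟩, hs⟩ :=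
    ((t1.and t2).and t3 |>.and hlt1 |>.and self_mem_nhdsWithin).exists
  have hs : 0 < s := hs
  have hχ := chi_test (n := n) hs hs1
  refine ⟨fun p => bmp n (dil n s p) * u p,
    fun i p => bmp n (dil n s p) * g i p + u p * Zd n i (fun p => bmp n (dil n s p)) p,
    ⟨?_, fun i => ?_, fun φ hφ i => h.cut_aux hn hχ hφ i⟩, hχ.2.mul_right, ?_, ?_, fun i => ?_⟩
  · refine h.1.of_le (hχ.1.continuous.aestronglyMeasurable.mul h.1.1) (.of_forall fun p => ?_)
    rw [norm_mul, Real.norm_eq_abs, abs_of_nonneg (bmp_nonneg _)]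
    exact mul_le_of_le_one_left (norm_nonneg _) (bmp_le_one _)
  · refine MemLp.add ?_ ⟨h.1.1.mul (hχ.tZd i).1.continuous.aestronglyMeasurable, ?_⟩
    · refine (h.2.1 i).of_le (hχ.1.continuous.aestronglyMeasurable.mul (h.2.1 i).1) (.of_forall fun p => ?_)
      rw [norm_mul, Real.norm_eq_abs, abs_of_nonneg (bmp_nonneg _)]
      exact mul_le_of_le_one_left (norm_nonneg _) (bmp_le_one _)
    · refine (hbound s hs i).trans_lt (ENNReal.mul_lt_top ?_ (((bmp_test (n := n)).tZd i).memLp _).2)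
      refine (eLpNorm_mono fun p => ?_).trans_lt h.1.2
      rw [norm_mul, Real.norm_eq_abs]
      exact mul_le_of_le_one_left (norm_nonneg _) (hab s p)
  · intro θ p
    simp only [dil_rot, bmp_rot θ, hr θ]
  · convert h1 using 2
    ext p; ring
  · have e : (fun p => bmp n (dil n s p) * g i p + u p * Zd n i (fun p => bmp n (dil n s p)) p - g i p) =
        (fun p => (bmp n (dil n s p) - 1) * g i p) +
          fun p => u p * Zd n i (fun p => bmp n (dil n s p)) p := by
      ext p; simp only [Pi.add_apply]; ring
    rw [e]
    refine (eLpNorm_add_le ((hm1 s).mul (h.2.1 i).1)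
      (h.1.1.mul (hχ.tZd i).1.continuous.aestronglyMeasurable) (by norm_num)).trans ?_
    calc _ ≤ ε / 2 + ε / 2 := add_le_add (h2 i) (h3 i)
      _ = ε := ENNReal.add_halves ε

/-- density of rotation invariant test functions -/
theorem dens (hn : 1 ≤ n) {u : Pt n → ℝ} {g : Ix n → Pt n → ℝ} (h : HD n u g)
    (hr : RotInv n u) {ε : ℝ≥0∞} (hε : 0 < ε) :
    ∃ φ, TestFun n φ ∧ RotInv n φ ∧ eLpNorm (fun p => φ p - u p) (ENNReal.ofReal (Qs n)) volume ≤ ε ∧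
      ∀ i, eLpNorm (fun p => Zd n i φ p - g i p) 2 volume ≤ ε := by
  have hε2 : 0 < ε / 2 := ENNReal.half_pos hε.ne'
  obtain ⟨v, g', hv, hvs, hvr, h1, h2⟩ := cutoff hn h hr hε2
  obtain ⟨φ, hφ, hφr, h3, h4⟩ := dens_compact hn hv hvs hvr hε2
  refine ⟨φ, hφ, hφr, ?_, fun i => ?_⟩
  · have e : (fun p => φ p - u p) = (fun p => φ p - v p) + fun p => v p - u p := by ext p; simp
    rw [e]
    refine (eLpNorm_add_le (hφ.1.continuous.aestronglyMeasurable.sub hv.1.1)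
      (hv.1.1.sub h.1.1) (one_le_Qs hn)).trans ?_
    calc _ ≤ ε / 2 + ε / 2 := add_le_add h3 h1
      _ = ε := ENNReal.add_halves ε
  · have e : (fun p => Zd n i φ p - g i p) = (fun p => Zd n i φ p - g' i p) + fun p => g' i p - g i p := by
      ext p; simp
    rw [e]
    refine (eLpNorm_add_le ((hφ.tZd i).1.continuous.aestronglyMeasurable.sub (hv.2.1 i).1)
      ((hv.2.1 i).1.sub (h.2.1 i).1) (by norm_num)).trans ?_
    calc _ ≤ ε / 2 + ε / 2 := add_le_add (h4 i) (h2 i)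
      _ = ε := ENNReal.add_halves ε

end P4
end HeisAux

namespace HeisAux
open ENNReal
section P5
variable {n : ℕ}

/-- real valued `L^r` norm -/
def nr {n : ℕ} (r : ℝ≥0∞) (u : Pt n → ℝ) : ℝ := (eLpNorm u r volume).toReal

lemma nr_nonneg (r : ℝ≥0∞) (u : Pt n → ℝ) : 0 ≤ nr r u := ENNReal.toReal_nonneg

lemma nr_le {r : ℝ≥0∞} {u : Pt n → ℝ} {c : ℝ} (hc : 0 ≤ c) (h : eLpNorm u r volume ≤ ENNReal.ofReal c) :
    nr r u ≤ c := by
  have := ENNReal.toReal_mono ENNReal.ofReal_ne_top h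
  rwa [ENNReal.toReal_ofReal hc] at this

lemma ofReal_nr {r : ℝ≥0∞} {u : Pt n → ℝ} (hu : MemLp u r volume) :
    ENNReal.ofReal (nr r u) = eLpNorm u r volume := ENNReal.ofReal_toReal hu.2.ne

lemma nr_add_le {r : ℝ≥0∞} (hr : 1 ≤ r) {u v : Pt n → ℝ} (hu : MemLp u r volume) (hv : MemLp v r volume) :
    nr r (fun p => u p + v p) ≤ nr r u + nr r v := by
  unfold nr
  rw [← ENNReal.toReal_add hu.2.ne hv.2.ne]
  exact ENNReal.toReal_mono (ENNReal.add_ne_top.2 ⟨hu.2.ne, hv.2.ne⟩) (eLpNorm_add_le hu.1 hv.1 hr)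

lemma nr_sub_comm (r : ℝ≥0∞) (u v : Pt n → ℝ) : nr r (fun p => u p - v p) = nr r (fun p => v p - u p) := by
  unfold nr
  congr 1
  refine eLpNorm_congr_norm_ae (.of_forall fun p => ?_)
  exact norm_sub_rev _ _

lemma nr_tri {r : ℝ≥0∞} (hr : 1 ≤ r) {u v : Pt n → ℝ} (hu : MemLp u r volume) (hv : MemLp v r volume) :
    |nr r u - nr r v| ≤ nr r (fun p => u p - v p) := by
  have h1 := nr_add_le hr (hu.sub hv) hv
  have h2 := nr_add_le hr (hv.sub hu) hu
  simp only [Pi.sub_apply, sub_add_cancel] at h1 h2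
  have e1 : nr r (u - v) = nr r (fun p => u p - v p) := rfl
  have e2 : nr r (v - u) = nr r (fun p => u p - v p) := nr_sub_comm r v u
  rw [e1] at h1; rw [e2] at h2
  rw [abs_le]
  constructor
  · have : nr r (fun p => v p) = nr r v := rfl
    linarith
  · have : nr r (fun p => u p) = nr r u := rfl
    linarith

lemma nr_tendsto {r : ℝ≥0∞} (hr : 1 ≤ r) {u : ℕ → Pt n → ℝ} {v : Pt n → ℝ} (hu : ∀ k, MemLp (u k) r volume)
    (hv : MemLp v r volume) (h : Tendsto (fun k => nr r (fun p => u k p - v p)) atTop (𝓝 0)) :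
    Tendsto (fun k => nr r (u k)) atTop (𝓝 (nr r v)) := by
  rw [tendsto_iff_norm_sub_tendsto_zero]
  exact squeeze_zero (fun _ => norm_nonneg _) (fun k => nr_tri hr (hu k) hv) h

lemma nr_rpow {q : ℝ} (hq : 0 < q) {u : Pt n → ℝ} (hu : MemLp u (ENNReal.ofReal q) volume) :
    nr (ENNReal.ofReal q) u ^ q = ∫ p, |u p| ^ q := by
  unfold nr
  rw [hu.eLpNorm_eq_integral_rpow_norm (by simpa using hq) ENNReal.ofReal_ne_top]
  rw [ENNReal.toReal_ofReal hq.le]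
  have h0 : 0 ≤ ∫ p, ‖u p‖ ^ q := integral_nonneg fun p => by positivity
  rw [ENNReal.toReal_ofReal (by positivity), ← Real.rpow_mul h0, inv_mul_cancel₀ hq.ne', Real.rpow_one]
  rfl

lemma nr_eq {q : ℝ} (hq : 0 < q) {u : Pt n → ℝ} (hu : MemLp u (ENNReal.ofReal q) volume) :
    nr (ENNReal.ofReal q) u = (∫ p, |u p| ^ q) ^ q⁻¹ := by
  rw [← nr_rpow hq hu, ← Real.rpow_mul (nr_nonneg _ _), mul_inv_cancel₀ hq.ne', Real.rpow_one]

lemma nr_sq {u : Pt n → ℝ} (hu : MemLp u 2 volume) : nr 2 u ^ 2 = ∫ p, u p ^ 2 := by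
  have two : (2:ℝ≥0∞) = ENNReal.ofReal 2 := by simp
  rw [two] at hu ⊢
  have := nr_rpow (by norm_num) hu
  rw [← Real.rpow_natCast]
  push_cast
  rw [this]
  congr 1; ext p
  norm_num

lemma int_rpow {q : ℝ} (hq : 0 < q) {u : Pt n → ℝ} (hu : MemLp u (ENNReal.ofReal q) volume) :
    Integrable (fun p => |u p| ^ q) volume := by
  have := hu.integrable_norm_rpow (by simpa using hq) ENNReal.ofReal_ne_top
  rwa [ENNReal.toReal_ofReal hq.le] at this

theorem dens_seq (hn : 1 ≤ n) {u : Pt n → ℝ} {g : Ix n → Pt n → ℝ} (h : HD n u g) (hr : RotInv n u) :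
    ∃ φ : ℕ → Pt n → ℝ, (∀ k, TestFun n (φ k)) ∧ (∀ k, RotInv n (φ k)) ∧
      Tendsto (fun k => nr (ENNReal.ofReal (Qs n)) (fun p => φ k p - u p)) atTop (𝓝 0) ∧
      ∀ i, Tendsto (fun k => nr 2 (fun p => Zd n i (φ k) p - g i p)) atTop (𝓝 0) := by
  have h0 : ∀ k : ℕ, (0:ℝ) < 1 / ((k:ℝ) + 1) := fun k => by positivity
  choose φ h1 h2 h3 h4 using fun k : ℕ => dens hn h hr (ENNReal.ofReal_pos.2 (h0 k))
  exact ⟨φ, h1, h2, squeeze_zero (fun _ => nr_nonneg _ _) (fun k => nr_le (h0 k).le (h3 k))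
    tendsto_one_div_add_atTop_nhds_zero_nat,
    fun i => squeeze_zero (fun _ => nr_nonneg _ _) (fun k => nr_le (h0 k).le (h4 k i))
    tendsto_one_div_add_atTop_nhds_zero_nat⟩

lemma hGradSq_eq (φ : Pt n → ℝ) (p : Pt n) : hGradSq n φ p = ∑ i, Zd n i φ p ^ 2 := by
  rw [Fintype.sum_sum_type]
  simp only [Zd_inl, Zd_inr, hGradSq, hDot, Finset.sum_add_distrib, sq]

lemma Zd_smul (c : ℝ) {φ : Pt n → ℝ} (hφ : TestFun n φ) (i : Ix n) (p : Pt n) :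
    Zd n i (fun p => c * φ p) p = c * Zd n i φ p := by
  unfold Zd
  rw [fderiv_const_mul (hφ.differentiable p)]
  simp; ring

lemma sobolev_test (hn : 1 ≤ n) {S : ℝ}
    (hS : S = sInf { c : ℝ | ∃ v : Pt n → ℝ, TestFun n v ∧
        (∫ p : Pt n, |v p| ^ Qs n) ^ (2 / Qs n) = 1 ∧
        c = ∫ p : Pt n, hGradSq n v p }) {φ : Pt n → ℝ} (hφ : TestFun n φ) :
    S * nr (ENNReal.ofReal (Qs n)) φ ^ 2 ≤ ∑ i, nr 2 (Zd n i φ) ^ 2 := by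
  have hq := Qs_gt hn
  have hq0 : 0 < Qs n := by linarith
  have hm := hφ.memLp (ENNReal.ofReal (Qs n))
  set a := nr (ENNReal.ofReal (Qs n)) φ with ha
  rcases (nr_nonneg (ENNReal.ofReal (Qs n)) φ).eq_or_lt with h0 | h0
  · rw [← ha] at h0
    rw [← h0]
    simp
    positivity
  rw [← ha] at h0
  have hψ : TestFun n (fun p => a⁻¹ * φ p) := hφ.mul contDiff_const
  have hle : S ≤ ∫ p, hGradSq n (fun p => a⁻¹ * φ p) p := by
    rw [hS]
    refine csInf_le ⟨0, ?_⟩ ⟨_, hψ, ?_, rfl⟩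
    · rintro c ⟨v, -, -, rfl⟩
      refine integral_nonneg fun p => ?_
      simp only [Pi.zero_apply]
      rw [hGradSq_eq]; positivity
    · have : ∫ p, |a⁻¹ * φ p| ^ Qs n = 1 := by
        simp only [abs_mul]
        have : ∀ p, (|a⁻¹| * |φ p|) ^ Qs n = (a⁻¹) ^ Qs n * |φ p| ^ Qs n := fun p => by
          rw [Real.mul_rpow (by positivity) (by positivity), abs_of_pos (by positivity)]
        simp only [this]
        rw [integral_const_mul, ← nr_rpow hq0 hm, ← ha, Real.inv_rpow h0.le, inv_mul_cancel₀]
        positivity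
      rw [this, Real.one_rpow]
  have e : ∫ p, hGradSq n (fun p => a⁻¹ * φ p) p = (a⁻¹) ^ 2 * ∑ i, nr 2 (Zd n i φ) ^ 2 := by
    have e1 : ∀ p, hGradSq n (fun p => a⁻¹ * φ p) p = (a⁻¹) ^ 2 * ∑ i, Zd n i φ p ^ 2 := by
      intro p
      rw [hGradSq_eq, Finset.mul_sum]
      refine Finset.sum_congr rfl fun i _ => ?_
      rw [Zd_smul _ hφ]; ring
    simp only [e1]
    rw [integral_const_mul, integral_finsetSum]
    · congr 1
      refine Finset.sum_congr rfl fun i _ => ?_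
      rw [nr_sq ((hφ.tZd i).memLp 2)]
    · exact fun i _ => ((hφ.tZd i).memLp 2).integrable_sq
  rw [e] at hle
  calc S * a ^ 2 ≤ ((a⁻¹) ^ 2 * ∑ i, nr 2 (Zd n i φ) ^ 2) * a ^ 2 := by gcongr
    _ = _ := by field_simp

theorem sobolev (hn : 1 ≤ n) {S : ℝ}
    (hS : S = sInf { c : ℝ | ∃ v : Pt n → ℝ, TestFun n v ∧
        (∫ p : Pt n, |v p| ^ Qs n) ^ (2 / Qs n) = 1 ∧
        c = ∫ p : Pt n, hGradSq n v p }) {u : Pt n → ℝ} {g : Ix n → Pt n → ℝ} (h : HD n u g)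
    (hr : RotInv n u) :
    S * nr (ENNReal.ofReal (Qs n)) u ^ 2 ≤ ∑ i, nr 2 (g i) ^ 2 := by
  obtain ⟨φ, h1, h2, h3, h4⟩ := dens_seq hn h hr
  have t1 := nr_tendsto (one_le_Qs hn) (fun k => (h1 k).memLp _) h.1 h3
  have t2 := fun i => nr_tendsto (by norm_num) (fun k => ((h1 k).tZd i).memLp 2) (h.2.1 i) (h4 i)
  exact le_of_tendsto_of_tendsto' ((t1.pow 2).const_mul S)
    (tendsto_finsetSum _ fun i _ => (t2 i).pow 2) fun k => sobolev_test hn hS (h1 k)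

end P5
end HeisAux

namespace HeisAux
open ENNReal
section P6
variable {n : ℕ}

def zsq (n : ℕ) (p : Pt n) : ℝ := ∑ j, (p.1 j) ^ 2 + ∑ j, (p.2.1 j) ^ 2

lemma zsq_cont : Continuous (zsq n) := by unfold zsq; fun_prop

def cf (n : ℕ) (v : Pt n) : Ix n → ℝ
  | .inl j => v.1 j
  | .inr j => v.2.1 j

lemma cf_le (v : Pt n) (i : Ix n) : |cf n v i| ≤ ‖v‖ := by
  rcases i with j | j
  · exact (norm_le_pi_norm v.1 j).trans (norm_fst_le v)
  · exact (norm_le_pi_norm v.2.1 j).trans ((norm_fst_le v.2).trans (norm_snd_le v))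

lemma decomp (v : Pt n) : v = ∑ i, cf n v i • ev n i + v.2.2 • et n := by
  rw [Fintype.sum_sum_type]
  refine Prod.ext ?_ (Prod.ext ?_ ?_)
  · ext j
    simp [cf, ev, ex, ey, et, Prod.fst_sum, Prod.snd_sum, Finset.sum_apply, Pi.single_apply]
  · ext j
    simp [cf, ev, ex, ey, et, Prod.fst_sum, Prod.snd_sum, Finset.sum_apply, Pi.single_apply]
  · simp [cf, ev, ex, ey, et, Prod.snd_sum]

lemma rot_deriv {φ : Pt n → ℝ} (hφ : TestFun n φ) (hr : RotInv n φ) (p : Pt n) :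
    fderiv ℝ φ p (p.2.1, -p.1, 0) = 0 := by
  have h1 : HasDerivAt (fun θ => rotL n θ p) (p.2.1, -p.1, 0) 0 := by
    simp only [rotL_apply]
    refine HasDerivAt.prodMk ?_ (HasDerivAt.prodMk ?_ (hasDerivAt_const _ _))
    · have := (((Real.hasDerivAt_cos 0).smul_const p.1) |>.fun_add ((Real.hasDerivAt_sin 0).smul_const p.2.1))
      simpa using this
    · have := (((Real.hasDerivAt_sin 0).neg.smul_const p.1) |>.fun_add ((Real.hasDerivAt_cos 0).smul_const p.2.1))
      simpa using this
  have h0 : rotL n 0 p = p := by simp [rotL_apply]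
  have h2 : HasFDerivAt φ (fderiv ℝ φ p) (rotL n 0 p) := by
    rw [h0]; exact (hφ.differentiable p).hasFDerivAt
  have h3 := h2.comp_hasDerivAt 0 h1
  have h4 : (φ ∘ fun θ => rotL n θ p) = fun _ => φ p := by ext θ; exact hr θ p
  rw [h4] at h3
  exact h3.unique (hasDerivAt_const _ _)

lemma grad_bound {φ : Pt n → ℝ} (hφ : TestFun n φ) (hr : RotInv n φ) {p : Pt n} {R m : ℝ}
    (hR : ‖p‖ ≤ R) (hm : 0 < m) (hz : m ≤ zsq n p) :
    ‖fderiv ℝ φ p‖ ≤ (1 + (4 * n * R + 1) * (R / (2 * m))) * ∑ i, |Zd n i φ p| := by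
  set D := fderiv ℝ φ p with hD
  set Sg := ∑ i, |Zd n i φ p| with hSg
  have hR0 : 0 ≤ R := (norm_nonneg p).trans hR
  have hSg0 : 0 ≤ Sg := Finset.sum_nonneg fun i _ => abs_nonneg _
  have e1 : 2 * zsq n p * D (et n) = ∑ i, cf n (p.2.1, -p.1, 0) i * Zd n i φ p := by
    have h0 := rot_deriv hφ hr p
    rw [← hD, decomp (p.2.1, -p.1, 0)] at h0
    simp only [map_add, map_sum, map_smul, smul_eq_mul, zero_mul, add_zero] at h0
    have : ∑ i, cf n (p.2.1, -p.1, 0) i * Zd n i φ p =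
        ∑ i, cf n (p.2.1, -p.1, 0) i * D (ev n i) + (∑ i, cf n (p.2.1, -p.1, 0) i * Lf n i p) * D (et n) := by
      rw [Finset.sum_mul, ← Finset.sum_add_distrib]
      refine Finset.sum_congr rfl fun i _ => ?_
      unfold Zd; rw [← hD]; ring
    rw [this, h0, zero_add]
    congr 1
    rw [Fintype.sum_sum_type]
    simp only [cf, Lf_inl, Lf_inr, zsq, mul_add, Finset.mul_sum, Pi.neg_apply]
    rw [add_comm]
    congr 1 <;> refine Finset.sum_congr rfl fun j _ => ?_ <;> ring
  have hnorm : ‖((p.2.1, -p.1, 0) : Pt n)‖ ≤ ‖p‖ := by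
    simp only [Prod.norm_mk, norm_neg, norm_zero]
    refine max_le ?_ (max_le ?_ (norm_nonneg _))
    · exact (norm_fst_le p.2).trans (norm_snd_le p)
    · exact norm_fst_le p
  have hDt : |D (et n)| ≤ R / (2 * m) * Sg := by
    have h1 : 2 * zsq n p * |D (et n)| ≤ R * Sg := by
      have : |2 * zsq n p * D (et n)| = 2 * zsq n p * |D (et n)| := by
        rw [abs_mul, abs_of_pos (by linarith)]
      rw [← this, e1, hSg, Finset.mul_sum]
      refine (Finset.abs_sum_le_sum_abs _ _).trans (Finset.sum_le_sum fun i _ => ?_)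
      rw [abs_mul]
      gcongr
      exact (cf_le _ i).trans (hnorm.trans hR)
    rw [div_mul_eq_mul_div, le_div_iff₀ (by positivity)]
    nlinarith [abs_nonneg (D (et n))]
  have hLf : ∀ i, |Lf n i p| ≤ 2 * R := by
    intro i
    rcases i with j | j
    · rw [Lf_inl, abs_mul, abs_of_pos (by norm_num : (0:ℝ) < 2)]
      gcongr; exact (cf_le p (.inr j)).trans hR
    · rw [Lf_inr, abs_mul, show |(-2:ℝ)| = 2 by norm_num]
      gcongr; exact (cf_le p (.inl j)).trans hR
  have hDe : ∀ i, |D (ev n i)| ≤ |Zd n i φ p| + 2 * R * |D (et n)| := by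
    intro i
    have : D (ev n i) = Zd n i φ p - Lf n i p * D (et n) := by unfold Zd; rw [← hD]; ring
    rw [this]
    refine (abs_sub _ _).trans ?_
    rw [abs_mul]
    gcongr
    exact hLf i
  refine ContinuousLinearMap.opNorm_le_bound _ (by positivity) fun v => ?_
  have hv : D v = ∑ i, cf n v i * D (ev n i) + v.2.2 * D (et n) := by
    conv_lhs => rw [decomp v]
    simp
  rw [hv, Real.norm_eq_abs]
  have hv2 : |v.2.2| ≤ ‖v‖ := (norm_snd_le v.2).trans (norm_snd_le v)
  calc |∑ i, cf n v i * D (ev n i) + v.2.2 * D (et n)|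
      ≤ ∑ i, ‖v‖ * (|Zd n i φ p| + 2 * R * |D (et n)|) + ‖v‖ * |D (et n)| := by
        refine (abs_add_le _ _).trans (add_le_add ?_ ?_)
        · refine (Finset.abs_sum_le_sum_abs _ _).trans (Finset.sum_le_sum fun i _ => ?_)
          rw [abs_mul]
          exact mul_le_mul (cf_le v i) (hDe i) (abs_nonneg _) (norm_nonneg _)
        · rw [abs_mul]; gcongr
    _ = (Sg + (4 * n * R + 1) * |D (et n)|) * ‖v‖ := by
        rw [← Finset.mul_sum, Finset.sum_add_distrib, ← hSg]
        simp
        ring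
    _ ≤ (Sg + (4 * n * R + 1) * (R / (2 * m) * Sg)) * ‖v‖ := by gcongr
    _ = _ := by ring

lemma grad_cut {η : Pt n → ℝ} (hη : TestFun n η) (hax : ∀ p ∈ tsupport η, 0 < zsq n p) :
    ∃ C : ℝ, 0 ≤ C ∧ ∀ φ, TestFun n φ → RotInv n φ → ∀ p,
      ‖fderiv ℝ (fun p => η p * φ p) p‖ ≤ (tsupport η).indicator (fun p => C * (|φ p| + ∑ i, |Zd n i φ p|)) p := by
  obtain ⟨R, hR⟩ := hη.2.isCompact.isBounded.exists_norm_le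
  have hmin : ∃ m > 0, ∀ p ∈ tsupport η, m ≤ zsq n p := by
    rcases (tsupport η).eq_empty_or_nonempty with h | h
    · exact ⟨1, by norm_num, by simp [h]⟩
    · obtain ⟨q, hq, hq2⟩ := hη.2.isCompact.exists_isMinOn h zsq_cont.continuousOn
      exact ⟨zsq n q, hax q hq, fun p hp => hq2 hp⟩
  obtain ⟨m, hm, hm2⟩ := hmin
  obtain ⟨A, hA⟩ := (hη.1.continuous.norm.bddAbove_range_of_hasCompactSupport hη.2.norm)
  obtain ⟨B, hB⟩ := ((hη.1.continuous_fderiv (by simp)).norm.bddAbove_range_of_hasCompactSupport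
    (hη.2.fderiv ℝ).norm)
  have hA : ∀ p, ‖η p‖ ≤ A := fun p => hA ⟨p, rfl⟩
  have hB : ∀ p, ‖fderiv ℝ η p‖ ≤ B := fun p => hB ⟨p, rfl⟩
  have hA0 : 0 ≤ A := (norm_nonneg _).trans (hA 0)
  have hB0 : 0 ≤ B := (norm_nonneg _).trans (hB 0)
  set c := (1 + (4 * n * |R| + 1) * (|R| / (2 * m)))
  have hc : 0 ≤ c := by positivity
  refine ⟨A * c + B, by positivity, fun φ hφ hr p => ?_⟩
  by_cases hp : p ∈ tsupport η
  · rw [Set.indicator_of_mem hp]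
    rw [fderiv_fun_mul (hη.differentiable p) (hφ.differentiable p)]
    have h1 := grad_bound hφ hr ((hR p hp).trans (le_abs_self R)) hm (hm2 p hp)
    have hs : 0 ≤ ∑ i, |Zd n i φ p| := Finset.sum_nonneg fun i _ => abs_nonneg _
    calc ‖η p • fderiv ℝ φ p + φ p • fderiv ℝ η p‖
        ≤ ‖η p‖ * ‖fderiv ℝ φ p‖ + ‖φ p‖ * ‖fderiv ℝ η p‖ := by
          refine (norm_add_le _ _).trans ?_
          rw [norm_smul, norm_smul]
      _ ≤ A * (c * ∑ i, |Zd n i φ p|) + ‖φ p‖ * B := by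
          gcongr
          · exact hA p
          · exact hB p
      _ ≤ _ := by
          rw [Real.norm_eq_abs]
          nlinarith [abs_nonneg (φ p), mul_nonneg hA0 hc, mul_nonneg (mul_nonneg hA0 hc) (abs_nonneg (φ p)),
            mul_nonneg hB0 hs]
  · rw [Set.indicator_of_notMem hp]
    have : p ∉ tsupport (fun p => η p * φ p) := fun h => hp (tsupport_mul_subset_left h)
    have h2 := support_fderiv_subset ℝ (f := fun p => η p * φ p)
    have : fderiv ℝ (fun p => η p * φ p) p = 0 := by
      by_contra h
      exact this (h2 h)
    rw [this, norm_zero]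

end P6
end HeisAux

namespace HeisAux
open ENNReal
section P7
variable {n : ℕ}

lemma interp_aux {p q : ℝ} (hp : 1 < p) (hpq : p < q) {ε : ℝ} (hε : 0 < ε) :
    ∃ C : ℝ, 0 ≤ C ∧ ∀ x : ℝ, 0 ≤ x → x ^ p ≤ ε * x ^ q + C * x := by
  set R : ℝ := ε ^ (-(1 / (q - p))) with hR
  have hR0 : 0 < R := by positivity
  have hRe : R ^ (p - q) = ε := by
    rw [hR, ← Real.rpow_mul hε.le]
    have : -(1 / (q - p)) * (p - q) = 1 := by
      have : q - p ≠ 0 := by linarith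
      field_simp; ring
    rw [this, Real.rpow_one]
  refine ⟨R ^ (p - 1), by positivity, fun x hx => ?_⟩
  rcases le_total R x with h | h
  · have hx0 : 0 < x := hR0.trans_le h
    have h1 : x ^ (p - q) ≤ ε := by
      rw [← hRe]
      exact Real.rpow_le_rpow_of_nonpos hR0 h (by linarith)
    have h2 : x ^ p = x ^ (p - q) * x ^ q := by rw [← Real.rpow_add hx0]; congr 1; ring
    rw [h2]
    have : 0 ≤ R ^ (p - 1) * x := by positivity
    nlinarith [Real.rpow_nonneg hx q]
  · rcases hx.eq_or_lt with rfl | hx0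
    · rw [Real.zero_rpow (by linarith), Real.zero_rpow (by linarith)]; simp
    have h2 : x ^ p = x ^ (p - 1) * x := by
      conv_rhs => rw [← Real.rpow_one x]
      rw [← Real.rpow_mul hx, ← Real.rpow_add hx0]; congr 1; ring
    rw [h2]
    have : x ^ (p - 1) ≤ R ^ (p - 1) := Real.rpow_le_rpow hx h (by linarith)
    have h3 : 0 ≤ ε * x ^ q := by positivity
    rw [← h2, h2]
    nlinarith

lemma trans_L1 {ψ : Pt n → ℝ} (hψ : TestFun n ψ) (v : Pt n) :
    eLpNorm (fun p => ψ (p - v) - ψ p) 1 volume ≤ ENNReal.ofReal ‖v‖ * eLpNorm (fderiv ℝ ψ) 1 volume := by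
  have hc : Continuous (fderiv ℝ ψ) := hψ.1.continuous_fderiv (by simp)
  rw [eLpNorm_one_eq_lintegral_enorm, eLpNorm_one_eq_lintegral_enorm]
  have hpt : ∀ p, ‖ψ (p - v) - ψ p‖ₑ ≤ ∫⁻ s in Set.Ioc (0:ℝ) 1, ENNReal.ofReal ‖v‖ * ‖fderiv ℝ ψ (p - s • v)‖ₑ := by
    intro p
    have hd : ∀ s : ℝ, HasDerivAt (fun s : ℝ => ψ (p - s • v)) (fderiv ℝ ψ (p - s • v) (-v)) s := by
      intro s
      have h1 : HasDerivAt (fun s : ℝ => p - s • v) (-v) s := by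
        have := ((hasDerivAt_id s).smul_const v).const_sub p
        simpa using this
      exact (hψ.differentiable (p - s • v)).hasFDerivAt.comp_hasDerivAt s h1
    have hcont : Continuous fun s : ℝ => fderiv ℝ ψ (p - s • v) (-v) := by fun_prop
    have h2 := intervalIntegral.integral_eq_sub_of_hasDerivAt (a := 0) (b := 1) (fun s _ => hd s)
      (hcont.intervalIntegrable 0 1)
    simp only [one_smul, zero_smul, sub_zero] at h2
    rw [← h2, intervalIntegral.integral_of_le (by norm_num)]
    refine (enorm_integral_le_lintegral_enorm _).trans (lintegral_mono fun s => ?_)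
    rw [← ofReal_norm, ← ofReal_norm, ← ENNReal.ofReal_mul (norm_nonneg _)]
    refine ENNReal.ofReal_le_ofReal ?_
    refine (ContinuousLinearMap.le_opNorm _ _).trans ?_
    rw [norm_neg, mul_comm]
  calc ∫⁻ p, ‖ψ (p - v) - ψ p‖ₑ ≤ ∫⁻ p, ∫⁻ s in Set.Ioc (0:ℝ) 1, ENNReal.ofReal ‖v‖ * ‖fderiv ℝ ψ (p - s • v)‖ₑ :=
        lintegral_mono hpt
    _ = ∫⁻ s in Set.Ioc (0:ℝ) 1, ∫⁻ p, ENNReal.ofReal ‖v‖ * ‖fderiv ℝ ψ (p - s • v)‖ₑ := by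
        refine lintegral_lintegral_swap ?_
        have : Continuous fun z : Pt n × ℝ => fderiv ℝ ψ (z.1 - z.2 • v) := by fun_prop
        exact ((this.enorm.measurable).const_mul _).aemeasurable
    _ = ∫⁻ s in Set.Ioc (0:ℝ) 1, ENNReal.ofReal ‖v‖ * ∫⁻ p, ‖fderiv ℝ ψ p‖ₑ := by
        congr 1; ext s
        rw [lintegral_const_mul _ (by fun_prop)]
        rw [lintegral_sub_right_eq_self (fun p => ‖fderiv ℝ ψ p‖ₑ) (s • v)]
    _ = _ := by simp

lemma moll_L1 {ψ : Pt n → ℝ} (hψ : TestFun n ψ) {σ : ℝ} (hσ : 0 < σ) :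
    eLpNorm (fun p => moll volume (rho n) σ ψ p - ψ p) 1 volume ≤
      ENNReal.ofReal (2 * σ) * eLpNorm (fderiv ℝ ψ) 1 volume := by
  have e : (fun p => moll volume (rho n) σ ψ p - ψ p) =
      fun p => ∫ x, rho n x * (ψ (p - σ • x) - ψ p) := by
    ext p
    simp only [mul_sub]
    rw [integral_sub, integral_mul_const, rho_int, one_mul]; · rfl
    · exact moll_integrable rho_test.1.continuous rho_test.2 hσ hψ.1.continuous.locallyIntegrable p
    · exact (rho_test.1.continuous.integrable_of_hasCompactSupport rho_test.2).mul_const _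
  have hc := hψ.1.continuous
  have hρ := (rho_test (n := n)).1.continuous
  have h1 : (∫⁻ x, ‖rho n x‖ₑ) = 1 := by
    have := ofReal_integral_norm_eq_lintegral_enorm (hρ.integrable_of_hasCompactSupport (μ := volume) rho_test.2)
    rw [← this]
    simp only [Real.norm_eq_abs, abs_of_nonneg (rho_nonneg _), rho_int, ENNReal.ofReal_one]
  have key := mink_aux (μ := (volume : Measure (Pt n))) (κ := rho n) hρ.measurable
    (f := fun x p => ψ (p - σ • x) - ψ p) (by
      have : Continuous fun z : Pt n × Pt n => ψ (z.2 - σ • z.1) - ψ z.2 := by fun_prop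
      exact this.measurable) (r := 1) le_rfl
    (ε := ENNReal.ofReal (2 * σ) * eLpNorm (fderiv ℝ ψ) 1 volume) (by
      intro x hx
      rw [ENNReal.ofReal_one]
      refine (trans_L1 hψ _).trans ?_
      gcongr
      rw [norm_smul, Real.norm_eq_abs, abs_of_pos hσ]
      nlinarith [rho_supp hx])
  rw [h1, one_mul, ENNReal.ofReal_one] at key
  rw [e]; exact key

lemma grad_L2 (hn : 1 ≤ n) {η : Pt n → ℝ} (hη : TestFun n η) (hax : ∀ p ∈ tsupport η, 0 < zsq n p) (Bd : ℝ) :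
    ∃ C : ℝ≥0∞, C ≠ ∞ ∧ ∀ φ, TestFun n φ → RotInv n φ → nr (ENNReal.ofReal (Qs n)) φ ≤ Bd →
      (∀ i, nr 2 (Zd n i φ) ≤ Bd) → eLpNorm (fderiv ℝ (fun p => η p * φ p)) 2 volume ≤ C := by
  obtain ⟨C, hC, h⟩ := grad_cut hη hax
  have hT : volume (tsupport η) ≠ ∞ := hη.2.isCompact.measure_lt_top.ne
  have hTm : MeasurableSet (tsupport η) := (isClosed_tsupport η).measurableSet
  have hq := Qs_gt hn
  refine ⟨ENNReal.ofReal C * (ENNReal.ofReal Bd * volume (tsupport η) ^ (1 / (2:ℝ) - 1 / Qs n) +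
    ∑ _i : Ix n, ENNReal.ofReal Bd), ?_, fun φ hφ hr h1 h2 => ?_⟩
  · refine ENNReal.mul_ne_top ENNReal.ofReal_ne_top (ENNReal.add_ne_top.2 ⟨ENNReal.mul_ne_top ENNReal.ofReal_ne_top ?_, ?_⟩)
    · refine ENNReal.rpow_ne_top_of_nonneg ?_ hT
      have : 1 / Qs n ≤ 1 / 2 := by gcongr
      linarith
    · simp [ENNReal.mul_eq_top]
  have hφc := hφ.1.continuous
  have hZc := fun i => (hφ.tZd i).1.continuous
  calc eLpNorm (fderiv ℝ (fun p => η p * φ p)) 2 volume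
      ≤ eLpNorm ((tsupport η).indicator (fun p => C * (|φ p| + ∑ i, |Zd n i φ p|))) 2 volume := by
        refine eLpNorm_mono_real fun p => h φ hφ hr p
    _ = eLpNorm (C • ((fun p => |φ p|) + ∑ i, fun p => |Zd n i φ p|)) 2 (volume.restrict (tsupport η)) := by
        rw [eLpNorm_indicator_eq_eLpNorm_restrict hTm]
        congr 1; ext p; simp
    _ = ENNReal.ofReal C * eLpNorm ((fun p => |φ p|) + ∑ i, fun p => |Zd n i φ p|) 2 (volume.restrict (tsupport η)) := by
        rw [eLpNorm_const_smul, Real.enorm_eq_ofReal hC]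
    _ ≤ _ := by
        gcongr
        refine (eLpNorm_add_le hφc.abs.aestronglyMeasurable
          (Finset.aestronglyMeasurable_sum _ fun i _ => (hZc i).abs.aestronglyMeasurable) (by norm_num)).trans ?_
        gcongr
        · refine (eLpNorm_le_eLpNorm_mul_rpow_measure_univ (q := ENNReal.ofReal (Qs n)) ?_
            hφc.abs.aestronglyMeasurable).trans ?_
          · rw [show (2:ℝ≥0∞) = ENNReal.ofReal 2 by simp]
            exact ENNReal.ofReal_le_ofReal hq.le
          · rw [Measure.restrict_apply_univ, ENNReal.toReal_ofReal (by linarith)]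
            simp only [ENNReal.toReal_ofNat]
            gcongr
            refine (eLpNorm_mono_measure _ Measure.restrict_le_self).trans ?_
            have : eLpNorm (fun p => |φ p|) (ENNReal.ofReal (Qs n)) volume = eLpNorm φ (ENNReal.ofReal (Qs n)) volume :=
              eLpNorm_congr_norm_ae (.of_forall fun p => by simp)
            rw [this, ← ofReal_nr (hφ.memLp _)]
            exact ENNReal.ofReal_le_ofReal h1
        · refine (eLpNorm_sum_le (fun i _ => (hZc i).abs.aestronglyMeasurable) (by norm_num)).trans ?_
          refine Finset.sum_le_sum fun i _ => ?_
          refine (eLpNorm_mono_measure _ Measure.restrict_le_self).trans ?_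
          have : eLpNorm (fun p => |Zd n i φ p|) 2 volume = eLpNorm (Zd n i φ) 2 volume :=
            eLpNorm_congr_norm_ae (.of_forall fun p => by simp)
          rw [this, ← ofReal_nr ((hφ.tZd i).memLp _)]
          exact ENNReal.ofReal_le_ofReal (h2 i)

lemma qc_test (hn : 1 ≤ n) {η : Pt n → ℝ} (hη : TestFun n η) (hax : ∀ p ∈ tsupport η, 0 < zsq n p) (Bd : ℝ)
    {ε : ℝ} (hε : 0 < ε) :
    ∃ σ > 0, ∃ C : ℝ, 0 ≤ C ∧ ∀ φ, TestFun n φ → RotInv n φ → nr (ENNReal.ofReal (Qs n)) φ ≤ Bd →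
      (∀ i, nr 2 (Zd n i φ) ≤ Bd) →
      ∫ p, |η p * φ p| ^ Qs n ≤ ε + C * nr 1 (moll volume (rho n) σ (fun p => η p * φ p)) := by
  obtain ⟨C2, hC2, hg⟩ := grad_L2 hn hη hax Bd
  have hn0 : (1:ℝ) ≤ n := by exact_mod_cast hn
  have hq2 := Qs_gt hn
  set q : ℝ := 2 * (2 * n + 1) / (2 * n - 1) with hqdef
  have hq : Qs n < q := by
    rw [Qs_eq hn, hqdef, lt_div_iff₀ (by linarith)]
    have : 2 / (n:ℝ) * n = 2 := by field_simp
    have h3 : 0 < 2 / (n:ℝ) := by positivity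
    nlinarith
  have hq0 : 0 < q := by linarith
  have hfr : Module.finrank ℝ (Pt n) = 2 * n + 1 := by
    simp; ring
  set c0 := SNormLESNormFDerivOfEqConst ℝ (volume : Measure (Pt n)) ((2 : NNReal) : ℝ) with hc0
  have hT : volume (tsupport η) ≠ ∞ := hη.2.isCompact.measure_lt_top.ne
  -- bounds
  set A : ℝ := ((c0 : ℝ≥0∞) * C2).toReal
  have hA : ∀ φ, TestFun n φ → RotInv n φ → nr (ENNReal.ofReal (Qs n)) φ ≤ Bd →
      (∀ i, nr 2 (Zd n i φ) ≤ Bd) → ∫ p, |η p * φ p| ^ q ≤ A ^ q := by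
    intro φ hφ hr h1 h2
    have hψ : TestFun n (fun p => η p * φ p) := hφ.mul hη.1
    have h3 := eLpNorm_le_eLpNorm_fderiv_of_eq (μ := (volume : Measure (Pt n))) (p := 2) (p' := q.toNNReal)
      (hψ.1.of_le (by exact_mod_cast le_top)) hψ.2 (by norm_num) (by rw [hfr]; omega) (by
        rw [Real.coe_toNNReal _ hq0.le, hfr, hqdef]
        push_cast
        have : (2 * (n:ℝ) - 1) ≠ 0 := by linarith
        field_simp; ring)
    rw [← nr_rpow hq0 (hψ.memLp _)]
    refine Real.rpow_le_rpow (nr_nonneg _ _) ?_ hq0.le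
    refine ENNReal.toReal_mono (ENNReal.mul_ne_top ENNReal.coe_ne_top hC2) (h3.trans ?_)
    exact mul_le_mul' le_rfl (hg φ hφ hr h1 h2)
  set B : ℝ := (C2 * volume (tsupport η) ^ (1 / (2:ℝ))).toReal
  have hBfin : C2 * volume (tsupport η) ^ (1 / (2:ℝ)) ≠ ∞ :=
    ENNReal.mul_ne_top hC2 (ENNReal.rpow_ne_top_of_nonneg (by norm_num) hT)
  have hB : ∀ φ, TestFun n φ → RotInv n φ → nr (ENNReal.ofReal (Qs n)) φ ≤ Bd →
      (∀ i, nr 2 (Zd n i φ) ≤ Bd) → ∀ σ > 0,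
      nr 1 (fun p => moll volume (rho n) σ (fun p => η p * φ p) p - η p * φ p) ≤ 2 * σ * B := by
    intro φ hφ hr h1 h2 σ hσ
    have hψ : TestFun n (fun p => η p * φ p) := hφ.mul hη.1
    have h3 : eLpNorm (fderiv ℝ (fun p => η p * φ p)) 1 volume ≤ C2 * volume (tsupport η) ^ (1 / (2:ℝ)) := by
      have hs : Function.support (fun x => ‖fderiv ℝ (fun p => η p * φ p) x‖) ⊆ tsupport η := by
        refine subset_trans (fun x hx => ?_) ((support_fderiv_subset ℝ (f := fun p => η p * φ p)).trans (tsupport_mul_subset_left))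
        intro h0
        exact hx (by show ‖fderiv ℝ (fun p => η p * φ p) x‖ = 0; rw [h0, norm_zero])
      rw [← eLpNorm_norm, ← eLpNorm_restrict_eq_of_support_subset hs, eLpNorm_norm]
      refine (eLpNorm_le_eLpNorm_mul_rpow_measure_univ (q := 2) (by norm_num)
        (hψ.1.continuous_fderiv (by simp)).aestronglyMeasurable).trans ?_
      rw [Measure.restrict_apply_univ]
      have : (1 / (1:ℝ≥0∞).toReal - 1 / (2:ℝ≥0∞).toReal) = 1 / (2:ℝ) := by norm_num
      rw [this]
      gcongr
      exact (eLpNorm_mono_measure _ Measure.restrict_le_self).trans (hg φ hφ hr h1 h2)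
    have h4 := (moll_L1 hψ hσ).trans (mul_le_mul_right h3 _)
    refine nr_le (by positivity) (h4.trans ?_)
    rw [ENNReal.ofReal_mul (q := B) (by positivity), show ENNReal.ofReal B = _ from ENNReal.ofReal_toReal hBfin]
  have hB0 : 0 ≤ B := ENNReal.toReal_nonneg
  have hA0 : 0 ≤ A := ENNReal.toReal_nonneg
  obtain ⟨C, hC, hint⟩ := interp_aux (by linarith : 1 < Qs n) hq (show 0 < ε / (2 * (A ^ q + 1)) by positivity)
  refine ⟨ε / (4 * (C * B + 1)), by positivity, C, hC, fun φ hφ hr h1 h2 => ?_⟩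
  set σ := ε / (4 * (C * B + 1)) with hσ
  have hσ0 : 0 < σ := by positivity
  have hψ : TestFun n (fun p => η p * φ p) := hφ.mul hη.1
  have hi1 : Integrable (fun p => |η p * φ p|) volume :=
    (hψ.1.continuous.integrable_of_hasCompactSupport hψ.2).abs
  have e1 : ∫ p, |η p * φ p| = nr 1 (fun p => η p * φ p) := by
    have := nr_rpow (n := n) (q := 1) (by norm_num) (hψ.memLp _)
    simpa using this.symm
  have hm := moll_test rho_test hσ0 hψ.1.continuous.locallyIntegrable hψ.2
  have h5 := nr_tri (le_refl 1) (hm.memLp 1) (hψ.memLp 1)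
  have h6 := hB φ hφ hr h1 h2 σ hσ0
  have h7 : nr 1 (fun p => η p * φ p) ≤ nr 1 (moll volume (rho n) σ (fun p => η p * φ p)) + 2 * σ * B := by
    have := (abs_le.1 h5).1
    linarith
  calc ∫ p, |η p * φ p| ^ Qs n
      ≤ ∫ p, (ε / (2 * (A ^ q + 1)) * |η p * φ p| ^ q + C * |η p * φ p|) := by
        refine integral_mono (int_rpow (by linarith) (hψ.memLp _))
          (((int_rpow hq0 (hψ.memLp _)).const_mul _).add (hi1.const_mul _)) fun p => hint _ (abs_nonneg _)
    _ = ε / (2 * (A ^ q + 1)) * (∫ p, |η p * φ p| ^ q) + C * nr 1 (fun p => η p * φ p) := by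
        rw [integral_add ((int_rpow hq0 (hψ.memLp _)).const_mul _) (hi1.const_mul _), integral_const_mul,
          integral_const_mul, e1]
    _ ≤ ε / (2 * (A ^ q + 1)) * A ^ q + C * (nr 1 (moll volume (rho n) σ (fun p => η p * φ p)) + 2 * σ * B) := by
        gcongr
        exact hA φ hφ hr h1 h2
    _ ≤ _ := by
        have g1 : ε / (2 * (A ^ q + 1)) * A ^ q ≤ ε / 2 := by
          rw [div_mul_eq_mul_div, div_le_iff₀ (by positivity)]
          have : 0 ≤ A ^ q := by positivity
          nlinarith
        have g2 : C * (2 * σ * B) ≤ ε / 2 := by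
          have : σ * (4 * (C * B + 1)) = ε := by rw [hσ]; field_simp
          nlinarith
        nlinarith

end P7
end HeisAux

namespace HeisAux
open ENNReal
section P8
variable {n : ℕ}

/-- conjugate exponent -/
def Pc (n : ℕ) : ℝ≥0∞ := ENNReal.ofReal (Qs n / (Qs n - 1))

lemma hconj (hn : 1 ≤ n) : ENNReal.HolderConjugate (Pc n) (ENNReal.ofReal (Qs n)) := by
  have hq := Qs_gt hn
  constructor
  unfold Pc
  rw [← ENNReal.ofReal_inv_of_pos (div_pos (by linarith) (by linarith)), ← ENNReal.ofReal_inv_of_pos (x := Qs n) (by linarith),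
    ← ENNReal.ofReal_add (inv_nonneg.2 (div_pos (by linarith) (by linarith)).le) (by positivity)]
  rw [inv_one, ← ENNReal.ofReal_one]
  congr 1
  have : Qs n ≠ 0 := by linarith
  field_simp; ring

lemma hol_int (hn : 1 ≤ n) {a b : Pt n → ℝ} (ha : MemLp a (Pc n) volume)
    (hb : MemLp b (ENNReal.ofReal (Qs n)) volume) : Integrable (fun p => a p * b p) volume := by
  have := hconj hn
  exact ha.integrable_mul hb

lemma hol_nr (hn : 1 ≤ n) {a b : Pt n → ℝ} (ha : MemLp a (Pc n) volume)
    (hb : MemLp b (ENNReal.ofReal (Qs n)) volume) :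
    nr 1 (fun p => a p * b p) ≤ nr (Pc n) a * nr (ENNReal.ofReal (Qs n)) b := by
  have := hconj hn
  refine nr_le (mul_nonneg (nr_nonneg _ _) (nr_nonneg _ _)) ?_
  rw [ENNReal.ofReal_mul (nr_nonneg _ _), ofReal_nr ha, ofReal_nr hb]
  have h := eLpNorm_smul_le_mul_eLpNorm (p := Pc n) (q := ENNReal.ofReal (Qs n)) (r := 1) (μ := volume) hb.1 ha.1
  have e : a • b = fun p => a p * b p := rfl
  rwa [e] at h

lemma int_le_nr {f : Pt n → ℝ} (hf : Integrable f volume) : |∫ p, f p| ≤ nr 1 f := by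
  have h1 := norm_integral_le_integral_norm (μ := volume) f
  have h2 : ∫ p, ‖f p‖ = nr 1 f := by
    unfold nr
    rw [eLpNorm_one_eq_lintegral_enorm, ← ofReal_integral_norm_eq_lintegral_enorm hf,
      ENNReal.toReal_ofReal (integral_nonneg fun _ => norm_nonneg _)]
  rw [h2] at h1; exact h1

lemma hol_abs (hn : 1 ≤ n) {a b : Pt n → ℝ} (ha : MemLp a (Pc n) volume)
    (hb : MemLp b (ENNReal.ofReal (Qs n)) volume) :
    |∫ p, a p * b p| ≤ nr (Pc n) a * nr (ENNReal.ofReal (Qs n)) b :=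
  (int_le_nr (hol_int hn ha hb)).trans (hol_nr hn ha hb)

lemma young1 {v : Pt n → ℝ} (hv : MemLp v 1 volume) {σ : ℝ} (hσ : 0 < σ) :
    nr 1 (moll volume (rho n) σ v) ≤ nr 1 v := by
  obtain ⟨w, hw, hvw⟩ := hv.1
  have hwm : MemLp w 1 volume := hv.ae_eq hvw
  have e : moll volume (rho n) σ v = moll volume (rho n) σ w := funext fun p => moll_congr hσ hvw p
  have e2 : nr 1 v = nr 1 w := by unfold nr; rw [eLpNorm_congr_ae hvw]
  rw [e, e2]
  have hρ := (rho_test (n := n)).1.continuous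
  have h1 : (∫⁻ x, ‖rho n x‖ₑ) = 1 := by
    have := ofReal_integral_norm_eq_lintegral_enorm (hρ.integrable_of_hasCompactSupport (μ := volume) rho_test.2)
    rw [← this]
    simp only [Real.norm_eq_abs, abs_of_nonneg (rho_nonneg _), rho_int, ENNReal.ofReal_one]
  have key := mink_aux (μ := (volume : Measure (Pt n))) (κ := rho n) hρ.measurable
    (f := fun x p => w (p - σ • x)) (by
      have : Measurable fun z : Pt n × Pt n => z.2 - σ • z.1 := by fun_prop
      exact hw.measurable.comp this) (r := 1) le_rfl
    (ε := eLpNorm w 1 volume) (by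
      intro x hx
      rw [ENNReal.ofReal_one]
      exact (eLpNorm_comp_measurePreserving (g := w) hw.aestronglyMeasurable
        (measurePreserving_sub_right volume (σ • x))).le)
  rw [h1, one_mul, ENNReal.ofReal_one] at key
  exact ENNReal.toReal_mono hwm.2.ne key

lemma moll_sub {v w : Pt n → ℝ} (hv : LocallyIntegrable v volume) (hw : LocallyIntegrable w volume) {σ : ℝ} (hσ : 0 < σ)
    (p : Pt n) : moll volume (rho n) σ (fun q => v q - w q) p =
      moll volume (rho n) σ v p - moll volume (rho n) σ w p := by
  unfold moll
  simp only [mul_sub]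
  exact integral_sub (moll_integrable rho_test.1.continuous rho_test.2 hσ hv p)
    (moll_integrable rho_test.1.continuous rho_test.2 hσ hw p)

lemma eta_mul {η : Pt n → ℝ} (hη : TestFun n η) {w : Pt n → ℝ}
    (hw : MemLp w (ENNReal.ofReal (Qs n)) volume) : MemLp (fun p => η p * w p) (ENNReal.ofReal (Qs n)) volume := by
  have := hw.mul (r := ENNReal.ofReal (Qs n)) (hη.memLp ∞)
  exact this

lemma moll_mem {v : Pt n → ℝ} (hv : Integrable v volume) (hs : HasCompactSupport v) {σ : ℝ} (hσ : 0 < σ) (r : ℝ≥0∞) :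
    MemLp (moll volume (rho n) σ v) r volume :=
  (moll_test rho_test hσ hv.locallyIntegrable hs).memLp _

theorem qc (hn : 1 ≤ n) {η : Pt n → ℝ} (hη : TestFun n η) (hax : ∀ p ∈ tsupport η, 0 < zsq n p) (Bd : ℝ)
    {ε : ℝ} (hε : 0 < ε) :
    ∃ σ > 0, ∃ C : ℝ, 0 ≤ C ∧ ∀ w g, HD n w g → RotInv n w → nr (ENNReal.ofReal (Qs n)) w ≤ Bd →
      (∀ i, nr 2 (g i) ≤ Bd) →
      ∫ p, |η p * w p| ^ Qs n ≤ ε + C * nr 1 (moll volume (rho n) σ (fun p => η p * w p)) := by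
  have hq := Qs_gt hn
  have hq0 : 0 < Qs n := by linarith
  obtain ⟨σ, hσ, C, hC, hmain⟩ := qc_test hn hη hax (Bd + 1) hε
  refine ⟨σ, hσ, C, hC, fun w g hw hr h1 h2 => ?_⟩
  obtain ⟨φ, f1, f2, f3, f4⟩ := dens_seq hn hw hr
  have t1 := nr_tendsto (one_le_Qs hn) (fun k => (f1 k).memLp _) hw.1 f3
  have t2 := fun i => nr_tendsto (by norm_num) (fun k => ((f1 k).tZd i).memLp 2) (hw.2.1 i) (f4 i)
  have e1 : ∀ᶠ k in atTop, nr (ENNReal.ofReal (Qs n)) (φ k) ≤ Bd + 1 :=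
    (t1.eventually_lt_const (show _ < Bd + 1 by linarith)).mono fun _ h => h.le
  have e2 : ∀ᶠ k in atTop, ∀ i, nr 2 (Zd n i (φ k)) ≤ Bd + 1 :=
    eventually_all.2 fun i => ((t2 i).eventually_lt_const (show _ < Bd + 1 by linarith [h2 i])).mono fun _ h => h.le
  obtain ⟨Cη, hCη⟩ : ∃ C, ∀ x, ‖η x‖ ≤ C := hη.1.continuous.bounded_above_of_compact_support hη.2
  have hCη0 : 0 ≤ Cη := (norm_nonneg _).trans (hCη 0)
  have hd : ∀ k, MemLp (fun p => φ k p - w p) (ENNReal.ofReal (Qs n)) volume := fun k => ((f1 k).memLp _).sub hw.1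
  -- L^p convergence of η φ
  have a1 : Tendsto (fun k => nr (ENNReal.ofReal (Qs n)) (fun p => η p * φ k p - η p * w p)) atTop (𝓝 0) := by
    refine squeeze_zero (fun _ => nr_nonneg _ _) (fun k => ?_) (by simpa using f3.const_mul Cη)
    refine nr_le (mul_nonneg hCη0 (nr_nonneg _ _)) ?_
    rw [ENNReal.ofReal_mul hCη0, ofReal_nr (hd k)]
    refine eLpNorm_le_mul_eLpNorm_of_ae_le_mul (.of_forall fun p => ?_) _
    rw [← mul_sub, norm_mul]
    exact mul_le_mul_of_nonneg_right (hCη p) (norm_nonneg _)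
  have a2 := nr_tendsto (one_le_Qs hn) (fun k => eta_mul hη ((f1 k).memLp _)) (eta_mul hη hw.1) a1
  have a3 := (a2.rpow_const (p := Qs n) (Or.inr hq0.le))
  have iw : Integrable (fun p => η p * w p) volume := hol_int hn (hη.memLp _) hw.1
  have ik : ∀ k, Integrable (fun p => η p * φ k p) volume := fun k => hol_int hn (hη.memLp _) ((f1 k).memLp _)
  have sw : HasCompactSupport (fun p => η p * w p) := hη.2.mul_right
  have sk : ∀ k, HasCompactSupport (fun p => η p * φ k p) := fun k => hη.2.mul_right
  have b1 : Tendsto (fun k => nr 1 (fun p => moll volume (rho n) σ (fun p => η p * φ k p) p -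
      moll volume (rho n) σ (fun p => η p * w p) p)) atTop (𝓝 0) := by
    refine squeeze_zero (fun _ => nr_nonneg _ _) (fun k => ?_)
      (by simpa using f3.const_mul (nr (Pc n) η))
    have : (fun p => moll volume (rho n) σ (fun p => η p * φ k p) p -
      moll volume (rho n) σ (fun p => η p * w p) p) = moll volume (rho n) σ (fun p => η p * (φ k p - w p)) := by
      ext p
      rw [← moll_sub (ik k).locallyIntegrable iw.locallyIntegrable hσ]
      simp only [mul_sub]
    rw [this]
    have i1 := hol_int hn (hη.memLp _) (hd k)
    exact (young1 (memLp_one_iff_integrable.2 i1) hσ).trans (hol_nr hn (hη.memLp _) (hd k))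
  have b2 := nr_tendsto le_rfl (fun k => moll_mem (ik k) (sk k) hσ 1) (moll_mem iw sw hσ 1) b1
  rw [← nr_rpow hq0 (eta_mul hη hw.1)]
  refine le_of_tendsto_of_tendsto a3 ((b2.const_mul C).const_add ε) ?_
  filter_upwards [e1, e2] with k g1 g2
  rw [nr_rpow hq0 (eta_mul hη ((f1 k).memLp _))]
  exact hmain (φ k) (f1 k) (f2 k) g1 g2

lemma exists_eta {C : Set (Pt n)} (hC : IsCompact C) (hax : ∀ p ∈ C, 0 < zsq n p) :
    ∃ η : Pt n → ℝ, TestFun n η ∧ (∀ p ∈ tsupport η, 0 < zsq n p) ∧ (∀ p ∈ C, η p = 1) ∧ ∀ p, 0 ≤ η p := by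
  have hU : IsOpen {p : Pt n | 0 < zsq n p} := isOpen_lt continuous_const zsq_cont
  obtain ⟨L, hL, h1, h2⟩ := exists_compact_between hC hU hax
  obtain ⟨f, f1, f2, f3, f4⟩ := exists_contMDiff_support_eq_eq_one_iff (n := (⊤ : ℕ∞)) (modelWithCornersSelf ℝ (Pt n)) isOpen_interior hC.isClosed h1
  have ht : tsupport f ⊆ L := by
    unfold tsupport; rw [f3]
    exact closure_minimal interior_subset hL.isClosed
  refine ⟨f, ⟨f1.contDiff, hL.of_isClosed_subset (isClosed_tsupport f) ht⟩, fun p hp => h2 (ht hp), fun p hp => (f4 p).1 hp,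
    fun p => (f2 ⟨p, rfl⟩).1⟩

end P8
end HeisAux

namespace HeisAux
open ENNReal
section P9
variable {n : ℕ}

lemma pair_eq {p q : ℝ≥0∞} [Fact (1 ≤ p)] [Fact (1 ≤ q)] [ENNReal.HolderConjugate p q] {f g : Pt n → ℝ} (hf : MemLp f p volume)
    (hg : MemLp g q volume) :
    (ContinuousLinearMap.mul ℝ ℝ).lpPairing volume p q (hf.toLp f) (hg.toLp g) = ∫ x, g x * f x := by
  rw [ContinuousLinearMap.lpPairing_eq_integral]
  refine integral_congr_ae ?_
  filter_upwards [hf.coeFn_toLp, hg.coeFn_toLp] with x h1 h2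
  rw [h1, h2]; simp [mul_comm]

lemma wk_extract (hn : 1 ≤ n) {u : ℕ → Pt n → ℝ} {g : ℕ → Ix n → Pt n → ℝ} {Bd : ℝ}
    (hu : ∀ k, MemLp (u k) (ENNReal.ofReal (Qs n)) volume) (hub : ∀ k, nr (ENNReal.ofReal (Qs n)) (u k) ≤ Bd)
    (hg : ∀ k i, MemLp (g k i) 2 volume) (hgb : ∀ k i, nr 2 (g k i) ≤ Bd) :
    ∃ φ : ℕ → ℕ, StrictMono φ ∧
      (∀ f, MemLp f (Pc n) volume → ∃ l, Tendsto (fun k => ∫ p, f p * u (φ k) p) atTop (𝓝 l)) ∧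
      ∃ G : Ix n → Pt n → ℝ, (∀ i, MemLp (G i) 2 volume) ∧
        ∀ i f, MemLp f 2 volume → Tendsto (fun k => ∫ p, f p * g (φ k) i p) atTop (𝓝 (∫ p, f p * G i p)) := by
  have hc := hconj hn
  have hc' : ENNReal.HolderConjugate (ENNReal.ofReal (Qs n)) (Pc n) := hc.symm
  have hq := Qs_gt hn
  have : Fact (1 ≤ ENNReal.ofReal (Qs n)) := ⟨one_le_Qs hn⟩
  have : Fact (1 ≤ Pc n) := ⟨by
    unfold Pc; rw [ENNReal.one_le_ofReal, one_le_div (by linarith)]; linarith⟩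
  have : Fact (Pc n ≠ ∞) := ⟨ENNReal.ofReal_ne_top⟩
  have : Fact ((2:ℝ≥0∞) ≠ ∞) := ⟨by norm_num⟩
  let E := Lp ℝ (Pc n) (volume : Measure (Pt n)) × (Ix n → Lp ℝ 2 (volume : Measure (Pt n)))
  have : MeasurableSpace.CountablyGenerated (Pt n) := inferInstance
  have : SFinite (volume : Measure (Pt n)) := inferInstance
  have sA : SecondCountableTopology (Lp ℝ (Pc n) (volume : Measure (Pt n))) := Lp.SecondCountableTopology
  have sB : SecondCountableTopology (Lp ℝ 2 (volume : Measure (Pt n))) := Lp.SecondCountableTopology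
  have sE : SecondCountableTopology E := inferInstanceAs (SecondCountableTopology (_ × _))
  have sE' : TopologicalSpace.SeparableSpace E := inferInstance
  let A := (ContinuousLinearMap.mul ℝ ℝ).lpPairing (volume : Measure (Pt n)) (ENNReal.ofReal (Qs n)) (Pc n)
  let B := (ContinuousLinearMap.mul ℝ ℝ).lpPairing (volume : Measure (Pt n)) 2 2
  let pr : Ix n → E →L[ℝ] Lp ℝ 2 (volume : Measure (Pt n)) := fun i =>
    (ContinuousLinearMap.proj i).comp (ContinuousLinearMap.snd ℝ _ _)
  let Φ : ℕ → E →L[ℝ] ℝ := fun k => (A ((hu k).toLp (u k))).comp (ContinuousLinearMap.fst ℝ _ _) +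
    ∑ i, (B ((hg k i).toLp (g k i))).comp (pr i)
  have nA : ∀ k, ‖(hu k).toLp (u k)‖ ≤ Bd := fun k => by rw [Lp.norm_toLp]; exact hub k
  have nB : ∀ k i, ‖(hg k i).toLp (g k i)‖ ≤ Bd := fun k i => by rw [Lp.norm_toLp]; exact hgb k i
  have hΦ : ∀ k, ‖Φ k‖ ≤ ‖A‖ * Bd * ‖ContinuousLinearMap.fst ℝ (Lp ℝ (Pc n) (volume : Measure (Pt n))) (Ix n → Lp ℝ 2 (volume : Measure (Pt n)))‖ + ∑ i, ‖B‖ * Bd * ‖pr i‖ := by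
    intro k
    refine (norm_add_le _ _).trans (add_le_add ?_ ((norm_sum_le _ _).trans (Finset.sum_le_sum fun i _ => ?_)))
    · refine (ContinuousLinearMap.opNorm_comp_le _ _).trans (mul_le_mul_of_nonneg_right ?_ (norm_nonneg _))
      exact (A.le_opNorm _).trans (mul_le_mul_of_nonneg_left (nA k) (norm_nonneg _))
    · refine (ContinuousLinearMap.opNorm_comp_le _ _).trans (mul_le_mul_of_nonneg_right ?_ (norm_nonneg _))
      exact (B.le_opNorm _).trans (mul_le_mul_of_nonneg_left (nB k i) (norm_nonneg _))
  set R := ‖A‖ * Bd * ‖ContinuousLinearMap.fst ℝ (Lp ℝ (Pc n) (volume : Measure (Pt n))) (Ix n → Lp ℝ 2 (volume : Measure (Pt n)))‖ + ∑ i, ‖B‖ * Bd * ‖pr i‖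
  obtain ⟨L, -, φ, hφ, hL⟩ := WeakDual.isSeqCompact_closedBall (𝕜 := ℝ) (E := E) (0 : StrongDual ℝ E) R
    (x := fun k => WeakDual.toStrongDual.symm (Φ k)) (fun k => by
      simpa using hΦ k)
  have hev : ∀ e : E, Tendsto (fun k => Φ (φ k) e) atTop (𝓝 (L e)) := fun e =>
    ((WeakDual.eval_continuous e).tendsto L).comp hL
  have hΦe : ∀ k (e : E), Φ k e = A ((hu k).toLp (u k)) e.1 + ∑ i, B ((hg k i).toLp (g k i)) (e.2 i) := by
    intro k e
    simp only [Φ]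
    rw [_root_.add_apply, _root_.sum_apply]
    rfl
  refine ⟨φ, hφ, fun f hf => ⟨L (hf.toLp f, 0), ?_⟩, ?_⟩
  · refine (hev (hf.toLp f, 0)).congr fun k => ?_
    rw [hΦe]
    simp only [Pi.zero_apply, map_zero, Finset.sum_const_zero, add_zero]
    exact pair_eq _ _
  · let ι : Ix n → Lp ℝ 2 (volume : Measure (Pt n)) →L[ℝ] E := fun i =>
      (ContinuousLinearMap.inr ℝ _ _).comp (ContinuousLinearMap.single ℝ (fun _ => Lp ℝ 2 (volume : Measure (Pt n))) i)
    let Li : Ix n → StrongDual ℝ (Lp ℝ 2 (volume : Measure (Pt n))) := fun i => (WeakDual.toStrongDual L).comp (ι i)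
    let Gi : Ix n → Lp ℝ 2 (volume : Measure (Pt n)) := fun i => (InnerProductSpace.toDual ℝ _).symm (Li i)
    refine ⟨fun i => Gi i, fun i => Lp.memLp _, fun i f hf => ?_⟩
    have h1 := hev (ι i (hf.toLp f))
    have h2 : L (ι i (hf.toLp f)) = ∫ p, f p * Gi i p := by
      have : L (ι i (hf.toLp f)) = inner ℝ (Gi i) (hf.toLp f) := by
        rw [InnerProductSpace.toDual_symm_apply]; rfl
      rw [this, L2.inner_def]
      refine integral_congr_ae ?_
      filter_upwards [hf.coeFn_toLp] with x h1
      rw [h1]; simp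
    rw [h2] at h1
    refine h1.congr fun k => ?_
    have e0 : ι i (hf.toLp f) = ((0 : Lp ℝ (Pc n) (volume : Measure (Pt n))), Pi.single i (hf.toLp f)) := rfl
    rw [hΦe, e0]
    simp only [map_zero, zero_add]
    rw [Finset.sum_eq_single i]
    · rw [Pi.single_eq_same]; exact pair_eq _ _
    · intro j _ hj
      rw [Pi.single_eq_of_ne hj, map_zero]
    · simp

end P9
end HeisAux

namespace HeisAux
open ENNReal
open scoped Pointwise
section P10
variable {n : ℕ}

/-- weight vanishing on the axis and at infinity -/
def wt (n : ℕ) (p : Pt n) : ℝ := min (zsq n p) 1 / (1 + ‖p‖)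

lemma zsq_nonneg (p : Pt n) : 0 ≤ zsq n p := by unfold zsq; positivity

lemma wt_cont : Continuous (wt n) := by
  unfold wt
  have := zsq_cont (n := n)
  refine Continuous.div (this.min continuous_const) (by fun_prop) fun p => ?_
  positivity

lemma wt_nonneg (p : Pt n) : 0 ≤ wt n p :=
  div_nonneg (le_min (zsq_nonneg p) zero_le_one) (by positivity)

lemma wt_le (p : Pt n) : wt n p ≤ 1 := by
  unfold wt
  rw [div_le_one (by positivity)]
  have := norm_nonneg p
  exact (min_le_right _ _).trans (by linarith)

lemma wt_pos {p : Pt n} : 0 < wt n p ↔ 0 < zsq n p := by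
  unfold wt
  rw [div_pos_iff_of_pos_right (by positivity), lt_min_iff]
  simp

lemma wt_compact {θ : ℝ} (hθ : 0 < θ) : IsCompact {p : Pt n | θ ≤ wt n p} := by
  refine Metric.isCompact_of_isClosed_isBounded (isClosed_le continuous_const wt_cont) ?_
  refine (Metric.isBounded_closedBall (x := (0 : Pt n)) (r := 1 / θ)).subset fun p hp => ?_
  have hp : θ ≤ wt n p := hp
  rw [mem_closedBall_zero_iff, le_div_iff₀ hθ]
  unfold wt at hp
  rw [le_div_iff₀ (by positivity)] at hp
  have := min_le_right (zsq n p) 1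
  nlinarith

lemma axis_null (hn : 1 ≤ n) : ∀ᵐ p : Pt n, 0 < zsq n p := by
  let j : Fin n := ⟨0, hn⟩
  let ℓ : Pt n →ₗ[ℝ] ℝ := (LinearMap.proj j).comp (LinearMap.fst ℝ (Fin n → ℝ) ((Fin n → ℝ) × ℝ))
  have h1 : volume ((LinearMap.ker ℓ : Submodule ℝ (Pt n)) : Set (Pt n)) = 0 := by
    refine Measure.addHaar_submodule _ _ fun h => ?_
    have : ℓ (ex n j) = 0 := by
      have : ex n j ∈ LinearMap.ker ℓ := by rw [h]; trivial
      exact this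
    simp [ℓ, ex] at this
  rw [ae_iff]
  refine measure_mono_null (fun p hp => ?_) h1
  have hp : ¬ 0 < zsq n p := hp
  have h0 : zsq n p = 0 := le_antisymm (not_lt.1 hp) (zsq_nonneg p)
  have h2 : p.1 j ^ 2 ≤ ∑ i, p.1 i ^ 2 := Finset.single_le_sum (fun i _ => sq_nonneg (p.1 i)) (Finset.mem_univ j)
  have h3 : 0 ≤ ∑ i, p.2.1 i ^ 2 := by positivity
  unfold zsq at h0
  have h4 : p.1 j ^ 2 = 0 := le_antisymm (by linarith) (sq_nonneg _)
  exact pow_eq_zero_iff (by norm_num) |>.1 h4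

lemma moll_conv (hn : 1 ≤ n) {u : ℕ → Pt n → ℝ} {Bd : ℝ}
    (hu : ∀ k, MemLp (u k) (ENNReal.ofReal (Qs n)) volume) (hub : ∀ k, nr (ENNReal.ofReal (Qs n)) (u k) ≤ Bd)
    (hw : ∀ f, MemLp f (Pc n) volume → ∃ l, Tendsto (fun k => ∫ p, f p * u k p) atTop (𝓝 l))
    {η : Pt n → ℝ} (hη : TestFun n η) {σ : ℝ} (hσ : 0 < σ) :
    ∃ V : Pt n → ℝ, MemLp V 1 volume ∧
      Tendsto (fun k => nr 1 (fun p => moll volume (rho n) σ (fun p => η p * u k p) p - V p)) atTop (𝓝 0) := by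
  have hk := resc_test (rho_test (n := n)) hσ
  have iu : ∀ k, Integrable (fun p => η p * u k p) volume := fun k => hol_int hn (hη.memLp _) (hu k)
  have su : ∀ k, HasCompactSupport (fun p => η p * u k p) := fun k => hη.2.mul_right
  have hkt : ∀ p, TestFun n (fun q => resc (rho n) σ (p - q) * η q) := fun p =>
    hη.mul (hk.1.comp (contDiff_const.sub contDiff_id))
  have e : ∀ k p, moll volume (rho n) σ (fun p => η p * u k p) p = ∫ q, (resc (rho n) σ (p - q) * η q) * u k q := by
    intro k p
    rw [moll_eq hσ]
    congr 1; ext q; ring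
  choose V hV using fun p => hw _ ((hkt p).memLp _)
  obtain ⟨R, hR⟩ : ∃ C, ∀ x, ‖resc (rho n) σ x‖ ≤ C := hk.1.continuous.bounded_above_of_compact_support hk.2
  have hR0 : 0 ≤ R := (norm_nonneg _).trans (hR 0)
  have hT : IsCompact (tsupport (resc (rho n) σ) + tsupport η) := hk.2.isCompact.add hη.2.isCompact
  set T := tsupport (resc (rho n) σ) + tsupport η with hTd
  set D : ℝ := R * nr (Pc n) η * Bd
  have hbound : ∀ k p, ‖moll volume (rho n) σ (fun p => η p * u k p) p‖ ≤ T.indicator (fun _ => D) p := by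
    intro k p
    by_cases hp : p ∈ T
    · rw [Set.indicator_of_mem hp, e]
      refine (hol_abs hn ((hkt p).memLp _) (hu k)).trans ?_
      have h1 : nr (Pc n) (fun q => resc (rho n) σ (p - q) * η q) ≤ R * nr (Pc n) η := by
        refine nr_le (mul_nonneg hR0 (nr_nonneg _ _)) ?_
        rw [ENNReal.ofReal_mul hR0, ofReal_nr (hη.memLp _)]
        refine eLpNorm_le_mul_eLpNorm_of_ae_le_mul (.of_forall fun q => ?_) _
        rw [norm_mul]
        exact mul_le_mul_of_nonneg_right (hR _) (norm_nonneg _)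
      exact mul_le_mul h1 (hub k) (nr_nonneg _ _) (mul_nonneg hR0 (nr_nonneg _ _))
    · rw [Set.indicator_of_notMem hp, e]
      have : ∀ q, (resc (rho n) σ (p - q) * η q) * u k q = 0 := by
        intro q
        by_contra h0
        have h1 : resc (rho n) σ (p - q) ≠ 0 := fun h => h0 (by simp [h])
        have h2 : η q ≠ 0 := fun h => h0 (by simp [h])
        refine hp ⟨p - q, subset_tsupport _ h1, q, subset_tsupport _ h2, ?_⟩
        simp
      simp [this]
  have hlim : ∀ p, Tendsto (fun k => moll volume (rho n) σ (fun p => η p * u k p) p) atTop (𝓝 (V p)) := by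
    intro p
    simp only [e]
    exact hV p
  have hm : ∀ k, AEStronglyMeasurable (moll volume (rho n) σ (fun p => η p * u k p)) volume :=
    fun k => (moll_mem (iu k) (su k) hσ 1).1
  have hDi : Integrable (T.indicator fun _ : Pt n => D) volume := by
    rw [integrable_indicator_iff hT.isClosed.measurableSet]
    exact integrableOn_const hT.measure_lt_top.ne
  have hVm : AEStronglyMeasurable V volume := aestronglyMeasurable_of_tendsto_ae atTop hm (.of_forall hlim)
  refine ⟨V, ?_, ?_⟩
  · rw [memLp_one_iff_integrable]
    exact hDi.mono' hVm (.of_forall fun p => le_of_tendsto (hlim p).norm (.of_forall fun k => hbound k p))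
  · have h1 := tendsto_lintegral_norm_of_dominated_convergence hm hDi.2 (fun k => .of_forall fun p => hbound k p)
      (.of_forall hlim)
    have h2 := (ENNReal.tendsto_toReal ENNReal.zero_ne_top).comp h1
    refine h2.congr fun k => ?_
    simp only [Function.comp, nr, eLpNorm_one_eq_lintegral_enorm, ofReal_norm]

lemma wt_cauchy (hn : 1 ≤ n) {u : ℕ → Pt n → ℝ} {g : ℕ → Ix n → Pt n → ℝ} {Bd : ℝ}
    (hu : ∀ k, HD n (u k) (g k)) (hr : ∀ k, RotInv n (u k)) (hub : ∀ k, nr (ENNReal.ofReal (Qs n)) (u k) ≤ Bd)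
    (hgb : ∀ k i, nr 2 (g k i) ≤ Bd)
    (hw : ∀ f, MemLp f (Pc n) volume → ∃ l, Tendsto (fun k => ∫ p, f p * u k p) atTop (𝓝 l))
    {ε : ℝ} (hε : 0 < ε) :
    ∃ N, ∀ k ≥ N, ∀ l ≥ N, ∫ p, wt n p * |u k p - u l p| ^ Qs n ≤ ε := by
  have hq := Qs_gt hn
  have hq0 : 0 < Qs n := by linarith
  have hB0 : 0 ≤ Bd := (nr_nonneg _ _).trans (hub 0)
  have hd := fun k l => HD.sub hn (hu k) (hu l)
  have hdr : ∀ k l, RotInv n (fun p => u k p - u l p) := fun k l θ p => by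
    show u k _ - u l _ = _
    rw [hr k, hr l]
  have hsub : ∀ {r : ℝ≥0∞} (_ : 1 ≤ r) {a b : Pt n → ℝ}, MemLp a r volume → MemLp b r volume → nr r a ≤ Bd → nr r b ≤ Bd →
      nr r (fun p => a p - b p) ≤ 2 * Bd := by
    intro r hr1 a b ha hb h1 h2
    have h3 := nr_add_le hr1 (ha.sub hb) hb
    have h4 : nr r (fun p => a p - b p) ≤ nr r a + nr r b := by
      refine nr_le (add_nonneg (nr_nonneg _ _) (nr_nonneg _ _)) ?_
      rw [ENNReal.ofReal_add (nr_nonneg _ _) (nr_nonneg _ _), ofReal_nr ha, ofReal_nr hb]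
      exact eLpNorm_sub_le ha.1 hb.1 hr1
    linarith
  have hdb : ∀ k l, nr (ENNReal.ofReal (Qs n)) (fun p => u k p - u l p) ≤ 2 * Bd := fun k l =>
    hsub (one_le_Qs hn) (hu k).1 (hu l).1 (hub k) (hub l)
  have hgb2 : ∀ k l i, nr 2 (fun p => g k i p - g l i p) ≤ 2 * Bd := fun k l i =>
    hsub (by norm_num) ((hu k).2.1 i) ((hu l).2.1 i) (hgb k i) (hgb l i)
  set D : ℝ := (2 * Bd) ^ Qs n + 1 with hD
  have hD0 : 0 < D := by positivity
  set θ : ℝ := ε / (2 * D) with hθ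
  have hθ0 : 0 < θ := by positivity
  obtain ⟨η, hη, hηax, hη1, hη0⟩ := exists_eta (wt_compact hθ0) (fun p hp => wt_pos.1 (lt_of_lt_of_le hθ0 hp))
  obtain ⟨σ, hσ, C, hC, hmain⟩ := qc hn hη hηax (2 * Bd) (show 0 < ε / 4 by positivity)
  obtain ⟨V, hVm, hV⟩ := moll_conv hn (fun k => (hu k).1) hub hw hη hσ
  obtain ⟨N, hN⟩ := eventually_atTop.1 (hV.eventually_lt_const (show 0 < ε / (8 * (C + 1)) by positivity))
  refine ⟨N, fun k hk l hl => ?_⟩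
  have iu : ∀ k, Integrable (fun p => η p * u k p) volume := fun k => hol_int hn (hη.memLp _) (hu k).1
  have su : ∀ k, HasCompactSupport (fun p => η p * u k p) := fun k => hη.2.mul_right
  have mu : ∀ k, MemLp (moll volume (rho n) σ (fun p => η p * u k p)) 1 volume := fun k => moll_mem (iu k) (su k) hσ 1
  have h1 := hmain _ _ (hd k l) (hdr k l) (hdb k l) (hgb2 k l)
  have h2 : nr 1 (moll volume (rho n) σ (fun p => η p * (u k p - u l p))) ≤ ε / (8 * (C + 1)) + ε / (8 * (C + 1)) := by
    have e : moll volume (rho n) σ (fun p => η p * (u k p - u l p)) = fun p =>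
        (moll volume (rho n) σ (fun p => η p * u k p) p - V p) + (V p - moll volume (rho n) σ (fun p => η p * u l p) p) := by
      ext p
      simp only [mul_sub]
      rw [moll_sub (iu k).locallyIntegrable (iu l).locallyIntegrable hσ]
      ring
    rw [e]
    refine (nr_add_le le_rfl ((mu k).sub hVm) (hVm.sub (mu l))).trans ?_
    have h3 := hN k hk
    have h4 := hN l hl
    have h5 := nr_sub_comm 1 V (moll volume (rho n) σ (fun p => η p * u l p))
    have e5 : nr 1 (V - moll volume (rho n) σ (fun p => η p * u l p)) = nr 1 (fun p => V p - moll volume (rho n) σ (fun p => η p * u l p) p) := rfl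
    have e6 : nr 1 (moll volume (rho n) σ (fun p => η p * u k p) - V) = nr 1 (fun p => moll volume (rho n) σ (fun p => η p * u k p) p - V p) := rfl
    rw [e5, e6, h5]
    linarith
  have ip := int_rpow hq0 (hd k l).1
  have ie := int_rpow hq0 (eta_mul hη (hd k l).1)
  calc ∫ p, wt n p * |u k p - u l p| ^ Qs n ≤ ∫ p, (θ * |u k p - u l p| ^ Qs n + |η p * (u k p - u l p)| ^ Qs n) := by
        refine integral_mono_of_nonneg (.of_forall fun p => mul_nonneg (wt_nonneg p) (by positivity)) ((ip.const_mul θ).add ie) (.of_forall fun p => ?_)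
        have hp0 : 0 ≤ |u k p - u l p| ^ Qs n := by positivity
        have hp1 : 0 ≤ |η p * (u k p - u l p)| ^ Qs n := by positivity
        simp only
        by_cases hp : θ ≤ wt n p
        · rw [hη1 p hp, one_mul]
          have := mul_nonneg hθ0.le hp0
          nlinarith [mul_le_mul_of_nonneg_right (wt_le p) hp0]
        · push Not at hp
          nlinarith [mul_le_mul_of_nonneg_right hp.le hp0]
    _ = θ * (∫ p, |u k p - u l p| ^ Qs n) + ∫ p, |η p * (u k p - u l p)| ^ Qs n := by
        rw [integral_add (ip.const_mul θ) ie, integral_const_mul]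
    _ ≤ θ * D + (ε / 4 + C * (ε / (8 * (C + 1)) + ε / (8 * (C + 1)))) := by
        gcongr
        · rw [← nr_rpow hq0 (hd k l).1]
          have := Real.rpow_le_rpow (nr_nonneg _ _) (hdb k l) hq0.le
          linarith
        · exact h1.trans (by gcongr)
    _ ≤ ε := by
        have g1 : θ * D = ε / 2 := by rw [hθ]; field_simp
        have g2 : C * (ε / (8 * (C + 1)) + ε / (8 * (C + 1))) ≤ ε / 4 := by
          have : C * (ε / (8 * (C + 1)) + ε / (8 * (C + 1))) = ε / 4 * (C / (C + 1)) := by field_simp; ring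
          rw [this]
          have : C / (C + 1) ≤ 1 := by rw [div_le_one (by positivity)]; linarith
          nlinarith
        linarith

end P10
end HeisAux

namespace HeisAux
open ENNReal
section P11
variable {n : ℕ}

/-- the root of the weight -/
def sw (n : ℕ) (p : Pt n) : ℝ := wt n p ^ (Qs n)⁻¹

lemma sw_nonneg (p : Pt n) : 0 ≤ sw n p := Real.rpow_nonneg (wt_nonneg p) _

lemma sw_cont (hn : 1 ≤ n) : Continuous (sw n) := by
  have := Qs_gt hn
  exact wt_cont.rpow_const fun p => Or.inr (by positivity)

lemma sw_le (hn : 1 ≤ n) (p : Pt n) : sw n p ≤ 1 := by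
  have := Qs_gt hn
  exact Real.rpow_le_one (wt_nonneg p) (wt_le p) (by positivity)

lemma wt_le_sw (hn : 1 ≤ n) (p : Pt n) : wt n p ≤ sw n p := by
  have := Qs_gt hn
  have h0 : (Qs n)⁻¹ ≤ 1 := inv_le_one_of_one_le₀ (by linarith)
  have h := Real.rpow_le_rpow_of_exponent_ge' (wt_nonneg p) (wt_le p) (by positivity) h0
  rwa [Real.rpow_one] at h

lemma sw_pow (hn : 1 ≤ n) (p : Pt n) (x : ℝ) : |sw n p * x| ^ Qs n = wt n p * |x| ^ Qs n := by
  have := Qs_gt hn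
  rw [abs_mul, abs_of_nonneg (sw_nonneg p), Real.mul_rpow (sw_nonneg p) (abs_nonneg x), sw,
    ← Real.rpow_mul (wt_nonneg p), inv_mul_cancel₀ (by linarith), Real.rpow_one]

lemma sw_mem (hn : 1 ≤ n) {r : ℝ≥0∞} {u : Pt n → ℝ} (hu : MemLp u r volume) :
    MemLp (fun p => sw n p * u p) r volume := by
  refine hu.of_le ((sw_cont hn).aestronglyMeasurable.mul hu.1) (.of_forall fun p => ?_)
  rw [norm_mul, Real.norm_of_nonneg (sw_nonneg p)]
  exact mul_le_of_le_one_left (norm_nonneg _) (sw_le hn p)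

lemma sw_nr (hn : 1 ≤ n) {u : Pt n → ℝ} (hu : MemLp u (ENNReal.ofReal (Qs n)) volume) :
    nr (ENNReal.ofReal (Qs n)) (fun p => sw n p * u p) ^ Qs n = ∫ p, wt n p * |u p| ^ Qs n := by
  have := Qs_gt hn
  rw [nr_rpow (by linarith) (sw_mem hn hu)]
  simp only [sw_pow hn]

lemma MemLp_subf {r : ℝ≥0∞} {u v : Pt n → ℝ} (hu : MemLp u r volume) (hv : MemLp v r volume) :
    MemLp (fun p => u p - v p) r volume := hu.sub hv

/-- compactness -/
lemma compactness (hn : 1 ≤ n) {u : ℕ → Pt n → ℝ} {g : ℕ → Ix n → Pt n → ℝ} {Bd : ℝ}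
    (hu : ∀ k, HD n (u k) (g k)) (hc : ∀ k, IsCyl n (u k)) (hub : ∀ k, nr (ENNReal.ofReal (Qs n)) (u k) ≤ Bd)
    (hgb : ∀ k i, nr 2 (g k i) ≤ Bd) :
    ∃ φ : ℕ → ℕ, StrictMono φ ∧ ∃ U : Pt n → ℝ, ∃ G : Ix n → Pt n → ℝ, IsCyl n U ∧ HD n U G ∧
      (∀ i f, MemLp f 2 volume → Tendsto (fun k => ∫ p, f p * g (φ k) i p) atTop (𝓝 (∫ p, f p * G i p))) ∧
      (∀ᵐ p, Tendsto (fun k => u (φ k) p) atTop (𝓝 (U p))) ∧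
      Tendsto (fun k => ∫ p, wt n p * |u (φ k) p - U p| ^ Qs n) atTop (𝓝 0) := by
  have hq := Qs_gt hn
  have hq0 : 0 < Qs n := by linarith
  have hB0 : 0 ≤ Bd := (nr_nonneg _ _).trans (hub 0)
  obtain ⟨φ, hφ, hw, G, hG, hGw⟩ := wk_extract hn (fun k => (hu k).1) hub (fun k => (hu k).2.1) hgb
  have hcau := fun (ε : ℝ) (hε : 0 < ε) => wt_cauchy hn (fun k => hu (φ k)) (fun k => (hc (φ k)).rotInv)
    (fun k => hub (φ k)) (fun k => hgb (φ k)) hw hε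
  obtain ⟨ψ, hψ, hP⟩ := extraction_forall_of_eventually'
    (P := fun j k => ∀ a ≥ k, ∀ b ≥ k, ∫ p, wt n p * |u (φ a) p - u (φ b) p| ^ Qs n ≤ ((1 / 2 : ℝ) ^ (j + 1)) ^ Qs n)
    (by
      intro j
      obtain ⟨N, hN⟩ := hcau (((1 / 2 : ℝ) ^ (j + 1)) ^ Qs n) (by positivity)
      exact ⟨N, fun k hk a ha b hb => hN a (hk.trans ha) b (hk.trans hb)⟩)
  set χ : ℕ → ℕ := fun k => φ (ψ k) with hχ
  have hχm : StrictMono χ := hφ.comp hψ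
  have hm := fun k => (hu (χ k)).1
  have hWm := fun k => sw_mem hn (hm k)
  have hnr : ∀ N a b, N ≤ a → N ≤ b →
      nr (ENNReal.ofReal (Qs n)) (fun p => sw n p * (u (χ a) p - u (χ b) p)) ≤ (1 / 2 : ℝ) ^ (N + 1) := by
    intro N a b ha hb
    have h1 := hP N (ψ a) (hψ.monotone ha) (ψ b) (hψ.monotone hb)
    rw [← sw_nr hn (MemLp_subf (hm a) (hm b))] at h1
    exact (Real.rpow_le_rpow_iff (nr_nonneg _ _) (by positivity) hq0).1 h1
  have hel : ∀ N a b, N ≤ a → N ≤ b →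
      eLpNorm (fun p => sw n p * (u (χ a) p - u (χ b) p)) (ENNReal.ofReal (Qs n)) volume ≤ ENNReal.ofReal ((1 / 2 : ℝ) ^ (N + 1)) := by
    intro N a b ha hb
    rw [← ofReal_nr (sw_mem hn (MemLp_subf (hm a) (hm b)))]
    exact ENNReal.ofReal_le_ofReal (hnr N a b ha hb)
  have hae := Lp.ae_tendsto_of_cauchy_eLpNorm (p := ENNReal.ofReal (Qs n)) (B := fun N => ENNReal.ofReal ((1 / 2 : ℝ) ^ N))
    (fun k => (hWm k).1) (one_le_Qs hn)
    (by
      rw [← ENNReal.ofReal_tsum_of_nonneg (fun _ => by positivity) summable_geometric_two]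
      exact ENNReal.ofReal_ne_top)
    (by
      intro N a b ha hb
      have e : ((fun p => sw n p * u (χ a) p) - fun p => sw n p * u (χ b) p) = fun p => sw n p * (u (χ a) p - u (χ b) p) := by
        ext p; simp [mul_sub]
      rw [e]
      refine (hel N a b ha hb).trans_lt ((ENNReal.ofReal_lt_ofReal_iff (by positivity)).2 ?_)
      rw [pow_succ]
      have : (0 : ℝ) < (1 / 2) ^ N := by positivity
      linarith)
  choose v hv using hc
  set U : Pt n → ℝ := fun p => limUnder atTop (fun k => v (χ k) (znorm n p) p.2.2) with hU
  have hUc : IsCyl n U := ⟨fun r t => limUnder atTop (fun k => v (χ k) r t), fun p => rfl⟩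
  have hlim : ∀ᵐ p, Tendsto (fun k => u (χ k) p) atTop (𝓝 (U p)) := by
    filter_upwards [hae, axis_null hn] with p ⟨l, hl⟩ hp
    have hs : 0 < sw n p := Real.rpow_pos_of_pos (wt_pos.2 hp) _
    have h1 : Tendsto (fun k => u (χ k) p) atTop (𝓝 (l / sw n p)) := by
      refine (hl.div_const (sw n p)).congr fun k => ?_
      field_simp
    have : U p = l / sw n p := by
      refine Tendsto.limUnder_eq ?_
      refine h1.congr fun k => hv (χ k) p
    rwa [this]
  have hUm : AEStronglyMeasurable U volume := aestronglyMeasurable_of_tendsto_ae atTop (fun k => (hm k).1) hlim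
  have hUe : eLpNorm U (ENNReal.ofReal (Qs n)) volume ≤ ENNReal.ofReal Bd := by
    refine (Lp.eLpNorm_lim_le_liminf_eLpNorm (fun k => (hm k).1) U hlim).trans ?_
    refine liminf_le_of_frequently_le' (Frequently.of_forall fun k => ?_)
    rw [← ofReal_nr (hm k)]
    exact ENNReal.ofReal_le_ofReal (hub _)
  have hUL : MemLp U (ENNReal.ofReal (Qs n)) volume := ⟨hUm, hUe.trans_lt ENNReal.ofReal_lt_top⟩
  have hUn : nr (ENNReal.ofReal (Qs n)) U ≤ Bd := nr_le hB0 hUe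
  have hsn : ∀ k, nr (ENNReal.ofReal (Qs n)) (fun p => sw n p * (u (χ k) p - U p)) ≤ (1 / 2 : ℝ) ^ (k + 1) := by
    intro k
    refine nr_le (by positivity) ?_
    refine (Lp.eLpNorm_lim_le_liminf_eLpNorm (f := fun l p => sw n p * (u (χ k) p - u (χ l) p))
      (fun l => (sw_mem hn (MemLp_subf (hm k) (hm l))).1) _ ?_).trans ?_
    · filter_upwards [hlim] with p hp
      exact (tendsto_const_nhds.sub hp).const_mul _
    · refine liminf_le_of_frequently_le' (Eventually.frequently ?_)
      filter_upwards [eventually_ge_atTop k] with l hl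
      exact hel k k l le_rfl hl
  have hsn0 : Tendsto (fun k => nr (ENNReal.ofReal (Qs n)) (fun p => sw n p * (u (χ k) p - U p))) atTop (𝓝 0) := by
    refine squeeze_zero (fun k => nr_nonneg _ _) hsn ?_
    exact (tendsto_add_atTop_iff_nat 1).2 (tendsto_pow_atTop_nhds_zero_of_lt_one (by norm_num) (by norm_num))
  have hdn : ∀ k, nr (ENNReal.ofReal (Qs n)) (fun p => u (χ k) p - U p) ≤ 2 * Bd := by
    intro k
    have h4 : nr (ENNReal.ofReal (Qs n)) (fun p => u (χ k) p - U p) ≤ nr (ENNReal.ofReal (Qs n)) (u (χ k)) + nr (ENNReal.ofReal (Qs n)) U := by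
      refine nr_le (add_nonneg (nr_nonneg _ _) (nr_nonneg _ _)) ?_
      rw [ENNReal.ofReal_add (nr_nonneg _ _) (nr_nonneg _ _), ofReal_nr (hm k), ofReal_nr hUL]
      exact eLpNorm_sub_le (hm k).1 hUL.1 (one_le_Qs hn)
    have := hub (χ k)
    linarith
  -- weak convergence
  have hweak : ∀ f, MemLp f (Pc n) volume → Tendsto (fun k => ∫ p, f p * u (χ k) p) atTop (𝓝 (∫ p, f p * U p)) := by
    intro f hf
    let A : ℕ → Set (Pt n) := fun m => {p | 0 < wt n p} ∩ {p | wt n p < 1 / ((m : ℝ) + 1)}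
    have hA : ∀ m, MeasurableSet (A m) := fun m =>
      (isOpen_lt continuous_const wt_cont).measurableSet.inter (isOpen_lt wt_cont continuous_const).measurableSet
    let a : ℕ → Pt n → ℝ := fun m => (A m).indicator 1
    have ha : ∀ m, AEStronglyMeasurable (a m) (volume : Measure (Pt n)) := fun m =>
      (stronglyMeasurable_one.indicator (hA m)).aestronglyMeasurable
    have ha1 : ∀ m p, |a m p| ≤ 1 := by
      intro m p
      by_cases hp : p ∈ A m <;> simp [a, hp]
    have hat : ∀ p, Tendsto (fun m => a m p) atTop (𝓝 0) := by
      intro p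
      refine tendsto_const_nhds.congr' ?_
      by_cases hp : 0 < wt n p
      · have := (tendsto_one_div_add_atTop_nhds_zero_nat (𝕜 := ℝ)).eventually_lt_const hp
        filter_upwards [this] with m hm
        have : p ∉ A m := fun h => absurd h.2 (not_lt.2 hm.le)
        simp [a, this]
      · exact .of_forall fun m => by
          have : p ∉ A m := fun h => hp h.1
          simp [a, this]
    have hPc : 0 < Qs n / (Qs n - 1) := div_pos hq0 (by linarith)
    have hT := (ENNReal.tendsto_toReal ENNReal.zero_ne_top).comp (elp_dom hPc hf a ha ha1 hat)
    have hT : Tendsto (fun m => nr (Pc n) (fun p => a m p * f p)) atTop (𝓝 0) := hT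
    have hafm : ∀ m, MemLp (fun p => a m p * f p) (Pc n) volume := fun m =>
      hf.of_le ((ha m).mul hf.1) (.of_forall fun p => by
        rw [norm_mul]; exact mul_le_of_le_one_left (norm_nonneg _) (ha1 m p))
    rw [← tendsto_sub_nhds_zero_iff]
    rw [Metric.tendsto_atTop]
    intro ε hε
    obtain ⟨m, hmm⟩ := (hT.eventually_lt_const (show 0 < ε / (2 * (2 * Bd + 1)) by positivity)).exists
    have hlt := hsn0.eventually_lt_const (show 0 < ε / (2 * ((nr (Pc n) f + 1) * ((m : ℝ) + 1))) by
      have := nr_nonneg (Pc n) f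
      positivity)
    obtain ⟨N, hN⟩ := eventually_atTop.1 hlt
    refine ⟨N, fun k hk => ?_⟩
    have hd := MemLp_subf (hm k) hUL
    set w : Pt n → ℝ := fun p => u (χ k) p - U p with hwd
    have hbm : MemLp (fun p => (1 - a m p) * w p) (ENNReal.ofReal (Qs n)) volume := by
      have : MemLp (fun p => a m p * w p) (ENNReal.ofReal (Qs n)) volume :=
        hd.of_le ((ha m).mul hd.1) (.of_forall fun p => by
          rw [norm_mul]; exact mul_le_of_le_one_left (norm_nonneg _) (ha1 m p))
      refine (MemLp_subf hd this).ae_eq (.of_forall fun p => ?_)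
      simp only; ring
    have hbn : nr (ENNReal.ofReal (Qs n)) (fun p => (1 - a m p) * w p) ≤ ((m : ℝ) + 1) * nr (ENNReal.ofReal (Qs n)) (fun p => sw n p * w p) := by
      refine nr_le (mul_nonneg (by positivity) (nr_nonneg _ _)) ?_
      rw [ENNReal.ofReal_mul (by positivity), ofReal_nr (sw_mem hn hd)]
      refine eLpNorm_le_mul_eLpNorm_of_ae_le_mul ?_ _
      filter_upwards [axis_null hn] with p hp
      rw [norm_mul, norm_mul, ← mul_assoc]
      refine mul_le_mul_of_nonneg_right ?_ (norm_nonneg _)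
      rw [Real.norm_of_nonneg (sw_nonneg p)]
      by_cases hpA : p ∈ A m
      · have : a m p = 1 := by simp [a, hpA]
        rw [this]
        have := sw_nonneg p
        simp only [sub_self, norm_zero]
        positivity
      · have h0 : a m p = 0 := by simp [a, hpA]
        have h1 : 1 / ((m : ℝ) + 1) ≤ wt n p := by
          by_contra h
          exact hpA ⟨wt_pos.2 hp, not_le.1 h⟩
        have h2 := h1.trans (wt_le_sw hn p)
        rw [div_le_iff₀ (by positivity)] at h2
        rw [h0]
        simp only [sub_zero, norm_one]
        linarith
    have e : (∫ p, f p * u (χ k) p) - ∫ p, f p * U p = (∫ p, (a m p * f p) * w p) + ∫ p, f p * ((1 - a m p) * w p) := by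
      rw [← integral_sub (hol_int hn hf (hm k)) (hol_int hn hf hUL), ← integral_add (hol_int hn (hafm m) hd) (hol_int hn hf hbm)]
      congr 1; ext p; simp only [hwd]; ring
    rw [Real.dist_eq, sub_zero, e]
    refine (abs_add_le _ _).trans_lt ?_
    have h1 := hol_abs hn (hafm m) hd
    have h2 := hol_abs hn hf hbm
    have h3 : nr (Pc n) (fun p => a m p * f p) * nr (ENNReal.ofReal (Qs n)) w ≤ ε / (2 * (2 * Bd + 1)) * (2 * Bd) :=
      mul_le_mul hmm.le (hdn k) (nr_nonneg _ _) (by positivity)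
    have h3' : ε / (2 * (2 * Bd + 1)) * (2 * Bd) < ε / 2 := by
      rw [div_mul_eq_mul_div, div_lt_div_iff₀ (by positivity) (by positivity)]
      nlinarith
    have hN' := hN k hk
    have hf0 := nr_nonneg (Pc n) f
    have h4 : nr (Pc n) f * nr (ENNReal.ofReal (Qs n)) (fun p => (1 - a m p) * w p) ≤ nr (Pc n) f * (((m : ℝ) + 1) * (ε / (2 * ((nr (Pc n) f + 1) * ((m : ℝ) + 1))))) := by
      refine mul_le_mul_of_nonneg_left (hbn.trans ?_) hf0
      exact mul_le_mul_of_nonneg_left hN'.le (by positivity)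
    have h5 : nr (Pc n) f * (((m : ℝ) + 1) * (ε / (2 * ((nr (Pc n) f + 1) * ((m : ℝ) + 1))))) ≤ ε / 2 := by
      have : nr (Pc n) f * (((m : ℝ) + 1) * (ε / (2 * ((nr (Pc n) f + 1) * ((m : ℝ) + 1))))) = ε / 2 * (nr (Pc n) f / (nr (Pc n) f + 1)) := by
        field_simp
      rw [this]
      refine mul_le_of_le_one_right (by positivity) ?_
      rw [div_le_one (by positivity)]; linarith
    linarith
  have hGw' : ∀ i f, MemLp f 2 volume → Tendsto (fun k => ∫ p, f p * g (χ k) i p) atTop (𝓝 (∫ p, f p * G i p)) :=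
    fun i f hf => (hGw i f hf).comp hψ.tendsto_atTop
  refine ⟨χ, hχm, U, G, hUc, ⟨hUL, hG, fun τ hτ i => ?_⟩, hGw', hlim, ?_⟩
  · have h1 := hweak _ ((hτ.tZd i).memLp (Pc n))
    have h2 := (hGw' i τ (hτ.memLp 2)).neg
    have h3 : ∀ k, ∫ p, Zd n i τ p * u (χ k) p = -∫ p, τ p * g (χ k) i p := by
      intro k
      have := (hu (χ k)).2.2 τ hτ i
      simp only [mul_comm (u (χ k) _), mul_comm (g (χ k) i _)] at this
      exact this
    have h4 := tendsto_nhds_unique h1 (h2.congr fun k => (h3 k).symm)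
    simp only [mul_comm (U _), mul_comm (G i _)]
    exact h4
  · have h1 : Tendsto (fun k => nr (ENNReal.ofReal (Qs n)) (fun p => sw n p * (u (χ k) p - U p)) ^ Qs n) atTop (𝓝 (0 ^ Qs n)) :=
      hsn0.rpow_const (Or.inr hq0.le)
    rw [Real.zero_rpow hq0.ne'] at h1
    exact h1.congr fun k => sw_nr hn (MemLp_subf (hm k) hUL)

end P11
end HeisAux

namespace HeisAux
open ENNReal
section P12
variable {n : ℕ}

lemma bl1 {q : ℝ} (hq : 1 < q) {ε : ℝ} (hε : 0 < ε) :
    ∃ C : ℝ, 0 ≤ C ∧ ∀ a b : ℝ, |a + b| ^ q ≤ (1 + ε) * |a| ^ q + C * |b| ^ q := by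
  have hc : Tendsto (fun s : ℝ => (1 - s) ^ (1 - q)) (𝓝[>] 0) (𝓝 1) := by
    have h1 : ContinuousAt (fun s : ℝ => (1 - s) ^ (1 - q)) 0 :=
      ContinuousAt.rpow_const (by fun_prop) (Or.inl (by norm_num))
    have h2 := h1.tendsto.mono_left (nhdsWithin_le_nhds (s := Set.Ioi 0))
    simpa using h2
  have h2 : ∀ᶠ s : ℝ in 𝓝[>] 0, (1 - s) ^ (1 - q) < 1 + ε := hc.eventually_lt_const (by linarith)
  have h3 : ∀ᶠ s : ℝ in 𝓝[>] 0, s < 1 := nhdsWithin_le_nhds (eventually_lt_nhds (by norm_num))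
  obtain ⟨s, ⟨h4, h5⟩, h6⟩ := ((h2.and h3).and self_mem_nhdsWithin).exists
  have h6 : 0 < s := h6
  refine ⟨s ^ (1 - q), by positivity, fun a b => ?_⟩
  have hs : 0 < 1 - s := by linarith
  have h7 := (convexOn_rpow hq.le).2 (x := |a| / (1 - s)) (y := |b| / s) (show (0 : ℝ) ≤ |a| / (1 - s) by positivity) (show (0 : ℝ) ≤ |b| / s by positivity)
    hs.le h6.le (by ring)
  simp only [smul_eq_mul] at h7
  have e1 : (1 - s) * (|a| / (1 - s)) + s * (|b| / s) = |a| + |b| := by field_simp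
  have e2 : ∀ {x r : ℝ}, 0 < r → 0 ≤ x → r * (x / r) ^ q = r ^ (1 - q) * x ^ q := by
    intro x r hr hx
    rw [Real.div_rpow hx hr.le, Real.rpow_sub hr, Real.rpow_one]
    field_simp
  rw [e1, e2 hs (abs_nonneg a), e2 h6 (abs_nonneg b)] at h7
  have h8 : |a + b| ^ q ≤ (|a| + |b|) ^ q := Real.rpow_le_rpow (abs_nonneg _) (abs_add_le a b) (by linarith)
  have h9 : (1 - s) ^ (1 - q) * |a| ^ q ≤ (1 + ε) * |a| ^ q := mul_le_mul_of_nonneg_right h4.le (by positivity)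
  linarith

lemma bl2 {q : ℝ} (hq : 1 < q) {ε : ℝ} (hε : 0 < ε) :
    ∃ C : ℝ, 0 ≤ C ∧ ∀ a b : ℝ, |(|a + b| ^ q - |a| ^ q - |b| ^ q)| ≤ ε * |a| ^ q + C * |b| ^ q := by
  set η : ℝ := min (ε / 2) 1 with hη
  have hη0 : 0 < η := by positivity
  have hη1 : η ≤ 1 := min_le_right _ _
  have hη2 : η ≤ ε / 2 := min_le_left _ _
  obtain ⟨C, hC, h⟩ := bl1 hq hη0
  refine ⟨2 * C + 1, by positivity, fun a b => ?_⟩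
  have h1 := h a b
  have h2 := h (a + b) (-b)
  have e : a + b + -b = a := by ring
  rw [e, abs_neg] at h2
  have pa : 0 ≤ |a| ^ q := by positivity
  have pb : 0 ≤ |b| ^ q := by positivity
  have pab : 0 ≤ |a + b| ^ q := by positivity
  rw [abs_le]
  constructor
  · -- lower bound
    have h3 : η * |a + b| ^ q ≤ η * ((1 + η) * |a| ^ q + C * |b| ^ q) := mul_le_mul_of_nonneg_left h1 hη0.le
    have h4 : η * (1 + η) ≤ ε := by nlinarith
    have h5 : η * (1 + η) * |a| ^ q ≤ ε * |a| ^ q := mul_le_mul_of_nonneg_right h4 pa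
    have h6 : η * (C * |b| ^ q) ≤ 1 * (C * |b| ^ q) := mul_le_mul_of_nonneg_right hη1 (by positivity)
    nlinarith
  · have h5 : η * |a| ^ q ≤ ε * |a| ^ q := mul_le_mul_of_nonneg_right (by linarith) pa
    have := mul_nonneg hC pb
    nlinarith

lemma brezis_lieb {q : ℝ} (hq : 1 < q) {u : ℕ → Pt n → ℝ} {U : Pt n → ℝ} {D : ℝ}
    (hu : ∀ k, MemLp (u k) (ENNReal.ofReal q) volume) (hU : MemLp U (ENNReal.ofReal q) volume)
    (hlim : ∀ᵐ p, Tendsto (fun k => u k p) atTop (𝓝 (U p)))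
    (hD : ∀ k, ∫ p, |u k p - U p| ^ q ≤ D) :
    Tendsto (fun k => ∫ p, |(|u k p| ^ q - |u k p - U p| ^ q - |U p| ^ q)|) atTop (𝓝 0) := by
  have hq0 : 0 < q := by linarith
  have iu := fun k => int_rpow hq0 (hu k)
  have iU := int_rpow hq0 hU
  have iw := fun k => int_rpow hq0 (MemLp_subf (hu k) hU)
  have hD0 : 0 ≤ D := le_trans (integral_nonneg fun p => by positivity) (hD 0)
  have jf : ∀ k, Integrable (fun p => |(|u k p| ^ q - |u k p - U p| ^ q - |U p| ^ q)|) volume := fun k =>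
    (((iu k).sub (iw k)).sub iU).abs
  rw [Metric.tendsto_atTop]
  intro ε hε
  set η : ℝ := ε / (2 * (D + 1)) with hη
  have hη0 : 0 < η := by positivity
  obtain ⟨C, hC, hb⟩ := bl2 hq hη0
  let h : ℕ → Pt n → ℝ := fun k p => max (|(|u k p| ^ q - |u k p - U p| ^ q - |U p| ^ q)| - η * |u k p - U p| ^ q) 0
  have ih : ∀ k, Integrable (h k) volume := fun k => ((jf k).sub ((iw k).const_mul η)).pos_part
  have hh : Tendsto (fun k => ∫ p, h k p) atTop (𝓝 (∫ p : Pt n, (0 : ℝ))) := by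
    refine tendsto_integral_of_dominated_convergence (fun p => C * |U p| ^ q) (fun k => (ih k).1) (iU.const_mul C) ?_ ?_
    · intro k
      refine .of_forall fun p => ?_
      have h1 := hb (u k p - U p) (U p)
      rw [sub_add_cancel] at h1
      have h2 : 0 ≤ C * |U p| ^ q := by positivity
      rw [Real.norm_of_nonneg (le_max_right _ _)]
      exact max_le (by linarith) h2
    · filter_upwards [hlim] with p hp
      have a1 : Tendsto (fun k => |u k p| ^ q) atTop (𝓝 (|U p| ^ q)) := hp.abs.rpow_const (Or.inr hq0.le)
      have a2 : Tendsto (fun k => |u k p - U p| ^ q) atTop (𝓝 0) := by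
        have := (hp.sub_const (U p)).abs.rpow_const (p := q) (Or.inr hq0.le)
        simpa [Real.zero_rpow hq0.ne'] using this
      have a3 := (((a1.sub a2).sub_const (|U p| ^ q)).abs.sub (a2.const_mul η)).max (tendsto_const_nhds (x := (0 : ℝ)))
      simpa using a3
  rw [integral_zero] at hh
  obtain ⟨N, hN⟩ := eventually_atTop.1 (hh.eventually_lt_const (show 0 < ε / 2 by positivity))
  refine ⟨N, fun k hk => ?_⟩
  have h0 : 0 ≤ ∫ p, |(|u k p| ^ q - |u k p - U p| ^ q - |U p| ^ q)| := integral_nonneg fun p => abs_nonneg _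
  rw [Real.dist_eq, sub_zero, abs_of_nonneg h0]
  have h1 : ∫ p, |(|u k p| ^ q - |u k p - U p| ^ q - |U p| ^ q)| ≤ ∫ p, (h k p + η * |u k p - U p| ^ q) := by
    refine integral_mono (jf k) ((ih k).add ((iw k).const_mul η)) fun p => ?_
    have := le_max_left (|(|u k p| ^ q - |u k p - U p| ^ q - |U p| ^ q)| - η * |u k p - U p| ^ q) 0
    show _ ≤ max _ _ + _
    linarith
  rw [integral_add (ih k) ((iw k).const_mul η), integral_const_mul] at h1
  have h2 : η * (∫ p, |u k p - U p| ^ q) ≤ η * D := mul_le_mul_of_nonneg_left (hD k) hη0.le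
  have h3 : η * D ≤ ε / 2 := by
    rw [hη, div_mul_eq_mul_div, div_le_div_iff₀ (by positivity) (by positivity)]
    nlinarith
  have := hN k hk
  linarith

lemma K_bdd {K : Pt n → ℝ} {Kinf : ℝ} (hK : Continuous K) (hl : Tendsto K (cocompact (Pt n)) (𝓝 Kinf)) :
    ∃ B : ℝ, 0 ≤ B ∧ ∀ p, |K p| ≤ B := by
  have h1 : ∀ᶠ p in cocompact (Pt n), |K p| < |Kinf| + 1 := hl.abs.eventually_lt_const (by linarith)
  obtain ⟨T, hT, hTs⟩ := mem_cocompact.1 h1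
  obtain ⟨C, hC⟩ := hT.exists_bound_of_continuousOn hK.continuousOn
  refine ⟨max C (|Kinf| + 1), by positivity, fun p => ?_⟩
  by_cases hp : p ∈ T
  · exact (hC p hp).trans (le_max_left _ _)
  · exact (le_of_lt (hTs hp)).trans (le_max_right _ _)

lemma K_up {K : Pt n → ℝ} {Kinf δ : ℝ} (hK : Continuous K) (hl : Tendsto K (cocompact (Pt n)) (𝓝 Kinf))
    (hδ : δ = sSup (Set.range fun t : ℝ => max (K (0, 0, t)) 0)) :
    0 ≤ δ ∧ ∀ ε > 0, ∃ C : ℝ, 0 ≤ C ∧ ∀ p, K p ≤ δ + ε + C * wt n p := by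
  obtain ⟨B, hB, hKB⟩ := K_bdd hK hl
  have hbdd : BddAbove (Set.range fun t : ℝ => max (K (0, 0, t)) 0) := by
    refine ⟨B, ?_⟩
    rintro _ ⟨t, rfl⟩
    exact max_le ((le_abs_self _).trans (hKB _)) hB
  have hax : ∀ t : ℝ, max (K (0, 0, t)) 0 ≤ δ := fun t => by
    rw [hδ]; exact le_csSup hbdd ⟨t, rfl⟩
  have hδ0 : 0 ≤ δ := (le_max_right _ _).trans (hax 0)
  have hinf : Kinf ≤ δ := by
    have h1 : Tendsto (fun t : ℝ => ((0, 0, t) : Pt n)) (cocompact ℝ) (cocompact (Pt n)) := by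
      refine Topology.IsClosedEmbedding.tendsto_cocompact ?_
      refine Topology.IsClosedEmbedding.of_continuous_injective_isClosedMap (by fun_prop) ?_ ?_
      · intro a b h; simpa using h
      · refine (Isometry.of_dist_eq fun a b => ?_).isClosedEmbedding.isClosedMap
        simp [Prod.dist_eq]
    exact le_of_tendsto (hl.comp h1) (.of_forall fun t => (le_max_left _ _).trans (hax t))
  refine ⟨hδ0, fun ε hε => ?_⟩
  have h1 : ∀ᶠ p in cocompact (Pt n), K p < δ + ε := hl.eventually_lt_const (by linarith)
  obtain ⟨T, hT, hTs⟩ := mem_cocompact.1 h1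
  set T' : Set (Pt n) := {p | δ + ε ≤ K p} with hT'
  have hT'c : IsCompact T' := by
    refine hT.of_isClosed_subset (isClosed_le continuous_const hK) fun p hp => ?_
    by_contra h
    exact absurd (show K p < δ + ε from hTs h) (not_lt.2 hp)
  have hpos : ∀ p ∈ T', 0 < wt n p := by
    intro p hp
    rw [wt_pos]
    by_contra h
    have h0 : zsq n p = 0 := le_antisymm (not_lt.1 h) (zsq_nonneg p)
    unfold zsq at h0
    have hx : 0 ≤ ∑ i, p.1 i ^ 2 := by positivity
    have hy : 0 ≤ ∑ i, p.2.1 i ^ 2 := by positivity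
    have ex : p.1 = 0 := by
      have : ∑ i, p.1 i ^ 2 = 0 := by linarith
      rw [Finset.sum_eq_zero_iff_of_nonneg (fun i _ => sq_nonneg _)] at this
      ext i
      exact pow_eq_zero_iff (two_ne_zero) |>.1 (this i (Finset.mem_univ i))
    have ey : p.2.1 = 0 := by
      have : ∑ i, p.2.1 i ^ 2 = 0 := by linarith
      rw [Finset.sum_eq_zero_iff_of_nonneg (fun i _ => sq_nonneg _)] at this
      ext i
      exact pow_eq_zero_iff (two_ne_zero) |>.1 (this i (Finset.mem_univ i))
    have ep : p = (0, 0, p.2.2) := Prod.ext ex (Prod.ext ey rfl)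
    have h2 := (le_max_left _ _).trans (hax p.2.2)
    rw [← ep] at h2
    have h3 : δ + ε ≤ K p := hp
    linarith
  rcases T'.eq_empty_or_nonempty with he | hne
  · refine ⟨0, le_rfl, fun p => ?_⟩
    have : p ∉ T' := by rw [he]; exact fun h => h
    have : ¬ δ + ε ≤ K p := this
    linarith
  · obtain ⟨p₀, hp₀, hmin⟩ := hT'c.exists_isMinOn hne (wt_cont (n := n)).continuousOn
    have hm := hpos p₀ hp₀
    refine ⟨B / wt n p₀, by positivity, fun p => ?_⟩
    by_cases hp : p ∈ T'
    · have h2 : wt n p₀ ≤ wt n p := hmin hp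
      have h3 : B ≤ B / wt n p₀ * wt n p := by
        rw [div_mul_eq_mul_div, le_div_iff₀ hm]
        exact mul_le_mul_of_nonneg_left h2 hB
      have := (le_abs_self _).trans (hKB p)
      linarith
    · have h4 : ¬ δ + ε ≤ K p := hp
      have : 0 ≤ B / wt n p₀ * wt n p := mul_nonneg (by positivity) (wt_nonneg p)
      linarith

end P12
end HeisAux

namespace HeisAux
open ENNReal
section P13
variable {n : ℕ}

lemma energy_eq {g : Ix n → Pt n → ℝ} (hg : ∀ i, MemLp (g i) 2 volume) :
    ∫ p : Pt n, ∑ j, ((g (Sum.inl j) p) ^ 2 + (g (Sum.inr j) p) ^ 2) = ∑ i, nr 2 (g i) ^ 2 := by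
  have hi : ∀ i, Integrable (fun p => g i p ^ 2) volume := fun i => (hg i).integrable_sq
  have hj : ∀ j : Fin n, Integrable (fun p => g (Sum.inl j) p ^ 2 + g (Sum.inr j) p ^ 2) volume := fun j => (hi _).add (hi _)
  rw [integral_finsetSum _ (fun j _ => hj j), Fintype.sum_sum_type, ← Finset.sum_add_distrib]
  refine Finset.sum_congr rfl fun j _ => ?_
  rw [integral_add (hi _) (hi _), nr_sq (hg _), nr_sq (hg _)]

lemma mem_iff (K : Pt n → ℝ) (u : Pt n → ℝ) :
    (IsCyl n u ∧ MemLp u (ENNReal.ofReal (Qs n)) volume ∧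
        (∃ G : Pt n → (Fin n → ℝ) × (Fin n → ℝ), HasWeakHGrad n u G ∧
          (∫ p : Pt n, ∑ j, (((G p).1 j) ^ 2 + ((G p).2 j) ^ 2)) = 1) ∧
        0 < ∫ p : Pt n, K p * |u p| ^ Qs n) ↔
    (IsCyl n u ∧ (∃ g : Ix n → Pt n → ℝ, HD n u g ∧ ∑ i, nr 2 (g i) ^ 2 = 1) ∧ 0 < ∫ p : Pt n, K p * |u p| ^ Qs n) := by
  constructor
  · rintro ⟨h1, h2, ⟨G, ⟨hG, hw⟩, h3⟩, h4⟩
    let g : Ix n → Pt n → ℝ := fun i p => Sum.elim (fun j => (G p).1 j) (fun j => (G p).2 j) i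
    have hg : ∀ i, MemLp (g i) 2 volume := by
      rintro (j | j)
      · exact (hG j).1
      · exact (hG j).2
    refine ⟨h1, ⟨g, ⟨h2, hg, ?_⟩, ?_⟩, h4⟩
    · rintro φ hφ (j | j)
      · rw [Zd_inl]; exact (hw φ hφ j).1
      · rw [Zd_inr]; exact (hw φ hφ j).2
    · rw [← energy_eq hg]; exact h3
  · rintro ⟨h1, ⟨g, ⟨h2, hg, hw⟩, h3⟩, h4⟩
    refine ⟨h1, h2, ⟨fun p => (fun j => g (Sum.inl j) p, fun j => g (Sum.inr j) p), ⟨fun j => ⟨hg _, hg _⟩, fun φ hφ j => ⟨?_, ?_⟩⟩, ?_⟩, h4⟩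
    · rw [← Zd_inl]; exact hw φ hφ _
    · rw [← Zd_inr]; exact hw φ hφ _
    · rw [← energy_eq hg] at h3; exact h3

lemma K_int {q : ℝ} (hq : 0 < q) {K : Pt n → ℝ} (hK : Continuous K) {B : ℝ} (hKB : ∀ p, |K p| ≤ B)
    {u : Pt n → ℝ} (hu : MemLp u (ENNReal.ofReal q) volume) : Integrable (fun p => K p * |u p| ^ q) volume :=
  (int_rpow hq hu).bdd_mul hK.aestronglyMeasurable (.of_forall hKB)

lemma nr_pow_le (hn : 1 ≤ n) {S : ℝ} (hSpos : 0 < S) {u : Pt n → ℝ} (hu : MemLp u (ENNReal.ofReal (Qs n)) volume) {e : ℝ}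
    (h : S * nr (ENNReal.ofReal (Qs n)) u ^ 2 ≤ e) : ∫ p, |u p| ^ Qs n ≤ (e / S) ^ (Qs n / 2) := by
  have hq := Qs_gt hn
  rw [← nr_rpow (by linarith) hu]
  have h1 : nr (ENNReal.ofReal (Qs n)) u ^ 2 ≤ e / S := by rw [le_div_iff₀ hSpos]; linarith
  have h2 := Real.rpow_le_rpow (sq_nonneg _) h1 (show 0 ≤ Qs n / 2 by linarith)
  have e2 : (nr (ENNReal.ofReal (Qs n)) u ^ 2) ^ (Qs n / 2) = nr (ENNReal.ofReal (Qs n)) u ^ Qs n := by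
    rw [← Real.rpow_natCast, ← Real.rpow_mul (nr_nonneg _ _)]
    congr 1; push_cast; ring
  rwa [e2] at h2

/-- weak convergence: energy splitting -/
lemma energy_split {g : ℕ → Ix n → Pt n → ℝ} {G : Ix n → Pt n → ℝ} (hg : ∀ k i, MemLp (g k i) 2 volume)
    (hG : ∀ i, MemLp (G i) 2 volume) (h1 : ∀ k, ∑ i, nr 2 (g k i) ^ 2 = 1)
    (hw : ∀ i, Tendsto (fun k => ∫ p, G i p * g k i p) atTop (𝓝 (∫ p, G i p * G i p))) :
    Tendsto (fun k => ∑ i, nr 2 (fun p => g k i p - G i p) ^ 2) atTop (𝓝 (1 - ∑ i, nr 2 (G i) ^ 2)) := by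
  have e : ∀ k i, nr 2 (fun p => g k i p - G i p) ^ 2 = nr 2 (g k i) ^ 2 - 2 * (∫ p, G i p * g k i p) + nr 2 (G i) ^ 2 := by
    intro k i
    rw [nr_sq (MemLp_subf (hg k i) (hG i)), nr_sq (hg k i), nr_sq (hG i)]
    have i1 := (hg k i).integrable_sq
    have i2 := (hG i).integrable_sq
    have i3 : Integrable (fun p => G i p * g k i p) volume := (hG i).integrable_mul (hg k i)
    have i4 : Integrable (fun p => g k i p ^ 2 - 2 * (G i p * g k i p)) volume := i1.sub (i3.const_mul 2)
    rw [← integral_const_mul, ← integral_sub i1 (i3.const_mul 2), ← integral_add i4 i2]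
    congr 1; ext p; ring
  have e2 : ∀ k, ∑ i, nr 2 (fun p => g k i p - G i p) ^ 2 = 1 - 2 * (∑ i, ∫ p, G i p * g k i p) + ∑ i, nr 2 (G i) ^ 2 := by
    intro k
    simp only [e, Finset.sum_add_distrib, Finset.sum_sub_distrib, h1 k, Finset.mul_sum]
  have h2 : Tendsto (fun k => ∑ i, ∫ p, G i p * g k i p) atTop (𝓝 (∑ i, nr 2 (G i) ^ 2)) := by
    refine tendsto_finsetSum _ fun i _ => ?_
    rw [nr_sq (hG i)]
    simp only [sq]
    exact hw i
  have h3 := ((h2.const_mul 2).const_sub 1).add_const (∑ i, nr 2 (G i) ^ 2)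
  refine (h3.congr fun k => (e2 k).symm).trans (le_of_eq ?_)
  congr 1; ring

lemma main (hn : 1 ≤ n) (K : Pt n → ℝ) (Kinf : ℝ)
    (hKcont : Continuous K)
    (hKlim : Tendsto K (cocompact (Pt n)) (𝓝 Kinf))
    (S δ : ℝ)
    (hS : S = sInf { c : ℝ | ∃ v : Pt n → ℝ, TestFun n v ∧
        (∫ p : Pt n, |v p| ^ Qs n) ^ (2 / Qs n) = 1 ∧
        c = ∫ p : Pt n, hGradSq n v p })
    (hSpos : 0 < S)
    (hδ : δ = sSup (Set.range fun t : ℝ => max (K (0, 0, t)) 0))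
    (M : Set (Pt n → ℝ))
    (hM : ∀ u, u ∈ M ↔ (IsCyl n u ∧ (∃ g : Ix n → Pt n → ℝ, HD n u g ∧ ∑ i, nr 2 (g i) ^ 2 = 1) ∧ 0 < ∫ p : Pt n, K p * |u p| ^ Qs n))
    (hMne : M.Nonempty)
    (hV : 0 < δ → ∃ V ∈ M, δ * (1 / S) ^ (Qs n / 2) ≤ ∫ p : Pt n, K p * |V p| ^ Qs n) :
    ∃ u ∈ M, ∀ v ∈ M, (∫ p : Pt n, K p * |v p| ^ Qs n) ≤ ∫ p : Pt n, K p * |u p| ^ Qs n := by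
  have hq := Qs_gt hn
  have hq0 : 0 < Qs n := by linarith
  obtain ⟨Kb, hKb0, hKb⟩ := K_bdd hKcont hKlim
  obtain ⟨hδ0, hKup⟩ := K_up hKcont hKlim hδ
  set J : (Pt n → ℝ) → ℝ := fun u => ∫ p : Pt n, K p * |u p| ^ Qs n with hJ
  have hJK : ∀ u, MemLp u (ENNReal.ofReal (Qs n)) volume → J u ≤ Kb * ∫ p, |u p| ^ Qs n := by
    intro u hu
    rw [← integral_const_mul]
    exact integral_mono (K_int hq0 hKcont hKb hu) ((int_rpow hq0 hu).const_mul Kb) fun p =>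
      mul_le_mul_of_nonneg_right ((le_abs_self _).trans (hKb p)) (by positivity)
  have hbd : BddAbove (J '' M) := by
    refine ⟨Kb * (1 / S) ^ (Qs n / 2), ?_⟩
    rintro _ ⟨u, hu, rfl⟩
    obtain ⟨hc, ⟨g, hg, h1⟩, -⟩ := (hM u).1 hu
    have h2 := sobolev hn hS hg hc.rotInv
    rw [h1] at h2
    exact (hJK u hg.1).trans (mul_le_mul_of_nonneg_left (nr_pow_le hn hSpos hg.1 h2) hKb0)
  set A : ℝ := sSup (J '' M) with hA
  have hAub : ∀ v ∈ M, J v ≤ A := fun v hv => le_csSup hbd ⟨v, hv, rfl⟩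
  by_contra! hcon
  have hlt : ∀ u ∈ M, J u < A := by
    intro u hu
    obtain ⟨v, hv, h⟩ := hcon u hu
    exact lt_of_lt_of_le h (hAub v hv)
  have hA0 : 0 < A := by
    obtain ⟨u, hu⟩ := hMne
    exact ((hM u).1 hu).2.2.trans (hlt u hu)
  set B : ℝ := δ * (1 / S) ^ (Qs n / 2) with hB
  have hB0 : 0 ≤ B := by positivity
  have hBA : B < A := by
    rcases hδ0.eq_or_lt with h | h
    · rw [hB, ← h, zero_mul]; exact hA0
    · obtain ⟨V, hVM, hVl⟩ := hV h
      exact lt_of_le_of_lt hVl (hlt V hVM)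
  obtain ⟨x, -, hx, hxm⟩ := exists_seq_tendsto_sSup (hMne.image J) hbd
  choose u huM huJ using hxm
  choose hc hg hpos using fun k => (hM (u k)).1 (huM k)
  choose g hg hg1 using hg
  have hnr2 : ∀ k, nr (ENNReal.ofReal (Qs n)) (u k) ^ 2 ≤ 1 / S := by
    intro k
    have h2 := sobolev hn hS (hg k) (hc k).rotInv
    rw [hg1 k] at h2
    rw [le_div_iff₀ hSpos]; linarith
  have hub : ∀ k, nr (ENNReal.ofReal (Qs n)) (u k) ≤ 1 / S + 1 := fun k => by
    have := hnr2 k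
    nlinarith [sq_nonneg (nr (ENNReal.ofReal (Qs n)) (u k) - 1)]
  have hS1 : 0 < 1 / S := by positivity
  have hgb : ∀ k i, nr 2 (g k i) ≤ 1 / S + 1 := fun k i => by
    have h1 : nr 2 (g k i) ^ 2 ≤ ∑ i, nr 2 (g k i) ^ 2 :=
      Finset.single_le_sum (fun i _ => sq_nonneg (nr 2 (g k i))) (Finset.mem_univ i)
    rw [hg1 k] at h1
    nlinarith [sq_nonneg (nr 2 (g k i) - 1)]
  obtain ⟨φ, hφ, U, G, hUc, hU, hGw, hae, hwt⟩ := compactness hn hg hc hub hgb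
  have hsplit := energy_split (fun k => (hg (φ k)).2.1) hU.2.1 (fun k => hg1 (φ k)) (fun i => hGw i (G i) (hU.2.1 i))
  set a : ℝ := ∑ i, nr 2 (G i) ^ 2 with ha
  have ha0 : 0 ≤ a := Finset.sum_nonneg fun i _ => sq_nonneg _
  have ha1 : 0 ≤ 1 - a := ge_of_tendsto hsplit (.of_forall fun k => Finset.sum_nonneg fun i _ => sq_nonneg _)
  have hw := fun k => HD.sub hn (hg (φ k)) hU
  have hwr : ∀ k, RotInv n (fun p => u (φ k) p - U p) := fun k θ p => by
    show u (φ k) _ - U _ = _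
    rw [(hc (φ k)).rotInv, hUc.rotInv]
  have hwS := fun k => nr_pow_le hn hSpos (hw k).1 (sobolev hn hS (hw k) (hwr k))
  have hdlim : Tendsto (fun k => ((∑ i, nr 2 (fun p => g (φ k) i p - G i p) ^ 2) / S) ^ (Qs n / 2)) atTop (𝓝 (((1 - a) / S) ^ (Qs n / 2))) :=
    (hsplit.div_const S).rpow_const (Or.inr (by linarith))
  obtain ⟨D, hD⟩ := hdlim.bddAbove_range
  have hwD : ∀ k, ∫ p, |u (φ k) p - U p| ^ Qs n ≤ D := fun k => (hwS k).trans (hD ⟨k, rfl⟩)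
  have hBL := brezis_lieb (by linarith) (fun k => (hg (φ k)).1) hU.1 hae hwD
  have hx' : Tendsto (fun k => J (u (φ k))) atTop (𝓝 A) := by
    have := hx.comp hφ.tendsto_atTop
    exact this.congr fun k => (huJ (φ k)).symm
  have hkey : ∀ ε > 0, A ≤ J U + (δ + ε) * ((1 - a) / S) ^ (Qs n / 2) := by
    intro ε hε
    obtain ⟨C, hC, hKC⟩ := hKup ε hε
    have hstep : ∀ k, J (u (φ k)) ≤ J U + ((δ + ε) * ((∑ i, nr 2 (fun p => g (φ k) i p - G i p) ^ 2) / S) ^ (Qs n / 2)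
        + C * ∫ p, wt n p * |u (φ k) p - U p| ^ Qs n) + Kb * ∫ p, |(|u (φ k) p| ^ Qs n - |u (φ k) p - U p| ^ Qs n - |U p| ^ Qs n)| := by
      intro k
      have iw := int_rpow hq0 (hw k).1
      have iu := int_rpow hq0 (hg (φ k)).1
      have iU := int_rpow hq0 hU.1
      have iwt : Integrable (fun p => wt n p * |u (φ k) p - U p| ^ Qs n) volume :=
        iw.bdd_mul (c := 1) wt_cont.aestronglyMeasurable (.of_forall fun p => by
          rw [Real.norm_of_nonneg (wt_nonneg p)]; exact wt_le p)
      have iabs : Integrable (fun p => |(|u (φ k) p| ^ Qs n - |u (φ k) p - U p| ^ Qs n - |U p| ^ Qs n)|) volume :=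
        ((iu.sub iw).sub iU).abs
      have iKU := K_int hq0 hKcont hKb hU.1
      have iKu := K_int hq0 hKcont hKb (hg (φ k)).1
      have h1 : J (u (φ k)) ≤ ∫ p, (K p * |U p| ^ Qs n + ((δ + ε) * |u (φ k) p - U p| ^ Qs n + C * (wt n p * |u (φ k) p - U p| ^ Qs n))
          + Kb * |(|u (φ k) p| ^ Qs n - |u (φ k) p - U p| ^ Qs n - |U p| ^ Qs n)|) := by
        refine integral_mono iKu ((iKU.add ((iw.const_mul _).add (iwt.const_mul _))).add (iabs.const_mul _)) fun p => ?_
        simp only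
        set X := |u (φ k) p| ^ Qs n
        set Y := |u (φ k) p - U p| ^ Qs n with hY
        set Z := |U p| ^ Qs n
        have hY0 : 0 ≤ Y := by positivity
        have m1 : K p * (X - Y - Z) ≤ Kb * |X - Y - Z| := by
          refine (le_abs_self _).trans ?_
          rw [abs_mul]
          exact mul_le_mul_of_nonneg_right (hKb p) (abs_nonneg _)
        have m2 := mul_le_mul_of_nonneg_right (hKC p) hY0
        nlinarith
      have e1 := integral_add (iKU.add ((iw.const_mul (δ + ε)).add (iwt.const_mul C))) (iabs.const_mul Kb)
      have e2 := integral_add iKU ((iw.const_mul (δ + ε)).add (iwt.const_mul C))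
      have e3 := integral_add (iw.const_mul (δ + ε)) (iwt.const_mul C)
      simp only [Pi.add_apply] at e1 e2 e3
      rw [e1, e2, e3, integral_const_mul, integral_const_mul, integral_const_mul] at h1
      have h2 := mul_le_mul_of_nonneg_left (hwS k) (show 0 ≤ δ + ε by linarith)
      show J _ ≤ (∫ p, K p * |U p| ^ Qs n) + _ + _
      linarith
    have hlim := (tendsto_const_nhds (x := J U)).add ((hdlim.const_mul (δ + ε)).add (hwt.const_mul C)) |>.add (hBL.const_mul Kb)
    have := le_of_tendsto_of_tendsto' hx' hlim hstep
    simpa using this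
  have hP0 : 0 ≤ ((1 - a) / S) ^ (Qs n / 2) := by positivity
  have hkey2 : A ≤ J U + δ * ((1 - a) / S) ^ (Qs n / 2) := by
    refine le_of_forall_pos_le_add fun ε hε => ?_
    have h1 := hkey (ε / (((1 - a) / S) ^ (Qs n / 2) + 1)) (by positivity)
    have h2 : ε / (((1 - a) / S) ^ (Qs n / 2) + 1) * ((1 - a) / S) ^ (Qs n / 2) ≤ ε := by
      rw [div_mul_eq_mul_div, div_le_iff₀ (by positivity)]
      nlinarith
    nlinarith
  have hsep : δ * ((1 - a) / S) ^ (Qs n / 2) = B * (1 - a) ^ (Qs n / 2) := by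
    rw [hB, div_eq_mul_one_div, Real.mul_rpow ha1 hS1.le]; ring
  rw [hsep] at hkey2
  have hq2 : 1 ≤ Qs n / 2 := by linarith
  have ha1' : a ≤ 1 := by linarith
  have hJU : J U ≤ A * a := by
    have hpa : a ^ (Qs n / 2) ≤ a := by
      have := Real.rpow_le_rpow_of_exponent_ge' ha0 ha1' zero_le_one hq2
      rwa [Real.rpow_one] at this
    rcases ha0.eq_or_lt with h0 | h0
    · have h1 := nr_pow_le hn hSpos hU.1 (sobolev hn hS hU hUc.rotInv)
      rw [← ha, ← h0, zero_div, Real.zero_rpow (by linarith)] at h1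
      have h2 := hJK U hU.1
      rw [← h0, mul_zero]
      nlinarith
    · by_cases hneg : J U ≤ 0
      · exact hneg.trans (by positivity)
      push Not at hneg
      set c : ℝ := a ^ (-(1 / 2) : ℝ) with hcd
      have hc0 : 0 < c := Real.rpow_pos_of_pos h0 _
      have hc2 : c ^ 2 * a = 1 := by
        rw [hcd, ← Real.rpow_natCast, ← Real.rpow_mul ha0]
        norm_num
        rw [Real.rpow_neg_one, inv_mul_cancel₀ h0.ne']
      have hcq : c ^ Qs n * a ^ (Qs n / 2) = 1 := by
        rw [hcd, ← Real.rpow_mul ha0, ← Real.rpow_add h0]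
        have : -(1 / 2) * Qs n + Qs n / 2 = 0 := by ring
        rw [this, Real.rpow_zero]
      have hJc : J (fun p => c * U p) = c ^ Qs n * J U := by
        simp only [hJ]
        rw [← integral_const_mul]
        congr 1; ext p
        rw [abs_mul, abs_of_pos hc0, Real.mul_rpow hc0.le (abs_nonneg _)]; ring
      have hcn : ∀ i, nr 2 (fun p => c * G i p) ^ 2 = c ^ 2 * nr 2 (G i) ^ 2 := by
        intro i
        rw [nr_sq ((hU.smul c).2.1 i), nr_sq (hU.2.1 i), ← integral_const_mul]
        congr 1; ext p; ring
      have hmem : (fun p => c * U p) ∈ M := by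
        rw [hM]
        refine ⟨?_, ⟨_, hU.smul c, ?_⟩, ?_⟩
        · obtain ⟨v, hv⟩ := hUc
          exact ⟨fun r t => c * v r t, fun p => by simp only [hv p]⟩
        · simp only [hcn]
          rw [← Finset.mul_sum]; exact hc2
        · show 0 < J _
          rw [hJc]; positivity
      have h3 := hAub _ hmem
      rw [hJc] at h3
      have hpp : 0 < a ^ (Qs n / 2) := Real.rpow_pos_of_pos h0 _
      have h4 : J U = c ^ Qs n * J U * a ^ (Qs n / 2) := by
        rw [mul_right_comm, hcq, one_mul]
      have h5 : J U ≤ A * a ^ (Qs n / 2) := by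
        rw [h4]; exact mul_le_mul_of_nonneg_right h3 hpp.le
      exact h5.trans (mul_le_mul_of_nonneg_left hpa hA0.le)
  have hpb : (1 - a) ^ (Qs n / 2) ≤ 1 - a := by
    have := Real.rpow_le_rpow_of_exponent_ge' ha1 (by linarith) zero_le_one hq2
    rwa [Real.rpow_one] at this
  have haone : a = 1 := by
    have h1 := mul_le_mul_of_nonneg_left hpb hB0
    nlinarith
  rw [haone, sub_self, Real.zero_rpow (by linarith), mul_zero, add_zero] at hkey2
  have hUM : U ∈ M := by
    rw [hM]
    exact ⟨hUc, ⟨G, hU, haone⟩, lt_of_lt_of_le hA0 hkey2⟩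
  exact absurd (hlt U hUM) (not_lt.2 hkey2)

end P13
end HeisAux

open HeisAux

theorem constrained_infimum_attained (n : ℕ) (hn : 1 ≤ n)
    (K : Pt n → ℝ) (Kinf : ℝ)
    (hKcont : Continuous K)
    (hKcyl : IsCyl n K)
    (hKlim : Tendsto K (cocompact (Pt n)) (𝓝 Kinf))
    (hKpos : ∃ p : Pt n, 0 < K p)
    (S δ : ℝ)
    (hS : S = sInf { c : ℝ | ∃ v : Pt n → ℝ, TestFun n v ∧
        (∫ p : Pt n, |v p| ^ Qs n) ^ (2 / Qs n) = 1 ∧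
        c = ∫ p : Pt n, hGradSq n v p })
    (hSpos : 0 < S)
    (hδ : δ = sSup (Set.range fun t : ℝ => max (K (0, 0, t)) 0))
    (M : Set (Pt n → ℝ))
    (hM : M = { u | IsCyl n u ∧ MemLp u (ENNReal.ofReal (Qs n)) volume ∧
        (∃ G : Pt n → (Fin n → ℝ) × (Fin n → ℝ), HasWeakHGrad n u G ∧
          (∫ p : Pt n, ∑ j, (((G p).1 j) ^ 2 + ((G p).2 j) ^ 2)) = 1) ∧
        0 < ∫ p : Pt n, K p * |u p| ^ Qs n })
    (hMne : M.Nonempty)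
    (hV : 0 < δ → ∃ V ∈ M,
        (∫ p : Pt n, K p * |V p| ^ Qs n) ^ (-(Qh n - 2) / 2)
          ≤ δ ^ (-(Qh n - 2) / 2) * S ^ (Qh n / 2)) :
    ∃ u ∈ M, ∀ v ∈ M,
      (∫ p : Pt n, K p * |u p| ^ Qs n) ^ (-(Qh n - 2) / 2)
        ≤ (∫ p : Pt n, K p * |v p| ^ Qs n) ^ (-(Qh n - 2) / 2) := by
  have hM' : ∀ u, u ∈ M ↔ (IsCyl n u ∧ (∃ g : Ix n → Pt n → ℝ, HD n u g ∧ ∑ i, nr 2 (g i) ^ 2 = 1) ∧ 0 < ∫ p : Pt n, K p * |u p| ^ Qs n) := by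
    intro u
    rw [hM]
    exact mem_iff K u
  have hn0 : (0 : ℝ) < n := by exact_mod_cast hn
  have e1 : -(Qh n - 2) / 2 = -(n : ℝ) := by unfold Qh; ring
  have hpos : ∀ u ∈ M, 0 < ∫ p : Pt n, K p * |u p| ^ Qs n := fun u hu => ((hM' u).1 hu).2.2
  obtain ⟨u, hu, hmax⟩ := main hn K Kinf hKcont hKlim S δ hS hSpos hδ M hM' hMne (by
    intro hd
    obtain ⟨V, hVM, hVl⟩ := hV hd
    refine ⟨V, hVM, ?_⟩
    have hp := hpos V hVM
    rw [e1] at hVl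
    set j := ∫ p : Pt n, K p * |V p| ^ Qs n
    by_contra! hlt
    have h1 := Real.rpow_lt_rpow_of_neg hp hlt (show -(n : ℝ) < 0 by linarith)
    have h2 : (δ * (1 / S) ^ (Qs n / 2)) ^ (-(n : ℝ)) = δ ^ (-(n : ℝ)) * S ^ (Qh n / 2) := by
      rw [Real.mul_rpow hd.le (by positivity), ← Real.rpow_mul (by positivity), one_div, Real.inv_rpow hSpos.le,
        ← Real.rpow_neg hSpos.le]
      congr 2
      rw [Qs_eq hn]
      unfold Qh
      field_simp
    rw [h2] at h1
    linarith)
  refine ⟨u, hu, fun v hv => ?_⟩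
  rw [e1]
  exact Real.rpow_le_rpow_of_nonpos (hpos v hv) (hmax v hv) (by linarith)
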